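/- arXiv:2504.07006 — 2 statements merged into one kernel-verified Lean document; each statement's English description precedes it below -/
import Mathlib

section
/- There exists a constant C > 0 such that the following holds. Let W be a linear subspace of 𝔽₂ⁿ, let X, Y, D ⊆ W be nonempty subsets, and set δ = |X|·|Y|·|D|/|W|³. Let ε ∈ (0, 1/2) and let r be an integer with r ≥ C·ε^{-7}·(log(2/δ))^8. If X or Y is (r, ε/8)-algebraically spread within W, then |S(X, Y, D)| ≤ (1+ε)·δ·|W|². -/
/-- A subset `X` of the linear subspace `W ⊆ 𝔽₂ⁿ` is `(r, ε)`-algebraically spread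
within `W` if `X` has no density increment on any affine subspace of `W` of
codimension at most `r` (Definition 5.1 of the paper). -/
def AlgebraicallySpread (n : ℕ) (W : Submodule (ZMod 2) (Fin n → ZMod 2))
    (X : Set (Fin n → ZMod 2)) (r : ℕ) (ε : ℝ) : Prop :=
  ∀ (W' : Submodule (ZMod 2) (Fin n → ZMod 2)) (a : Fin n → ZMod 2),
    ((a + ·) '' (W' : Set (Fin n → ZMod 2))) ⊆ (W : Set (Fin n → ZMod 2)) →
    Module.finrank (ZMod 2) W ≤ Module.finrank (ZMod 2) W' + r →
    (Nat.card ↥(X ∩ ((a + ·) '' (W' : Set (Fin n → ZMod 2)))) : ℝ) / (Nat.card ↥W' : ℝ) ≤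
      (1 + ε) * ((Nat.card ↥X : ℝ) / (Nat.card ↥W : ℝ))

/-- The container set `S(X, Y, D)` (Section 5.1 of the paper). -/
def Container (n : ℕ) (X Y D : Set (Fin n → ZMod 2)) :
    Set ((Fin n → ZMod 2) × (Fin n → ZMod 2)) :=
  {p | p.1 ∈ X ∧ p.2 ∈ Y ∧ p.1 + p.2 ∈ D}


set_option linter.unusedSectionVars false
namespace CSUB
open Finset

section fourier
variable {G : Type*} [AddCommGroup G] [Module (ZMod 2) G] [Fintype G] [DecidableEq G]

lemma zadd_self (x : G) : x + x = 0 := ZModModule.add_self x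

lemma zadd_cancel (x y : G) : x + y + y = x := by rw [add_assoc, zadd_self, add_zero]

/-- The real character attached to a linear functional. -/
noncomputable def chi (φ : Module.Dual (ZMod 2) G) (x : G) : ℝ := if φ x = 0 then 1 else -1

noncomputable instance dualFintype : Fintype (Module.Dual (ZMod 2) G) :=
  @Fintype.ofFinite _ (Module.finite_of_finite (ZMod 2))

lemma zcase (a : ZMod 2) : a = 0 ∨ a = 1 := by revert a; decide

lemma one_add_one_z : (1 : ZMod 2) + 1 = 0 := by decide

lemma chi_add_right (φ : Module.Dual (ZMod 2) G) (x y : G) :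
    chi φ (x + y) = chi φ x * chi φ y := by
  unfold chi
  rw [map_add]
  rcases zcase (φ x) with h | h <;> rcases zcase (φ y) with h' | h' <;> simp [h, h', one_add_one_z]

lemma chi_add_left (φ ψ : Module.Dual (ZMod 2) G) (x : G) :
    chi (φ + ψ) x = chi φ x * chi ψ x := by
  unfold chi
  rw [LinearMap.add_apply]
  rcases zcase (φ x) with h | h <;> rcases zcase (ψ x) with h' | h' <;> simp [h, h', one_add_one_z]

lemma chi_zero_left (x : G) : chi (0 : Module.Dual (ZMod 2) G) x = 1 := by simp [chi]

lemma chi_zero_right (φ : Module.Dual (ZMod 2) G) : chi φ (0 : G) = 1 := by simp [chi]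

lemma abs_chi (φ : Module.Dual (ZMod 2) G) (x : G) : |chi φ x| = 1 := by
  unfold chi; split_ifs <;> simp

lemma chi_mul_self (φ : Module.Dual (ZMod 2) G) (x : G) : chi φ x * chi φ x = 1 := by
  unfold chi; split_ifs <;> simp

lemma chi_sum_left {ι : Type*} (s : Finset ι) (φ : ι → Module.Dual (ZMod 2) G) (x : G) :
    chi (∑ i ∈ s, φ i) x = ∏ i ∈ s, chi (φ i) x := by
  classical
  induction s using Finset.induction_on with
  | empty => simp [chi_zero_left]
  | insert a s ha ih => rw [sum_insert ha, prod_insert ha, chi_add_left, ih]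

lemma sum_chi (φ : Module.Dual (ZMod 2) G) (h : φ ≠ 0) : ∑ x : G, chi φ x = 0 := by
  obtain ⟨y, hy⟩ : ∃ y, φ y ≠ 0 := by
    by_contra! hc
    exact h (LinearMap.ext hc)
  have h1 : ∑ x : G, chi φ (x + y) = ∑ x : G, chi φ x :=
    Fintype.sum_equiv (Equiv.addRight y) _ _ (fun x => rfl)
  have h2 : chi φ y = -1 := by simp [chi, hy]
  simp only [chi_add_right, h2] at h1
  rw [← sum_mul] at h1
  linarith

lemma card_dual : Fintype.card (Module.Dual (ZMod 2) G) = Fintype.card G := by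
  rw [← Nat.card_eq_fintype_card, ← Nat.card_eq_fintype_card,
    Module.natCard_eq_pow_finrank (K := ZMod 2), Module.natCard_eq_pow_finrank (K := ZMod 2) (V := G),
    Subspace.dual_finrank_eq]

lemma sum_dual (x : G) :
    ∑ φ : Module.Dual (ZMod 2) G, chi φ x = if x = 0 then (Fintype.card G : ℝ) else 0 := by
  split_ifs with h
  · simp [h, chi_zero_right, card_dual]
  · obtain ⟨ψ, hψ⟩ : ∃ ψ : Module.Dual (ZMod 2) G, ψ x ≠ 0 := by
      by_contra! hc
      exact h ((Module.forall_dual_apply_eq_zero_iff (ZMod 2) x).1 hc)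
    have h1 : ∑ φ : Module.Dual (ZMod 2) G, chi (φ + ψ) x = ∑ φ : Module.Dual (ZMod 2) G, chi φ x :=
      Fintype.sum_equiv (Equiv.addRight ψ) _ _ (fun x => rfl)
    have h2 : chi ψ x = -1 := by simp [chi, hψ]
    simp only [chi_add_left, h2] at h1
    rw [← sum_mul] at h1
    linarith

/-- Fourier transform. -/
noncomputable def ft (f : G → ℝ) (φ : Module.Dual (ZMod 2) G) : ℝ := ∑ x, f x * chi φ x

/-- Convolution. -/
noncomputable def conv (f g : G → ℝ) (z : G) : ℝ := ∑ x, f x * g (z + x)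

lemma ft_conv (f g : G → ℝ) (φ : Module.Dual (ZMod 2) G) :
    ft (conv f g) φ = ft f φ * ft g φ := by
  unfold ft conv
  rw [Finset.sum_mul]
  simp only [Finset.sum_mul]
  rw [Finset.sum_comm]
  refine Finset.sum_congr rfl fun x _ => ?_
  rw [Finset.mul_sum]
  refine Fintype.sum_equiv (Equiv.addRight x) _ _ (fun z => ?_)
  simp only [Equiv.coe_addRight, chi_add_right]
  linear_combination (-(f x * g (z + x) * chi φ z)) * chi_mul_self φ x

lemma ft_inv (f : G → ℝ) (y : G) :
    ∑ φ, ft f φ * chi φ y = (Fintype.card G : ℝ) * f y := by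
  unfold ft
  simp only [Finset.sum_mul]
  rw [Finset.sum_comm]
  have : ∀ x : G, ∑ φ : Module.Dual (ZMod 2) G, f x * chi φ x * chi φ y =
      if x = y then (Fintype.card G : ℝ) * f y else 0 := by
    intro x
    have h1 : ∀ φ : Module.Dual (ZMod 2) G, f x * chi φ x * chi φ y = f x * chi φ (x + y) := by
      intro φ; rw [chi_add_right, mul_assoc]
    simp only [h1]
    rw [← Finset.mul_sum, sum_dual]
    by_cases h : x = y
    · subst h; simp [zadd_self]; ring
    · have : x + y ≠ 0 := by
        intro hc
        apply h
        have := zadd_cancel x y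
        rw [hc, zero_add] at this
        exact this.symm
      simp [h, this]
  simp only [this]
  simp

lemma ft_inj (f g : G → ℝ) (h : ∀ φ, ft f φ = ft g φ) : f = g := by
  funext y
  have h1 := ft_inv f y
  have h2 := ft_inv g y
  simp only [h] at h1
  have hN : (Fintype.card G : ℝ) ≠ 0 := by
    have : Nonempty G := ⟨0⟩
    exact_mod_cast Fintype.card_ne_zero
  have := h1.symm.trans h2
  exact mul_left_cancel₀ hN this

lemma parseval (f : G → ℝ) :
    ∑ φ, ft f φ ^ 2 = (Fintype.card G : ℝ) * ∑ x, f x ^ 2 := by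
  have h1 : ∀ φ, ft f φ ^ 2 = ft (conv f f) φ * chi φ (0:G) := by
    intro φ; rw [ft_conv, chi_zero_right]; ring
  simp only [h1]
  rw [ft_inv]
  simp [conv, sq]

/-- Normalised indicator. -/
noncomputable def mu (A : Finset G) (x : G) : ℝ := if x ∈ A then (A.card : ℝ)⁻¹ else 0

lemma mu_nonneg (A : Finset G) (x : G) : 0 ≤ mu A x := by unfold mu; split_ifs <;> positivity

lemma sum_mu_mul (A : Finset G) (f : G → ℝ) : ∑ x, mu A x * f x = (A.card : ℝ)⁻¹ * ∑ x ∈ A, f x := by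
  simp [mu, ite_mul, Finset.mul_sum]

lemma sum_mu (A : Finset G) (hA : A.Nonempty) : ∑ x, mu A x = 1 := by
  have := sum_mu_mul A (fun _ => 1)
  simp only [mul_one] at this
  rw [this]
  have : (A.card : ℝ) ≠ 0 := by exact_mod_cast hA.card_pos.ne'
  simp [this]

lemma sum_mu_sq (A : Finset G) (hA : A.Nonempty) : ∑ x, mu A x ^ 2 = (A.card : ℝ)⁻¹ := by
  have : ∀ x, mu A x ^ 2 = mu A x * (A.card : ℝ)⁻¹ := by
    intro x; unfold mu; split_ifs <;> ring
  simp only [this]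
  rw [← Finset.sum_mul, sum_mu A hA, one_mul]

lemma ft_abs_le (f : G → ℝ) (φ : Module.Dual (ZMod 2) G) : |ft f φ| ≤ ∑ x, |f x| := by
  unfold ft
  refine (Finset.abs_sum_le_sum_abs _ _).trans (le_of_eq ?_)
  simp [abs_mul, abs_chi]

lemma ft_mu_abs_le (A : Finset G) (hA : A.Nonempty) (φ : Module.Dual (ZMod 2) G) :
    |ft (mu A) φ| ≤ 1 := by
  refine (ft_abs_le _ φ).trans ?_
  simp only [abs_of_nonneg (mu_nonneg A _)]
  rw [sum_mu A hA]

/-- Chang's bound for linearly independent large-spectrum elements. -/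
lemma chang (T : Finset G) (hT : T.Nonempty) (d : ℕ) (φ : Fin d → Module.Dual (ZMod 2) G)
    (hli : LinearIndependent (ZMod 2) φ) (hs : ∀ i, 1 / 2 ≤ |ft (mu T) (φ i)|) :
    (d : ℝ) ≤ 8 * Real.log ((Fintype.card G : ℝ) / T.card) := by
  have hTc : (0 : ℝ) < T.card := by exact_mod_cast hT.card_pos
  have hN : (0 : ℝ) < Fintype.card G := by
    have : Nonempty G := ⟨0⟩
    exact_mod_cast Fintype.card_pos
  set s : Fin d → ℝ := fun i => if 0 ≤ ft (mu T) (φ i) then 1 else -1 with hsdef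
  have hs1 : ∀ i, s i = 1 ∨ s i = -1 := by
    intro i; simp only [hsdef]; split_ifs <;> simp
  have hs2 : ∀ i, s i * ft (mu T) (φ i) = |ft (mu T) (φ i)| := by
    intro i; simp only [hsdef]; split_ifs with h
    · rw [abs_of_nonneg h, one_mul]
    · rw [abs_of_neg (not_le.1 h)]; ring
  set y : G → ℝ := fun x => ∑ i, (1/2) * (s i * chi (φ i) x) with hy
  -- lower bound
  have hlow : (d : ℝ) / 4 * T.card ≤ ∑ x ∈ T, y x := by
    have h1 : (T.card : ℝ)⁻¹ * ∑ x ∈ T, y x = ∑ i, (1/2) * |ft (mu T) (φ i)| := by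
      rw [← sum_mu_mul]
      simp only [hy, Finset.mul_sum]
      rw [Finset.sum_comm]
      refine Finset.sum_congr rfl fun i _ => ?_
      rw [← hs2 i, ft, Finset.mul_sum, Finset.mul_sum]
      refine Finset.sum_congr rfl fun x _ => by ring
    have h2 : (d : ℝ) / 4 ≤ ∑ i, (1/2) * |ft (mu T) (φ i)| := by
      have : ∑ i : Fin d, (1 / 4 : ℝ) ≤ ∑ i, (1/2) * |ft (mu T) (φ i)| :=
        Finset.sum_le_sum fun i _ => by have := hs i; linarith
      simp at this
      linarith
    rw [← h1] at h2
    rw [inv_mul_eq_div, le_div_iff₀ hTc] at h2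
    exact h2
  have hup : ∑ x : G, Real.exp (y x) = (Fintype.card G : ℝ) * Real.cosh (1/2) ^ d := by
    have h1 : ∀ x, Real.exp (y x) = ∏ i, (Real.cosh (1/2) + s i * Real.sinh (1/2) * chi (φ i) x) := by
      intro x
      rw [hy, Real.exp_sum]
      refine Finset.prod_congr rfl fun i _ => ?_
      have hc : chi (φ i) x = 1 ∨ chi (φ i) x = -1 := by unfold chi; split_ifs <;> simp
      have e1 := Real.cosh_add_sinh (1/2)
      have e2 := Real.cosh_sub_sinh (1/2)
      rcases hs1 i with h | h <;> rcases hc with h' | h' <;> rw [h, h'] <;> ring_nf at e1 e2 ⊢ <;> linarith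
    simp only [h1, Finset.prod_add]
    rw [Finset.sum_comm]
    rw [Finset.sum_eq_single Finset.univ]
    · simp
    · intro I _ hI
      simp only [Finset.prod_mul_distrib, ← chi_sum_left]
      rw [← Finset.mul_sum, ← Finset.mul_sum, sum_chi]
      · simp
      · intro h0
        have hne : (Finset.univ \ I).Nonempty := by
          rw [Finset.nonempty_iff_ne_empty]
          intro he
          rw [Finset.sdiff_eq_empty_iff_subset] at he
          exact hI (Finset.univ_subset_iff.1 he)
        obtain ⟨j, hj⟩ := hne
        have := (linearIndependent_iff'.1 hli) (Finset.univ \ I) (fun _ => 1) (by simpa using h0) j hj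
        exact one_ne_zero this
    · simp
  have hjen : (T.card : ℝ) * Real.exp (d / 4) ≤ ∑ x ∈ T, Real.exp (y x) := by
    have h1 : ∀ x ∈ T, Real.exp (d/4) * (1 + y x - d/4) ≤ Real.exp (y x) := by
      intro x _
      have := Real.add_one_le_exp (y x - d/4)
      calc _ ≤ Real.exp (d/4) * Real.exp (y x - d/4) := by
            apply mul_le_mul_of_nonneg_left _ (Real.exp_pos _).le; linarith
        _ = _ := by rw [← Real.exp_add]; ring_nf
    refine le_trans ?_ (Finset.sum_le_sum h1)
    rw [← Finset.mul_sum, mul_comm]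
    apply mul_le_mul_of_nonneg_left _ (Real.exp_pos _).le
    simp only [Finset.sum_sub_distrib, Finset.sum_add_distrib, Finset.sum_const, nsmul_eq_mul]
    linarith
  have hcosh : Real.cosh (1/2) ^ d ≤ Real.exp (d / 8) := by
    calc Real.cosh (1/2) ^ d ≤ (Real.exp ((1/2)^2/2)) ^ d :=
          pow_le_pow_left₀ (Real.cosh_pos _).le (Real.cosh_le_exp_half_sq _) _
      _ = _ := by rw [← Real.exp_nat_mul]; ring_nf
  have hfin : (T.card : ℝ) * Real.exp (d / 4) ≤ Fintype.card G * Real.exp (d/8) := by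
    refine hjen.trans ?_
    refine (Finset.sum_le_univ_sum_of_nonneg (fun x => (Real.exp_pos _).le)).trans ?_
    rw [hup]
    exact mul_le_mul_of_nonneg_left hcosh hN.le
  have : Real.exp (d / 8) ≤ (Fintype.card G : ℝ) / T.card := by
    rw [le_div_iff₀ hTc]
    have e : Real.exp (d / 4) = Real.exp (d/8) * Real.exp (d/8) := by rw [← Real.exp_add]; ring_nf
    rw [e] at hfin
    have hp := Real.exp_pos ((d:ℝ)/8)
    have : Real.exp (d/8) * (Real.exp (d/8) * T.card) ≤ Real.exp (d/8) * Fintype.card G := by linarith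
    exact le_of_mul_le_mul_left this hp
  have := (Real.le_log_iff_exp_le (by positivity)).2 this
  linarith

/-- The annihilator of the large spectrum. -/
lemma exists_V (T : Finset G) (hT : T.Nonempty) :
    ∃ V : Submodule (ZMod 2) G,
      (∀ φ : Module.Dual (ZMod 2) G, 1 / 2 ≤ |ft (mu T) φ| → ∀ v ∈ V, φ v = 0) ∧
      (Module.finrank (ZMod 2) G : ℝ) ≤ Module.finrank (ZMod 2) V +
        8 * Real.log ((Fintype.card G : ℝ) / T.card) := by
  set Sp : Set (Module.Dual (ZMod 2) G) := {φ | 1 / 2 ≤ |ft (mu T) φ|} with hSp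
  obtain ⟨f, hf1, hf2, hf3⟩ := Submodule.exists_fun_fin_finrank_span_eq (ZMod 2) Sp
  refine ⟨(Submodule.span (ZMod 2) Sp).dualCoannihilator, ?_, ?_⟩
  · intro φ hφ v hv
    rw [Submodule.mem_dualCoannihilator] at hv
    exact hv φ (Submodule.subset_span hφ)
  · have h1 := chang T hT _ f hf3 hf1
    have h2 := Subspace.finrank_add_finrank_dualCoannihilator_eq (Submodule.span (ZMod 2) Sp)
    have h3 : (Module.finrank (ZMod 2) G : ℝ) = Module.finrank (ZMod 2) (Submodule.span (ZMod 2) Sp)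
      + Module.finrank (ZMod 2) (Submodule.span (ZMod 2) Sp).dualCoannihilator := by
      exact_mod_cast h2.symm
    linarith

end fourier
end CSUB

set_option linter.unusedSectionVars false
namespace CSUB
open Finset
section cs
lemma chernoff {G : Type*} [DecidableEq G] (A : Finset G) (y : G → ℝ) (hy : ∀ a ∈ A, |y a| ≤ 1)
    (h0 : ∑ a ∈ A, y a = 0) (m : ℕ) (η : ℝ) (hη0 : 0 ≤ η) (hη1 : η ≤ 1) :
    (((Fintype.piFinset (fun _ : Fin m => A)).filter (fun a => (m : ℝ) * η < ∑ i, y (a i))).card : ℝ)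
      ≤ Real.exp (-(m * η ^ 2 / 4)) * (A.card : ℝ) ^ m := by
  classical
  set P := Fintype.piFinset (fun _ : Fin m => A) with hP
  have h1 : ∑ a ∈ P, ∏ i, Real.exp (η / 2 * y (a i)) = (∑ a ∈ A, Real.exp (η / 2 * y a)) ^ m := by
    have := (Finset.prod_univ_sum (fun _ : Fin m => A) (fun _ a => Real.exp (η / 2 * y a))).symm
    simpa [hP] using this
  have h2 : ∑ a ∈ A, Real.exp (η / 2 * y a) ≤ A.card * Real.exp (η ^ 2 / 4) := by
    have : ∀ a ∈ A, Real.exp (η / 2 * y a) ≤ (1 + η ^ 2 / 4) + η / 2 * y a := by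
      intro a ha
      have hya := abs_le.1 (hy a ha)
      have hb : |η / 2 * y a| ≤ 1 := by
        rw [abs_mul, abs_of_nonneg (by positivity)]
        nlinarith [hy a ha, abs_nonneg (y a)]
      have h3 := (abs_le.1 (Real.abs_exp_sub_one_sub_id_le hb)).2
      have h4 : y a ^ 2 ≤ 1 := by nlinarith
      have h5 : (η / 2 * y a) ^ 2 ≤ η ^ 2 / 4 := by
        rw [mul_pow]; nlinarith [sq_nonneg η]
      linarith
    refine (Finset.sum_le_sum this).trans ?_
    rw [Finset.sum_add_distrib, ← Finset.mul_sum, h0, Finset.sum_const, nsmul_eq_mul, mul_zero, add_zero]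
    apply mul_le_mul_of_nonneg_left _ (Nat.cast_nonneg _)
    have := Real.add_one_le_exp (η ^ 2 / 4)
    linarith
  have h3 : ((P.filter (fun a => (m : ℝ) * η < ∑ i, y (a i))).card : ℝ) * Real.exp (m * η ^ 2 / 2)
      ≤ ∑ a ∈ P, ∏ i, Real.exp (η / 2 * y (a i)) := by
    refine le_trans ?_ (Finset.sum_le_sum_of_subset_of_nonneg (Finset.filter_subset
      (fun a => (m : ℝ) * η < ∑ i, y (a i)) P) (fun _ _ _ => Finset.prod_nonneg fun _ _ => (Real.exp_pos _).le))
    rw [← nsmul_eq_mul]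
    refine Finset.card_nsmul_le_sum _ _ _ ?_
    intro a ha
    have ha := (Finset.mem_filter.1 ha).2
    rw [← Real.exp_sum, ← Finset.mul_sum]
    apply Real.exp_le_exp.2
    nlinarith
  have h4 : (∑ a ∈ A, Real.exp (η / 2 * y a)) ^ m ≤ (A.card : ℝ) ^ m * Real.exp (m * η ^ 2 / 4) := by
    refine (pow_le_pow_left₀ (Finset.sum_nonneg fun _ _ => (Real.exp_pos _).le) h2 m).trans ?_
    rw [mul_pow, ← Real.exp_nat_mul]
    apply le_of_eq; ring_nf
  rw [h1] at h3
  have h5 := h3.trans h4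
  have e1 : Real.exp (m * η ^ 2 / 2) = Real.exp (m * η ^ 2 / 4) * Real.exp (m * η ^ 2 / 4) := by
    rw [← Real.exp_add]; ring_nf
  rw [Real.exp_neg, inv_mul_eq_div, le_div_iff₀ (Real.exp_pos _)]
  rw [e1] at h5
  refine le_of_mul_le_mul_right ?_ (Real.exp_pos (m * η ^ 2 / 4))
  linarith

variable {G : Type*} [AddCommGroup G] [Module (ZMod 2) G] [Fintype G] [DecidableEq G]

lemma card_filter_shift (p : G → Prop) [DecidablePred p] (t : G) :
    (Finset.univ.filter (fun z => p (z + t))).card = (Finset.univ.filter p).card := by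
  refine Finset.card_bij (fun z _ => z + t) ?_ ?_ ?_
  · intro z hz; simpa using hz
  · intro a _ b _ h; simpa using h
  · intro b hb; exact ⟨b - t, by simpa using hb, by simp⟩

/-- Croot-Sisask almost periodicity in measure. -/
lemma croot_sisask (A : Finset G) (hA : A.Nonempty) (U : G → ℝ) (hU0 : ∀ x, 0 ≤ U x) (hU1 : ∀ x, U x ≤ 1)
    (g : G → ℝ) (hg : ∀ z, (A.card : ℝ) * g z = ∑ a ∈ A, U (z + a))
    (m : ℕ) (hm : 0 < m) (η : ℝ) (hη0 : 0 ≤ η) (hη1 : η ≤ 1) :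
    ∃ T : Finset G, (A.card : ℝ) ^ m * Fintype.card G ≤ 2 * T.card * (Fintype.card G : ℝ) ^ m ∧
      ∀ t ∈ T, ∀ t' ∈ T, ((Finset.univ.filter (fun z => 2 * η < |g (z + t) - g (z + t')|)).card : ℝ) ≤
        8 * Real.exp (-(m * η ^ 2 / 4)) * Fintype.card G := by
  classical
  set N : ℝ := (Fintype.card G : ℝ) with hN
  have hN0 : 0 < N := by
    have : Nonempty G := ⟨0⟩
    rw [hN]; exact_mod_cast Fintype.card_pos
  have hmR : (0 : ℝ) < m := by exact_mod_cast hm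
  have hAc : (0 : ℝ) < A.card := by exact_mod_cast hA.card_pos
  set κ := Real.exp (-(m * η ^ 2 / 4)) with hκ
  set P := Fintype.piFinset (fun _ : Fin m => A) with hP
  have hPc : (P.card : ℝ) = (A.card : ℝ) ^ m := by simp [hP]
  let dv : (Fin m → G) → G → ℝ := fun a z => ∑ i, (U (z + a i) - g z)
  let isbad : (Fin m → G) → G → Prop := fun a z => (m : ℝ) * η < |dv a z|
  have hg01 : ∀ z, 0 ≤ g z ∧ g z ≤ 1 := by
    intro z
    have h := hg z
    have h1 : 0 ≤ ∑ a ∈ A, U (z + a) := Finset.sum_nonneg fun _ _ => hU0 _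
    have h2 : ∑ a ∈ A, U (z + a) ≤ A.card := by
      refine (Finset.sum_le_sum fun a _ => hU1 (z + a)).trans ?_
      simp
    rw [← h] at h1 h2
    constructor
    · exact nonneg_of_mul_nonneg_right h1 hAc
    · nlinarith
  have hz : ∀ z, ((P.filter (fun a => isbad a z)).card : ℝ) ≤ 2 * κ * (A.card : ℝ) ^ m := by
    intro z
    have hs : ∑ a ∈ A, (U (z + a) - g z) = 0 := by
      rw [Finset.sum_sub_distrib, ← hg z]; simp
    have hab : ∀ a ∈ A, |U (z + a) - g z| ≤ 1 := by
      intro a _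
      rw [abs_le]
      have := hg01 z; have := hU0 (z + a); have := hU1 (z + a)
      constructor <;> linarith
    have c1 := chernoff A (fun a => U (z + a) - g z) hab hs m η hη0 hη1
    have c2 := chernoff A (fun a => -(U (z + a) - g z)) (by intro a ha; rw [abs_neg]; exact hab a ha)
      (by rw [Finset.sum_neg_distrib, hs, neg_zero]) m η hη0 hη1
    have hsub : P.filter (fun a => isbad a z) ⊆
        P.filter (fun a => (m : ℝ) * η < ∑ i, (U (z + a i) - g z)) ∪
        P.filter (fun a => (m : ℝ) * η < ∑ i, -(U (z + a i) - g z)) := by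
      intro a ha
      rw [Finset.mem_filter] at ha
      rw [Finset.mem_union, Finset.mem_filter, Finset.mem_filter]
      obtain ⟨ha1, ha2⟩ := ha
      simp only [isbad, dv] at ha2
      rcases lt_abs.1 ha2 with h | h
      · exact Or.inl ⟨ha1, h⟩
      · right; refine ⟨ha1, ?_⟩; rw [Finset.sum_neg_distrib]; exact h
    have := (Nat.cast_le (α := ℝ)).2 ((Finset.card_le_card hsub).trans (Finset.card_union_le _ _))
    push_cast at this
    linarith
  let nb : (Fin m → G) → ℝ := fun a => ((Finset.univ.filter (fun z => isbad a z)).card : ℝ)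
  have hsum : ∑ a ∈ P, nb a ≤ 2 * κ * (A.card : ℝ) ^ m * N := by
    have h1 : ∑ a ∈ P, nb a = ∑ z : G, ((P.filter (fun a => isbad a z)).card : ℝ) := by
      simp only [nb, Finset.card_filter]
      push_cast
      rw [Finset.sum_comm]
    rw [h1]
    refine (Finset.sum_le_sum fun z _ => hz z).trans ?_
    rw [Finset.sum_const, nsmul_eq_mul, Finset.card_univ, mul_comm]
  set Gd := P.filter (fun a => nb a ≤ 4 * κ * N) with hGd
  have hGdc : (A.card : ℝ) ^ m ≤ 2 * Gd.card := by
    have h1 : ((P.filter (fun a => ¬ nb a ≤ 4 * κ * N)).card : ℝ) * (4 * κ * N) ≤ ∑ a ∈ P, nb a := by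
      refine le_trans ?_ (Finset.sum_le_sum_of_subset_of_nonneg (Finset.filter_subset
        (fun a => ¬ nb a ≤ 4 * κ * N) P) (fun _ _ _ => Nat.cast_nonneg _))
      rw [← nsmul_eq_mul]
      refine Finset.card_nsmul_le_sum _ _ _ ?_
      intro a ha
      exact (not_le.1 (Finset.mem_filter.1 ha).2).le
    have h2 := h1.trans hsum
    have h3 : ((P.filter (fun a => ¬ nb a ≤ 4 * κ * N)).card : ℝ) * 2 ≤ (A.card : ℝ) ^ m := by
      have hp : 0 < 2 * κ * N := by have := Real.exp_pos (-(m * η ^ 2 / 4)); positivity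
      refine le_of_mul_le_mul_right ?_ hp
      linarith
    have h4 := Finset.card_filter_add_card_filter_not (s := P) (fun a => nb a ≤ 4 * κ * N)
    have h4' : (Gd.card : ℝ) + ((P.filter (fun a => ¬ nb a ≤ 4 * κ * N)).card : ℝ) = P.card := by
      exact_mod_cast h4
    linarith
  -- pigeonhole
  have hpig : ∃ x : Fin m → G, (Gd.card : ℝ) * N ≤
      ((Finset.univ.filter (fun t : G => (fun i => x i + t) ∈ Gd)).card : ℝ) * N ^ m := by
    by_contra! hc
    have h1 : ∑ x : Fin m → G, ((Finset.univ.filter (fun t : G => (fun i => x i + t) ∈ Gd)).card : ℝ)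
        = N * Gd.card := by
      simp only [Finset.card_filter]
      push_cast
      rw [Finset.sum_comm]
      have : ∀ t : G, ∑ x : Fin m → G, (if (fun i => x i + t) ∈ Gd then (1:ℝ) else 0) = Gd.card := by
        intro t
        have := Fintype.sum_equiv (Equiv.addRight (fun _ : Fin m => t))
          (fun x : Fin m → G => (if (fun i => x i + t) ∈ Gd then (1:ℝ) else 0))
          (fun x => if x ∈ Gd then (1:ℝ) else 0) (fun x => rfl)
        rw [this]; simp
      simp only [this]
      rw [Finset.sum_const, nsmul_eq_mul, Finset.card_univ]
    have h2 : ∑ x : Fin m → G, ((Finset.univ.filter (fun t : G => (fun i => x i + t) ∈ Gd)).card : ℝ) * N ^ m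
        < ∑ x : Fin m → G, (Gd.card : ℝ) * N :=
      Finset.sum_lt_sum_of_nonempty Finset.univ_nonempty (fun x _ => hc x)
    rw [← Finset.sum_mul, h1, Finset.sum_const, nsmul_eq_mul, Finset.card_univ] at h2
    simp only [Fintype.card_fun, Fintype.card_fin] at h2
    push_cast at h2
    rw [← hN] at h2
    linarith
  obtain ⟨x, hx⟩ := hpig
  refine ⟨Finset.univ.filter (fun t : G => (fun i => x i + t) ∈ Gd), ?_, ?_⟩
  · nlinarith
  · have key : ∀ t : G, (fun i => x i + t) ∈ Gd →
        ((Finset.univ.filter (fun z => (m : ℝ) * η < |∑ i, (U (z + x i) - g (z + t))|)).card : ℝ) ≤ 4 * κ * N := by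
      intro t ht
      have h1 := (Finset.mem_filter.1 ht).2
      simp only [nb, isbad, dv] at h1
      rw [← card_filter_shift _ t] at h1
      refine le_trans (le_of_eq ?_) h1
      congr 2
      ext z
      simp only [Finset.mem_filter, Finset.mem_univ, true_and]
      have : ∀ i, z + t + (x i + t) = z + x i := by
        intro i
        have : t + t = 0 := ZModModule.add_self t
        calc z + t + (x i + t) = z + x i + (t + t) := by abel
          _ = _ := by rw [this, add_zero]
      simp only [this]
    intro t ht t' ht'
    have k1 := key t (Finset.mem_filter.1 ht).2
    have k2 := key t' (Finset.mem_filter.1 ht').2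
    have hsub : Finset.univ.filter (fun z => 2 * η < |g (z + t) - g (z + t')|) ⊆
      (Finset.univ.filter (fun z => (m : ℝ) * η < |∑ i, (U (z + x i) - g (z + t))|)) ∪
      (Finset.univ.filter (fun z => (m : ℝ) * η < |∑ i, (U (z + x i) - g (z + t'))|)) := by
      intro z hz
      simp only [Finset.mem_filter, Finset.mem_univ, true_and, Finset.mem_union] at hz ⊢
      by_contra! hc
      obtain ⟨c1, c2⟩ := hc
      rw [Finset.sum_sub_distrib, Finset.sum_const, nsmul_eq_mul, Finset.card_univ, Fintype.card_fin] at c1 c2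
      have h3 : |(m:ℝ) * (g (z + t) - g (z + t'))| ≤ 2 * (m * η) := by
        rw [abs_le] at *
        constructor <;> linarith
      rw [abs_mul, abs_of_pos hmR] at h3
      nlinarith
    have := (Nat.cast_le (α := ℝ)).2 ((Finset.card_le_card hsub).trans (Finset.card_union_le _ _))
    push_cast at this
    linarith
end cs
end CSUB

set_option linter.unusedSectionVars false
namespace CSUB
open Finset
section ap
variable {G : Type*} [AddCommGroup G] [Module (ZMod 2) G] [Fintype G] [DecidableEq G]

lemma conv_mu_le (A : Finset G) (hA : A.Nonempty) (f : G → ℝ) (c : ℝ) (h : ∀ x, f x ≤ c) (z : G) :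
    conv (mu A) f z ≤ c := by
  unfold conv
  calc ∑ x, mu A x * f (z + x) ≤ ∑ x, mu A x * c :=
        Finset.sum_le_sum fun x _ => mul_le_mul_of_nonneg_left (h _) (mu_nonneg A x)
    _ = c := by rw [← Finset.sum_mul, sum_mu A hA, one_mul]

lemma conv_mu_ge (A : Finset G) (hA : A.Nonempty) (f : G → ℝ) (c : ℝ) (h : ∀ x, c ≤ f x) (z : G) :
    c ≤ conv (mu A) f z := by
  unfold conv
  calc c = ∑ x, mu A x * c := by rw [← Finset.sum_mul, sum_mu A hA, one_mul]
    _ ≤ ∑ x, mu A x * f (z + x) :=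
        Finset.sum_le_sum fun x _ => mul_le_mul_of_nonneg_left (h _) (mu_nonneg A x)

lemma conv_mu_gt (A : Finset G) (hA : A.Nonempty) (f : G → ℝ) (c : ℝ) (h : ∀ x, c < f x) (z : G) :
    c < conv (mu A) f z := by
  have : Nonempty G := ⟨0⟩
  obtain ⟨x0, hx0⟩ := Finite.exists_min f
  exact lt_of_lt_of_le (h x0) (conv_mu_ge A hA f (f x0) hx0 z)

lemma conv_sub_right (f g h : G → ℝ) (z : G) :
    conv f (fun x => g x - h x) z = conv f g z - conv f h z := by
  simp [conv, mul_sub, Finset.sum_sub_distrib]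

lemma conv_mu_abs (A : Finset G) (hA : A.Nonempty) (f : G → ℝ) (c : ℝ) (h : ∀ x ∈ A, |f x| ≤ c) :
    |conv (mu A) f 0| ≤ c := by
  have hAc : (0 : ℝ) < A.card := by exact_mod_cast hA.card_pos
  have : conv (mu A) f 0 = (A.card : ℝ)⁻¹ * ∑ x ∈ A, f x := by
    rw [← sum_mu_mul]; simp [conv]
  rw [this, abs_mul, abs_of_pos (by positivity), inv_mul_eq_div, div_le_iff₀ hAc]
  refine (Finset.abs_sum_le_sum_abs _ _).trans ?_
  refine (Finset.sum_le_card_nsmul _ _ c h).trans ?_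
  rw [nsmul_eq_mul, mul_comm]

/-- Averaging twice over `T`. -/
noncomputable def PP (T : Finset G) (f : G → ℝ) : G → ℝ := conv (mu T) (conv (mu T) f)

lemma ft_PP_iter (T : Finset G) (f : G → ℝ) (k : ℕ) (φ : Module.Dual (ZMod 2) G) :
    ft ((PP T)^[k] f) φ = ft (mu T) φ ^ (2 * k) * ft f φ := by
  induction k with
  | zero => simp
  | succ k ih =>
    rw [Function.iterate_succ_apply', PP, ft_conv, ft_conv, ih]; ring

lemma PP_iter_gt (T : Finset G) (hT : T.Nonempty) (f : G → ℝ) (c : ℝ) (h : ∀ x, c < f x) (k : ℕ) :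
    ∀ z, c < (PP T)^[k] f z := by
  induction k with
  | zero => exact h
  | succ k ih =>
    intro z
    rw [Function.iterate_succ_apply', PP]
    exact conv_mu_gt T hT _ c (conv_mu_gt T hT _ c ih) z

lemma PP_close (T : Finset G) (hT : T.Nonempty) (f : G → ℝ) (e : ℝ)
    (h : ∀ t ∈ T, ∀ t' ∈ T, ∀ w, f (w + t + t') - f w ≤ e) (w : G) : PP T f w ≤ f w + e := by
  have hTc : (0 : ℝ) < T.card := by exact_mod_cast hT.card_pos
  have h1 : PP T f w = ∑ t, mu T t * ∑ t', mu T t' * f (w + t + t') := rfl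
  rw [h1, sum_mu_mul]
  have h2 : ∀ t ∈ T, ∑ t', mu T t' * f (w + t + t') ≤ f w + e := by
    intro t ht
    rw [sum_mu_mul, inv_mul_eq_div, div_le_iff₀ hTc]
    refine (Finset.sum_le_card_nsmul _ _ (f w + e) (fun t' ht' => ?_)).trans ?_
    · have := h t ht t' ht' w; linarith
    · rw [nsmul_eq_mul, mul_comm]
  rw [inv_mul_eq_div, div_le_iff₀ hTc]
  refine (Finset.sum_le_card_nsmul _ _ (f w + e) h2).trans ?_
  rw [nsmul_eq_mul, mul_comm]

lemma PP_mono (T : Finset G) (f g : G → ℝ) (e : ℝ) (hT : T.Nonempty) (h : ∀ w, f w ≤ g w + e) (w : G) :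
    PP T f w ≤ PP T g w + e := by
  have h1 : ∀ w, conv (mu T) f w - conv (mu T) g w ≤ e := by
    intro w
    rw [← conv_sub_right]
    exact conv_mu_le T hT _ e (fun x => by have := h x; linarith) w
  have h2 : conv (mu T) (conv (mu T) f) w - conv (mu T) (conv (mu T) g) w ≤ e := by
    rw [← conv_sub_right]
    exact conv_mu_le T hT _ e h1 w
  unfold PP
  linarith

lemma PP_iter_close (T : Finset G) (hT : T.Nonempty) (f : G → ℝ) (e : ℝ)
    (h : ∀ t ∈ T, ∀ t' ∈ T, ∀ w, f (w + t + t') - f w ≤ e) (k : ℕ) :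
    ∀ w, (PP T)^[k] f w ≤ f w + k * e := by
  induction k with
  | zero => simp
  | succ k ih =>
    intro w
    rw [Function.iterate_succ_apply']
    have h1 := PP_mono T _ _ _ hT ih w
    have h2 := PP_close T hT f e h w
    push_cast
    linarith

/-- Almost periodicity with a subspace. -/
lemma almost_periodic (A B U : Finset G) (hA : A.Nonempty) (hB : B.Nonempty) (θ : ℝ)
    (hθ : (((A ×ˢ B).filter (fun q => q.1 + q.2 ∈ U)).card : ℝ) ≤ θ * A.card * B.card)
    (m k : ℕ) (hm : 0 < m) (η : ℝ) (hη0 : 0 ≤ η) (hη1 : η ≤ 1) :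
    ∃ (V : Submodule (ZMod 2) G) (w : G),
      (Module.finrank (ZMod 2) G : ℝ) ≤ Module.finrank (ZMod 2) V +
        8 * Real.log (2 * ((Fintype.card G : ℝ) / A.card) ^ m) ∧
      (Nat.card {v : V // w + (v : G) ∈ U} : ℝ) ≤ (θ +
        k * (2 * η + 8 * Real.exp (-(m * η ^ 2 / 4)) * ((Fintype.card G : ℝ) / B.card)) +
        ((Fintype.card G : ℝ) / A.card + (Fintype.card G : ℝ) / B.card) * (1 / 4) ^ k) * Nat.card V := by
  classical
  set N : ℝ := (Fintype.card G : ℝ) with hN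
  have hN0 : 0 < N := by
    have : Nonempty G := ⟨0⟩
    rw [hN]; exact_mod_cast Fintype.card_pos
  have hAc : (0 : ℝ) < A.card := by exact_mod_cast hA.card_pos
  have hBc : (0 : ℝ) < B.card := by exact_mod_cast hB.card_pos
  set u : G → ℝ := fun x => if x ∈ U then 1 else 0 with hu
  have hu0 : ∀ x, 0 ≤ u x := by intro x; simp only [hu]; split_ifs <;> norm_num
  have hu1 : ∀ x, u x ≤ 1 := by intro x; simp only [hu]; split_ifs <;> norm_num
  set g : G → ℝ := conv (mu A) u with hg
  have hgA : ∀ z, (A.card : ℝ) * g z = ∑ a ∈ A, u (z + a) := by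
    intro z
    rw [hg, conv, sum_mu_mul, ← mul_assoc, mul_inv_cancel₀ hAc.ne', one_mul]
  obtain ⟨T, hT1, hT2⟩ := croot_sisask A hA u hu0 hu1 g hgA m hm η hη0 hη1
  rw [← hN] at hT1 hT2
  set κ := 8 * Real.exp (-(m * η ^ 2 / 4)) with hκ
  have hTc : (0 : ℝ) < T.card := by
    have h1 : 0 < (A.card : ℝ) ^ m * N := by positivity
    have h2 : 0 < 2 * (T.card : ℝ) * N ^ m := lt_of_lt_of_le h1 hT1
    by_contra hc
    have : (T.card : ℝ) = 0 := le_antisymm (not_lt.1 hc) (Nat.cast_nonneg _)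
    rw [this] at h2; simp at h2
  have hT : T.Nonempty := Finset.card_pos.1 (by exact_mod_cast hTc)
  obtain ⟨V, hV1, hV2⟩ := exists_V T hT
  set ψ : G → ℝ := conv (mu B) g with hψ
  set e := 2 * η + κ * (N / B.card) with he
  have hg0 : ∀ z, 0 ≤ g z := conv_mu_ge A hA u 0 hu0
  have hg1 : ∀ z, g z ≤ 1 := conv_mu_le A hA u 1 hu1
  have hclose : ∀ t ∈ T, ∀ t' ∈ T, ∀ w, ψ (w + t + t') - ψ w ≤ e := by
    intro t ht t' ht' w
    have h1 : ψ (w + t + t') - ψ w = (B.card : ℝ)⁻¹ * ∑ b ∈ B, (g (w + t + t' + b) - g (w + b)) := by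
      simp only [hψ, conv]
      rw [sum_mu_mul, sum_mu_mul, Finset.sum_sub_distrib]; ring
    have h2 : ∑ b ∈ B, (g (w + t + t' + b) - g (w + b)) ≤
        ∑ b ∈ B, (2 * η + if 2 * η < |g (w + t + t' + b) - g (w + b)| then 1 else 0) := by
      refine Finset.sum_le_sum fun b _ => ?_
      split_ifs with h
      · have := hg0 (w + b); have := hg1 (w + t + t' + b); linarith
      · have := (abs_le.1 (not_lt.1 h)).2; linarith
    have h3 : ∑ b ∈ B, (if 2 * η < |g (w + t + t' + b) - g (w + b)| then (1:ℝ) else 0) ≤ κ * N := by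
      refine le_trans ?_ (hT2 t' ht' t ht)
      rw [← Finset.sum_filter, Finset.sum_const, nsmul_eq_mul, mul_one, Nat.cast_le]
      refine Finset.card_le_card_of_injOn (fun b => w + t + b) ?_ ?_
      · intro b hb
        simp only [Finset.coe_filter, Set.mem_ofPred_eq] at hb
        simp only [Finset.coe_filter, Set.mem_ofPred_eq, Finset.mem_univ, true_and]
        have e1 : w + t + b + t' = w + t + t' + b := by abel
        have e2 : w + t + b + t = w + b := by
          calc w + t + b + t = w + b + t + t := by abel
            _ = _ := zadd_cancel _ _
        rw [e1, e2]; exact hb.2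
      · intro a _ b _ h
        simpa using h
    rw [h1, inv_mul_eq_div, div_le_iff₀ hBc]
    refine h2.trans ?_
    rw [Finset.sum_add_distrib, Finset.sum_const, nsmul_eq_mul, he, add_mul, mul_assoc κ,
      div_mul_cancel₀ _ hBc.ne']
    linarith
  have hψ0 : ψ 0 ≤ θ := by
    have h1 : ψ 0 = (B.card : ℝ)⁻¹ * ((A.card : ℝ)⁻¹ * (((A ×ˢ B).filter (fun q => q.1 + q.2 ∈ U)).card : ℝ)) := by
      simp only [hψ, hg, conv]
      rw [sum_mu_mul]
      simp only [sum_mu_mul]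
      rw [← Finset.mul_sum, Finset.sum_comm, Finset.card_filter]
      push_cast
      rw [Finset.sum_product]
      congr 2
      refine Finset.sum_congr rfl fun a _ => Finset.sum_congr rfl fun b _ => ?_
      rw [zero_add, add_comm b a]
    rw [h1, inv_mul_eq_div, div_le_iff₀ hBc, inv_mul_eq_div, div_le_iff₀ hAc]
    linarith
  have hk := PP_iter_close T hT ψ e hclose k 0
  set Q := (PP T)^[k] ψ with hQ
  set Vf : Finset G := Finset.univ.filter (fun x => x ∈ V) with hVf
  have hVne : Vf.Nonempty := ⟨0, by simp [hVf]⟩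
  have hVc : (Vf.card : ℝ) = Nat.card V := by
    rw [Nat.card_eq_fintype_card, Fintype.card_subtype]
  have hdiff : conv (mu Vf) Q 0 - Q 0 ≤ (N / A.card + N / B.card) * (1 / 4) ^ k := by
    have h1 : N * (conv (mu Vf) Q 0 - Q 0) = ∑ φ, (ft (mu Vf) φ - 1) * ft Q φ := by
      rw [mul_sub, ← ft_inv, ← ft_inv, ← Finset.sum_sub_distrib]
      refine Finset.sum_congr rfl fun φ _ => ?_
      rw [ft_conv, chi_zero_right]; ring
    have h2 : ∀ φ, (ft (mu Vf) φ - 1) * ft Q φ ≤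
        (1/4)^k * N * (ft (mu A) φ ^ 2 + ft (mu B) φ ^ 2) := by
      intro φ
      by_cases hφ : 1 / 2 ≤ |ft (mu T) φ|
      · have : ft (mu Vf) φ = 1 := by
          rw [ft, sum_mu_mul]
          have : ∀ x ∈ Vf, chi φ x = 1 := by
            intro x hx
            simp [chi, hV1 φ hφ x (by simpa [hVf] using hx)]
          rw [Finset.sum_congr rfl this]
          have : (Vf.card : ℝ) ≠ 0 := by exact_mod_cast hVne.card_pos.ne'
          simp [this]
        rw [this]; simp; positivity
      · rw [hQ, ft_PP_iter, hψ, ft_conv, hg, ft_conv]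
        have a1 : |ft (mu Vf) φ - 1| ≤ 2 := by
          have := abs_le.1 (ft_mu_abs_le Vf hVne φ)
          rw [abs_le]; constructor <;> linarith
        have a2 : |ft (mu T) φ ^ (2 * k)| ≤ (1/4)^k := by
          rw [abs_pow, pow_mul]
          apply pow_le_pow_left₀ (by positivity)
          have := not_le.1 hφ
          nlinarith [abs_nonneg (ft (mu T) φ)]
        have a3 : |ft u φ| ≤ N := by
          refine (ft_abs_le u φ).trans ?_
          refine (Finset.sum_le_sum (g := fun _ => (1:ℝ)) fun x _ => ?_).trans ?_
          · rw [abs_of_nonneg (hu0 x)]; exact hu1 x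
          · simp [hN]
        have a4 : |ft (mu B) φ| * |ft (mu A) φ| ≤ (ft (mu A) φ ^ 2 + ft (mu B) φ ^ 2) / 2 := by
          rw [← sq_abs (ft (mu A) φ), ← sq_abs (ft (mu B) φ)]
          nlinarith [sq_nonneg (|ft (mu A) φ| - |ft (mu B) φ|)]
        refine (le_abs_self _).trans ?_
        rw [abs_mul, abs_mul, abs_mul, abs_mul]
        calc |ft (mu Vf) φ - 1| * (|ft (mu T) φ ^ (2 * k)| * (|ft (mu B) φ| * (|ft (mu A) φ| * |ft u φ|)))
            = |ft (mu Vf) φ - 1| * (|ft (mu T) φ ^ (2 * k)| * ((|ft (mu B) φ| * |ft (mu A) φ|) * |ft u φ|)) := by ring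
          _ ≤ 2 * ((1/4)^k * (((ft (mu A) φ ^ 2 + ft (mu B) φ ^ 2) / 2) * N)) := by gcongr
          _ = _ := by ring
    have h3 : N * (conv (mu Vf) Q 0 - Q 0) ≤ N * ((N / A.card + N / B.card) * (1 / 4) ^ k) := by
      rw [h1]
      refine (Finset.sum_le_sum fun φ _ => h2 φ).trans (le_of_eq ?_)
      rw [← Finset.mul_sum, Finset.sum_add_distrib, parseval, parseval, sum_mu_sq A hA, sum_mu_sq B hB]
      rw [← hN]; ring
    exact le_of_mul_le_mul_left h3 hN0
  have hcomm : conv (mu Vf) Q = (PP T)^[k] (conv (mu B) (conv (mu A) (conv (mu Vf) u))) := by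
    apply ft_inj
    intro φ
    rw [ft_conv, hQ, ft_PP_iter, ft_PP_iter, hψ, hg]
    simp only [ft_conv]; ring
  set ξ := θ + k * e + (N / A.card + N / B.card) * (1 / 4) ^ k with hξ
  have hle : conv (mu Vf) Q 0 ≤ ξ := by rw [hξ]; linarith
  obtain ⟨w, hw⟩ : ∃ w, conv (mu Vf) u w ≤ ξ := by
    by_contra! hc
    rw [hcomm] at hle
    have := PP_iter_gt T hT _ ξ (conv_mu_gt B hB _ ξ (conv_mu_gt A hA _ ξ hc)) k 0
    linarith
  refine ⟨V, w, ?_, ?_⟩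
  · refine hV2.trans ?_
    have : Real.log (N / T.card) ≤ Real.log (2 * (N / A.card) ^ m) := by
      apply Real.log_le_log (by positivity)
      rw [div_pow, div_le_iff₀ hTc, ← mul_div_assoc, div_mul_eq_mul_div, le_div_iff₀ (by positivity)]
      linarith
    linarith
  · have h1 : (Nat.card {v : V // w + (v : G) ∈ U} : ℝ) = ∑ x ∈ Vf, u (w + x) := by
      rw [hu, Finset.sum_boole]
      rw [Nat.cast_inj, Nat.card_eq_fintype_card, Fintype.card_subtype]
      refine Finset.card_bij (fun v _ => (v : G)) ?_ ?_ ?_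
      · intro v hv; simpa [hVf] using hv
      · intro a _ b _ h; exact Subtype.ext h
      · intro x hx
        simp only [hVf, Finset.mem_filter, Finset.mem_univ, true_and] at hx
        exact ⟨⟨x, hx.1⟩, by simpa using hx.2, rfl⟩
    have hVpos : (0:ℝ) < Vf.card := by exact_mod_cast hVne.card_pos
    rw [h1, ← hVc]
    rw [conv, sum_mu_mul, inv_mul_eq_div, div_le_iff₀ hVpos] at hw
    exact hw
end ap
end CSUB

set_option linter.unusedSectionVars false
namespace CSUB
open Finset
section sift
variable {G : Type*} [AddCommGroup G] [Module (ZMod 2) G] [Fintype G] [DecidableEq G]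

/-- Number of representations `z = x + y`. -/
noncomputable def cc (X Y : Finset G) (z : G) : ℝ := ((X.filter (fun x => z + x ∈ Y)).card : ℝ)

/-- Indicator. -/
noncomputable def ind (X : Finset G) (x : G) : ℝ := if x ∈ X then 1 else 0

lemma cc_eq (X Y : Finset G) (z : G) : cc X Y z = ∑ x, ind X x * ind Y (z + x) := by
  unfold cc ind
  rw [Finset.card_filter]
  push_cast
  simp only [ite_mul, one_mul, zero_mul, Finset.sum_ite_mem, Finset.univ_inter]

lemma cc_nonneg (X Y : Finset G) (z : G) : 0 ≤ cc X Y z := Nat.cast_nonneg _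

lemma cc_comm (X Y : Finset G) (z : G) : cc X Y z = cc Y X z := by
  rw [cc_eq, cc_eq]
  refine Fintype.sum_equiv (Equiv.addLeft z) _ _ (fun x => ?_)
  simp only [Equiv.coe_addLeft]
  have : z + (z + x) = x := by rw [← add_assoc, zadd_self, zero_add]
  rw [this, mul_comm]

lemma sift_identity (X Y : Finset G) (p : ℕ) (h : G → ℝ) :
    ∑ s : Fin p → G, ∑ a, ∑ b, (∏ i, ind X (a + s i)) * (∏ i, ind Y (b + s i)) * h (a + b) =
      (Fintype.card G : ℝ) * ∑ z, cc X Y z ^ p * h z := by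
  have h1 : ∀ s : Fin p → G, ∀ a : G,
      ∑ b, (∏ i, ind X (a + s i)) * (∏ i, ind Y (b + s i)) * h (a + b) =
      ∑ z, (∏ i, (ind X (a + s i) * ind Y (z + (a + s i)))) * h z := by
    intro s a
    refine Fintype.sum_equiv (Equiv.addLeft a) _ _ (fun b => ?_)
    simp only [Equiv.coe_addLeft]
    rw [Finset.prod_mul_distrib]
    have : ∀ i, a + b + (a + s i) = b + s i := by
      intro i
      calc a + b + (a + s i) = b + s i + a + a := by abel
        _ = _ := zadd_cancel _ _
    simp only [this]
  have h2 : ∀ z a : G, ∑ s : Fin p → G, ∏ i, (ind X (a + s i) * ind Y (z + (a + s i))) = cc X Y z ^ p := by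
    intro z a
    have e1 : ∑ s : Fin p → G, ∏ i, (ind X (a + s i) * ind Y (z + (a + s i))) =
        ∑ s : Fin p → G, ∏ i, (ind X (s i) * ind Y (z + s i)) :=
      Fintype.sum_equiv (Equiv.addLeft (fun _ : Fin p => a)) _ _ (fun s => rfl)
    rw [e1, cc_eq]
    have := Finset.prod_univ_sum (fun _ : Fin p => (Finset.univ : Finset G))
      (fun _ x => ind X x * ind Y (z + x))
    simp only [Finset.prod_const, Finset.card_univ, Fintype.card_fin, Fintype.piFinset_univ] at this
    rw [this]
  simp only [h1]
  rw [Finset.sum_comm]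
  have h3 : ∀ a : G, ∑ s : Fin p → G, ∑ z, (∏ i, (ind X (a + s i) * ind Y (z + (a + s i)))) * h z =
      ∑ z, cc X Y z ^ p * h z := by
    intro a
    rw [Finset.sum_comm]
    refine Finset.sum_congr rfl fun z _ => ?_
    rw [← Finset.sum_mul, h2]
  simp only [h3]
  rw [Finset.sum_const, nsmul_eq_mul, Finset.card_univ]

lemma prod_ind (X : Finset G) (p : ℕ) (s : Fin p → G) (a : G) :
    ∏ i, ind X (a + s i) = ind (Finset.univ.filter (fun a => ∀ i, a + s i ∈ X)) a := by
  unfold ind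
  simp only [Finset.mem_filter, Finset.mem_univ, true_and]
  split_ifs with h
  · exact Finset.prod_eq_one fun i _ => by simp [h i]
  · push Not at h
    obtain ⟨i, hi⟩ := h
    exact Finset.prod_eq_zero (Finset.mem_univ i) (by simp [hi])

lemma sum_ind_ind (A B : Finset G) (h : G → ℝ) :
    ∑ a, ∑ b, ind A a * ind B b * h (a + b) = ∑ q ∈ A ×ˢ B, h (q.1 + q.2) := by
  rw [Finset.sum_product]
  simp [ind, ite_mul, Finset.sum_ite_mem]

lemma sift (X Y D : Finset G) (hX : X.Nonempty) (hY : Y.Nonempty) (hD : D.Nonempty) (δ ε θ : ℝ)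
    (hδ : δ = (X.card : ℝ) * Y.card * D.card / (Fintype.card G : ℝ) ^ 3)
    (hε0 : 0 < ε) (hε1 : ε < 1 / 2) (hθ : 0 < θ) (p : ℕ) (hp : 0 < p)
    (hpθ : δ⁻¹ * Real.exp (-(p * ε / 3)) ≤ θ / 2)
    (hbig : (1 + ε) * δ * (Fintype.card G : ℝ) ^ 2 < ∑ z ∈ D, cc X Y z) :
    ∃ A B : Finset G, A.Nonempty ∧ B.Nonempty ∧
      1 / 2 * δ ^ (p + 1) * (Fintype.card G : ℝ) ^ 2 ≤ (A.card : ℝ) * B.card ∧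
      (((A ×ˢ B).filter (fun q => q.1 + q.2 ∈ Finset.univ.filter
        (fun z => cc X Y z < (1 + ε / 2) * (X.card * Y.card / Fintype.card G)))).card : ℝ) ≤
        θ * A.card * B.card := by
  classical
  set N : ℝ := (Fintype.card G : ℝ) with hN
  have hN0 : 0 < N := by
    have : Nonempty G := ⟨0⟩
    rw [hN]; exact_mod_cast Fintype.card_pos
  have hXc : (0 : ℝ) < X.card := by exact_mod_cast hX.card_pos
  have hYc : (0 : ℝ) < Y.card := by exact_mod_cast hY.card_pos
  have hDc : (0 : ℝ) < D.card := by exact_mod_cast hD.card_pos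
  have hXN : (X.card : ℝ) ≤ N := by rw [hN]; exact_mod_cast Finset.card_le_univ X
  have hYN : (Y.card : ℝ) ≤ N := by rw [hN]; exact_mod_cast Finset.card_le_univ Y
  have hDN : (D.card : ℝ) ≤ N := by rw [hN]; exact_mod_cast Finset.card_le_univ D
  set c0 : ℝ := X.card * Y.card / N with hc0
  have hc0p : 0 < c0 := by positivity
  have hδ1 : δ = (c0 / N) * (D.card / N) := by rw [hδ, hc0]; field_simp
  have hδ0 : 0 < δ := by rw [hδ]; positivity
  have hc01 : c0 / N ≤ 1 := by
    rw [div_le_one hN0, hc0, div_le_iff₀ hN0]; nlinarith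
  have hd1 : D.card / N ≤ 1 := by rw [div_le_one hN0]; exact hDN
  have hδc : δ ≤ c0 / N := by
    rw [hδ1]; exact mul_le_of_le_one_right (by positivity) hd1
  have hδd : δ ≤ D.card / N := by
    rw [hδ1]; exact mul_le_of_le_one_left (by positivity) hc01
  set U : Finset G := Finset.univ.filter (fun z => cc X Y z < (1 + ε / 2) * c0) with hU
  set M : ℝ := ∑ z, cc X Y z ^ p with hM
  have hM1 : D.card * ((1 + ε) * c0) ^ p ≤ M := by
    obtain ⟨p', rfl⟩ : ∃ p', p = p' + 1 := ⟨p - 1, by omega⟩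
    have h3 : (∑ z ∈ D, cc X Y z) ^ (p' + 1) / (D.card : ℝ) ^ p' ≤ ∑ z ∈ D, cc X Y z ^ (p' + 1) :=
      pow_sum_div_card_le_sum_pow (fun z _ => cc_nonneg X Y z) p'
    have h4 : ∑ z ∈ D, cc X Y z ^ (p' + 1) ≤ M :=
      Finset.sum_le_univ_sum_of_nonneg (fun z => pow_nonneg (cc_nonneg X Y z) _)
    refine le_trans ?_ (h3.trans h4)
    rw [le_div_iff₀ (by positivity)]
    have h5 : (1 + ε) * c0 * D.card ≤ ∑ z ∈ D, cc X Y z := by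
      refine le_trans (le_of_eq ?_) hbig.le
      rw [hδ1]; field_simp
    refine le_trans (le_of_eq ?_) (pow_le_pow_left₀ (by positivity) h5 (p' + 1))
    rw [mul_pow _ (D.card : ℝ)]; ring
  have hM0 : 0 < M := lt_of_lt_of_le (by positivity) hM1
  have hMU : ∑ z ∈ U, cc X Y z ^ p ≤ θ / 2 * M := by
    have h1 : ∑ z ∈ U, cc X Y z ^ p ≤ N * ((1 + ε / 2) * c0) ^ p := by
      have : ∀ z ∈ U, cc X Y z ^ p ≤ ((1 + ε / 2) * c0) ^ p := by
        intro z hz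
        exact pow_le_pow_left₀ (cc_nonneg X Y z) (Finset.mem_filter.1 hz).2.le p
      refine (Finset.sum_le_card_nsmul _ _ _ this).trans ?_
      rw [nsmul_eq_mul]
      apply mul_le_mul_of_nonneg_right _ (by positivity)
      rw [hN]; exact_mod_cast Finset.card_le_univ U
    have h2 : (1 + ε / 2) ≤ Real.exp (-(ε / 3)) * (1 + ε) := by
      have := Real.add_one_le_exp (-(ε / 3))
      nlinarith
    have h3 : (1 + ε / 2) ^ p ≤ Real.exp (-(p * ε / 3)) * (1 + ε) ^ p := by
      calc _ ≤ (Real.exp (-(ε / 3)) * (1 + ε)) ^ p := pow_le_pow_left₀ (by positivity) h2 p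
        _ = _ := by rw [mul_pow, ← Real.exp_nat_mul]; ring_nf
    calc ∑ z ∈ U, cc X Y z ^ p ≤ N * ((1 + ε / 2) * c0) ^ p := h1
      _ = N * c0 ^ p * (1 + ε / 2) ^ p := by rw [mul_pow]; ring
      _ ≤ N * c0 ^ p * (Real.exp (-(p * ε / 3)) * (1 + ε) ^ p) := by gcongr
      _ = (N / D.card) * Real.exp (-(p * ε / 3)) * (D.card * ((1 + ε) * c0) ^ p) := by
          rw [mul_pow]; field_simp
      _ ≤ (δ⁻¹ * Real.exp (-(p * ε / 3))) * M := by
          gcongr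
          rw [← inv_div]; exact inv_anti₀ hδ0 hδd
      _ ≤ θ / 2 * M := by gcongr
  let AA : (Fin p → G) → Finset G := fun s => Finset.univ.filter (fun a => ∀ i, a + s i ∈ X)
  let BB : (Fin p → G) → Finset G := fun s => Finset.univ.filter (fun a => ∀ i, a + s i ∈ Y)
  have id1 : ∑ s : Fin p → G, ((AA s).card : ℝ) * (BB s).card = N * M := by
    have := sift_identity X Y p (fun _ => 1)
    simp only [prod_ind] at this
    have e : ∀ s : Fin p → G, ∑ a, ∑ b, ind (AA s) a * ind (BB s) b * 1 = ((AA s).card : ℝ) * (BB s).card := by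
      intro s
      rw [sum_ind_ind (AA s) (BB s) (fun _ => 1)]
      simp [Finset.card_product]
    simp only [mul_one] at this e
    rw [← this]
    exact (Finset.sum_congr rfl fun s _ => (e s)).symm
  have id2 : ∑ s : Fin p → G, ((((AA s) ×ˢ (BB s)).filter (fun q => q.1 + q.2 ∈ U)).card : ℝ) =
      N * ∑ z ∈ U, cc X Y z ^ p := by
    have := sift_identity X Y p (ind U)
    simp only [prod_ind] at this
    have e : ∀ s : Fin p → G, ∑ a, ∑ b, ind (AA s) a * ind (BB s) b * ind U (a + b) =
        ((((AA s) ×ˢ (BB s)).filter (fun q => q.1 + q.2 ∈ U)).card : ℝ) := by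
      intro s
      rw [sum_ind_ind (AA s) (BB s) (ind U), Finset.card_filter]
      push_cast
      rfl
    have e2 : ∑ z, cc X Y z ^ p * ind U z = ∑ z ∈ U, cc X Y z ^ p := by
      simp [ind, Finset.sum_ite_mem]
    rw [← e2, ← this]
    exact (Finset.sum_congr rfl fun s _ => (e s)).symm
  obtain ⟨s, hs⟩ : ∃ s : Fin p → G, 0 ≤ ((AA s).card : ℝ) * (BB s).card -
      θ⁻¹ * ((((AA s) ×ˢ (BB s)).filter (fun q => q.1 + q.2 ∈ U)).card : ℝ) - N * M / 2 / N ^ p := by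
    by_contra! hc
    have h1 := Finset.sum_lt_sum_of_nonempty (s := (Finset.univ : Finset (Fin p → G)))
      Finset.univ_nonempty (fun s _ => hc s)
    rw [Finset.sum_sub_distrib, Finset.sum_sub_distrib, ← Finset.mul_sum, id1, id2, Finset.sum_const,
      Finset.sum_const, Finset.card_univ, nsmul_eq_mul] at h1
    simp only [Fintype.card_fun, Fintype.card_fin, smul_zero] at h1
    push_cast at h1
    rw [← hN, mul_div_cancel₀ _ (by positivity)] at h1
    have h2 : θ⁻¹ * (N * ∑ z ∈ U, cc X Y z ^ p) ≤ N * M / 2 := by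
      calc θ⁻¹ * (N * ∑ z ∈ U, cc X Y z ^ p) ≤ θ⁻¹ * (N * (θ / 2 * M)) := by gcongr
        _ = _ := by field_simp
    linarith
  have hu0 : 0 ≤ θ⁻¹ * ((((AA s) ×ˢ (BB s)).filter (fun q => q.1 + q.2 ∈ U)).card : ℝ) := by positivity
  have hE : 0 < N * M / 2 / N ^ p := by positivity
  have hprod : 0 < ((AA s).card : ℝ) * (BB s).card := by linarith
  refine ⟨AA s, BB s, ?_, ?_, ?_, ?_⟩
  · rw [← Finset.card_pos]
    by_contra hc
    have : (AA s).card = 0 := by omega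
    rw [this] at hprod; simp at hprod
  · rw [← Finset.card_pos]
    by_contra hc
    have : (BB s).card = 0 := by omega
    rw [this] at hprod; simp at hprod
  · have h1 : 1 / 2 * δ ^ (p + 1) * N ^ 2 ≤ N * M / 2 / N ^ p := by
      calc 1 / 2 * δ ^ (p + 1) * N ^ 2 = 1 / 2 * (δ ^ p * δ) * N ^ 2 := by rw [pow_succ]
        _ ≤ 1 / 2 * ((c0 / N) ^ p * (D.card / N)) * N ^ 2 := by gcongr
        _ = N * (D.card * (1 * c0) ^ p) / 2 / N ^ p := by rw [div_pow, one_mul]; field_simp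
        _ ≤ N * (D.card * ((1 + ε) * c0) ^ p) / 2 / N ^ p := by gcongr; linarith
        _ ≤ _ := by gcongr
    linarith
  · have h1 : θ⁻¹ * ((((AA s) ×ˢ (BB s)).filter (fun q => q.1 + q.2 ∈ U)).card : ℝ) ≤
        ((AA s).card : ℝ) * (BB s).card := by linarith
    rw [inv_mul_eq_div, div_le_iff₀ hθ] at h1
    linarith

lemma increment (X Y : Finset G) (hX : X.Nonempty) (hY : Y.Nonempty) (ε : ℝ) (hε0 : 0 < ε)
    (hε1 : ε < 1 / 2) (V : Submodule (ZMod 2) G) (w : G)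
    (hw : (Nat.card {v : V // w + (v : G) ∈ Finset.univ.filter
        (fun z => cc X Y z < (1 + ε / 2) * (X.card * Y.card / Fintype.card G))} : ℝ) ≤ ε / 4 * Nat.card V) :
    ∃ a : G, (1 + ε / 8) * (Y.card / Fintype.card G) * Nat.card V <
      (Nat.card {v : V // a + (v : G) ∈ Y} : ℝ) := by
  classical
  set N : ℝ := (Fintype.card G : ℝ) with hN
  have hN0 : 0 < N := by
    have : Nonempty G := ⟨0⟩
    rw [hN]; exact_mod_cast Fintype.card_pos
  have hXc : (0 : ℝ) < X.card := by exact_mod_cast hX.card_pos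
  have hYc : (0 : ℝ) < Y.card := by exact_mod_cast hY.card_pos
  set c0 : ℝ := X.card * Y.card / N with hc0
  have hc0p : 0 < c0 := by positivity
  have hVp : (0 : ℝ) < Nat.card V := by exact_mod_cast Nat.card_pos
  set b : ℝ := (1 + ε / 2) * c0 with hb
  have hb0 : 0 < b := by positivity
  have h1 : (1 - ε / 4) * Nat.card V * b ≤ ∑ v : V, cc X Y (w + v) := by
    have e1 : ∀ v : V, b * (1 - if w + (v:G) ∈ Finset.univ.filter (fun z => cc X Y z < b) then 1 else 0)
        ≤ cc X Y (w + v) := by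
      intro v
      split_ifs with h
      · simp; exact cc_nonneg _ _ _
      · simp at h; simpa using h
    refine le_trans ?_ (Finset.sum_le_sum fun v _ => e1 v)
    rw [← Finset.mul_sum, Finset.sum_sub_distrib, Finset.sum_boole]
    rw [Nat.card_eq_fintype_card, Fintype.card_subtype] at hw
    simp only [Finset.sum_const, Finset.card_univ, nsmul_eq_mul, mul_one]
    rw [Nat.card_eq_fintype_card] at hw ⊢
    nlinarith
  by_contra! hc
  have h2 : ∑ v : V, cc X Y (w + v) = ∑ x ∈ X, (Nat.card {v : V // (w + x) + (v : G) ∈ Y} : ℝ) := by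
    simp only [cc, Finset.card_filter]
    push_cast
    rw [Finset.sum_comm]
    refine Finset.sum_congr rfl fun x _ => ?_
    rw [Nat.card_eq_fintype_card, Fintype.card_subtype, Finset.sum_boole]
    congr 2
    ext v
    simp only [Finset.mem_filter, Finset.mem_univ, true_and]
    rw [add_right_comm]
  have h3 : ∑ v : V, cc X Y (w + v) ≤ X.card * ((1 + ε / 8) * (Y.card / N) * Nat.card V) := by
    rw [h2, ← nsmul_eq_mul]
    exact Finset.sum_le_card_nsmul _ _ _ (fun x _ => hc (w + x))
  have h4 : X.card * ((1 + ε / 8) * (Y.card / N) * Nat.card V) = (1 + ε / 8) * (c0 * Nat.card V) := by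
    rw [hc0]; ring
  have h5 : (1 - ε / 4) * Nat.card V * b = ((1 - ε / 4) * (1 + ε / 2)) * (c0 * Nat.card V) := by
    rw [hb]; ring
  have h6 : 0 < c0 * Nat.card V := by positivity
  have h7 : ((1 - ε / 4) * (1 + ε / 2)) * (c0 * Nat.card V) ≤ (1 + ε / 8) * (c0 * Nat.card V) := by linarith
  have h8 := le_of_mul_le_mul_right h7 h6
  nlinarith
end sift
end CSUB

namespace CSUB
set_option maxHeartbeats 1000000 in
lemma params : ∃ C : ℝ, 0 < C ∧ ∀ ε ℓ : ℝ, 0 < ε → ε < 1 / 2 → 1 / 2 ≤ ℓ →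
    ∃ (p k m : ℕ) (η : ℝ), 0 < p ∧ 0 < m ∧ 0 ≤ η ∧ η ≤ 1 ∧
      Real.exp ℓ * Real.exp (-(p * ε / 3)) ≤ ε / 16 ∧
      k * (2 * η + 8 * Real.exp (-(m * η ^ 2 / 4)) * Real.exp ((p + 1) * ℓ)) +
        2 * Real.exp ((p + 1) * ℓ) * (1 / 4) ^ k ≤ 3 * ε / 16 ∧
      8 * (Real.log 2 + m * ((p + 1) * ℓ)) ≤ C * ε⁻¹ ^ 7 * ℓ ^ 8 := by
  refine ⟨16 * 2000000 * 55 ^ 4, by norm_num, ?_⟩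
  intro ε ℓ hε0 hε1 hℓ
  obtain ⟨q, hq1, hq4⟩ : ∃ q : ℝ, 1 ≤ q ∧ q ^ 4 = ε⁻¹ := by
    refine ⟨(ε⁻¹) ^ ((1:ℝ)/4), ?_, ?_⟩
    · apply Real.one_le_rpow
      · rw [one_le_inv₀ hε0]; linarith
      · norm_num
    · rw [← Real.rpow_natCast, ← Real.rpow_mul (by positivity)]; norm_num
  have hq0 : 0 < q := by linarith
  have hεinv : 0 < ε⁻¹ := by positivity
  have hεq : ε * q ^ 4 = 1 := by rw [hq4]; field_simp
  set p : ℕ := ⌈3 * q ^ 4 * (ℓ + 8 * q)⌉₊ with hp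
  have hp1 : 3 * q ^ 4 * (ℓ + 8 * q) ≤ p := Nat.le_ceil _
  have hp2 : (p : ℝ) < 3 * q ^ 4 * (ℓ + 8 * q) + 1 := Nat.ceil_lt_add_one (by positivity)
  have hq41 : 1 ≤ q ^ 4 := one_le_pow₀ hq1
  have hq51 : 1 ≤ q ^ 5 := one_le_pow₀ hq1
  set L : ℝ := (p + 1) * ℓ with hL
  have hLlow : 12 * q ^ 4 ≤ L := by
    have h1 : 24 * q ^ 4 ≤ p := by
      refine le_trans ?_ hp1
      nlinarith
    rw [hL]; nlinarith
  have hLup : L ≤ 55 * ℓ ^ 2 * q ^ 5 := by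
    have h1 : (p : ℝ) + 1 ≤ 55 * ℓ * q ^ 5 := by
      have e1 : 3 * q ^ 4 * ℓ ≤ 3 * ℓ * q ^ 5 := by
        have : 0 ≤ 3 * q ^ 4 * ℓ * (q - 1) := by
          apply mul_nonneg (by positivity); linarith
        nlinarith
      have e2 : 24 * q ^ 5 ≤ 48 * ℓ * q ^ 5 := by nlinarith
      have e3 : (2:ℝ) ≤ 4 * ℓ * q ^ 5 := by nlinarith
      nlinarith
    rw [hL]; nlinarith
  have hL12 : 12 ≤ L := by linarith
  set k : ℕ := ⌈4 * L⌉₊ with hk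
  have hk1 : 4 * L ≤ k := Nat.le_ceil _
  have hk2 : (k : ℝ) < 4 * L + 1 := Nat.ceil_lt_add_one (by positivity)
  have hk5 : (k : ℝ) ≤ 5 * L := by linarith
  have hk0 : (0:ℝ) < k := by linarith
  set η : ℝ := ε / (32 * k) with hη
  have hη0 : 0 < η := by positivity
  set m : ℕ := ⌈68 * L / η ^ 2⌉₊ with hm
  have hm1 : 68 * L / η ^ 2 ≤ m := Nat.le_ceil _
  have hm2 : (m : ℝ) < 68 * L / η ^ 2 + 1 := Nat.ceil_lt_add_one (by positivity)
  have hmpos : (0:ℝ) < m := lt_of_lt_of_le (by positivity) hm1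
  have hmη : 17 * L ≤ m * η ^ 2 / 4 := by
    rw [div_le_iff₀ (by positivity)] at hm1; linarith
  have hppos : (0:ℝ) < p := lt_of_lt_of_le (by positivity) hp1
  have hεL : ε⁻¹ ≤ L / 12 := by rw [← hq4]; linarith
  refine ⟨p, k, m, η, by exact_mod_cast hppos, by exact_mod_cast hmpos, hη0.le, ?_, ?_, ?_, ?_⟩
  · rw [hη, div_le_one (by positivity)]; linarith
  · have h1 : ℓ + 8 * q ≤ p * ε / 3 := by
      have : 3 * q ^ 4 * (ℓ + 8 * q) * ε ≤ p * ε := mul_le_mul_of_nonneg_right hp1 hε0.le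
      have e : 3 * q ^ 4 * (ℓ + 8 * q) * ε = 3 * (ℓ + 8 * q) := by linear_combination 3 * (ℓ + 8 * q) * hεq
      linarith
    have h2 : 16 / ε ≤ Real.exp (8 * q) := by
      have e1 : 16 / ε = (2 * q) ^ 4 := by rw [mul_pow, hq4]; ring
      have e2 : Real.exp (8 * q) = Real.exp (2 * q) ^ 4 := by
        rw [← Real.exp_nat_mul]; congr 1; push_cast; ring
      rw [e1, e2]
      apply pow_le_pow_left₀ (by positivity)
      have := Real.add_one_le_exp (2 * q); linarith
    rw [← Real.exp_add]
    calc Real.exp (ℓ + -(p * ε / 3)) ≤ Real.exp (-(8 * q)) := Real.exp_le_exp.2 (by linarith)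
      _ = (Real.exp (8 * q))⁻¹ := Real.exp_neg _
      _ ≤ (16 / ε)⁻¹ := inv_anti₀ (by positivity) h2
      _ = ε / 16 := by rw [inv_div]
  · have t1 : k * (2 * η) = ε / 16 := by rw [hη]; field_simp; norm_num
    have hexpL : ∀ c : ℝ, c ≤ Real.exp c := fun c => by have := Real.add_one_le_exp c; linarith
    have t2 : k * (8 * Real.exp (-(m * η ^ 2 / 4)) * Real.exp L) ≤ ε / 16 := by
      have a1 : (k : ℝ) ≤ Real.exp (5 * L) := hk5.trans (hexpL _)
      have a2 : 128 * ε⁻¹ ≤ Real.exp (11 * L) := le_trans (by linarith) (hexpL _)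
      have a3 : Real.exp (-(m * η ^ 2 / 4)) ≤ Real.exp (-(17 * L)) := Real.exp_le_exp.2 (by linarith)
      have a4 : Real.exp (-(11 * L)) ≤ ε / 128 := by
        rw [Real.exp_neg]
        calc _ ≤ (128 * ε⁻¹)⁻¹ := inv_anti₀ (by positivity) a2
          _ = _ := by field_simp
      calc k * (8 * Real.exp (-(m * η ^ 2 / 4)) * Real.exp L)
          ≤ Real.exp (5 * L) * (8 * Real.exp (-(17 * L)) * Real.exp L) := by gcongr
        _ = 8 * (Real.exp (5 * L + -(17 * L) + L)) := by rw [Real.exp_add, Real.exp_add]; ring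
        _ = 8 * Real.exp (-(11 * L)) := by ring_nf
        _ ≤ ε / 16 := by linarith
    have t3 : 2 * Real.exp L * (1 / 4) ^ k ≤ ε / 16 := by
      have b1 : ((1:ℝ) / 4) ^ k ≤ Real.exp (-(4 * L)) := by
        have : (1:ℝ)/4 ≤ Real.exp (-1) := by
          rw [Real.exp_neg, one_div]
          apply inv_anti₀ (Real.exp_pos _)
          have := Real.exp_one_lt_d9; linarith
        calc ((1:ℝ) / 4) ^ k ≤ Real.exp (-1) ^ k := pow_le_pow_left₀ (by norm_num) this k
          _ = Real.exp (-k) := by rw [← Real.exp_nat_mul]; ring_nf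
          _ ≤ _ := Real.exp_le_exp.2 (by linarith)
      have b2 : 32 * ε⁻¹ ≤ Real.exp (3 * L) := le_trans (by linarith) (hexpL _)
      calc 2 * Real.exp L * (1 / 4) ^ k ≤ 2 * Real.exp L * Real.exp (-(4 * L)) := by gcongr
        _ = 2 * Real.exp (-(3 * L)) := by rw [mul_assoc, ← Real.exp_add]; ring_nf
        _ = 2 * (Real.exp (3 * L))⁻¹ := by rw [Real.exp_neg]
        _ ≤ 2 * (32 * ε⁻¹)⁻¹ := by
            apply mul_le_mul_of_nonneg_left (inv_anti₀ (by positivity) b2) (by norm_num)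
        _ = ε / 16 := by field_simp; norm_num
    rw [mul_add, t1]
    linarith
  · have hlog : Real.log 2 ≤ 1 := by have := Real.log_two_lt_d9; linarith
    have hηi : 1 / η ^ 2 ≤ 25600 * L ^ 2 * q ^ 8 := by
      have e : 1 / η ^ 2 = 1024 * k ^ 2 * q ^ 8 := by
        have : q ^ 8 = (ε⁻¹) ^ 2 := by rw [← hq4]; ring
        rw [hη, this]; field_simp; norm_num
      rw [e]
      have : (k : ℝ) ^ 2 ≤ (5 * L) ^ 2 := pow_le_pow_left₀ hk0.le hk5 2
      have hq8 : 0 < q ^ 8 := by positivity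
      nlinarith
    have hmb : (m : ℝ) + 1 ≤ 2000000 * L ^ 3 * q ^ 8 := by
      have h1 : 68 * L / η ^ 2 ≤ 68 * L * (25600 * L ^ 2 * q ^ 8) := by
        rw [div_eq_mul_one_div]; gcongr
      have h2 : 1 ≤ L ^ 3 * q ^ 8 := by
        have : 1 ≤ L ^ 3 := one_le_pow₀ (by linarith)
        exact one_le_mul_of_one_le_of_one_le this (one_le_pow₀ hq1)
      have h3 : 68 * L * (25600 * L ^ 2 * q ^ 8) = 1740800 * (L ^ 3 * q ^ 8) := by ring
      have h4 : 2000000 * L ^ 3 * q ^ 8 = 2000000 * (L ^ 3 * q ^ 8) := by ring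
      rw [h4]
      linarith
    have hL4 : L ^ 4 ≤ (55 * ℓ ^ 2 * q ^ 5) ^ 4 := pow_le_pow_left₀ (by linarith) hLup 4
    calc 8 * (Real.log 2 + m * L) ≤ 8 * ((m + 1) * L) := by nlinarith
      _ ≤ 8 * ((2000000 * L ^ 3 * q ^ 8) * L) := by gcongr
      _ = 8 * 2000000 * q ^ 8 * L ^ 4 := by ring
      _ ≤ 8 * 2000000 * q ^ 8 * (55 * ℓ ^ 2 * q ^ 5) ^ 4 := by gcongr
      _ = 8 * 2000000 * 55 ^ 4 * (q ^ 4) ^ 7 * ℓ ^ 8 := by ring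
      _ = 8 * 2000000 * 55 ^ 4 * ε⁻¹ ^ 7 * ℓ ^ 8 := by rw [hq4]
      _ ≤ 16 * 2000000 * 55 ^ 4 * ε⁻¹ ^ 7 * ℓ ^ 8 := by gcongr; norm_num
end CSUB

namespace CSUB
open Finset

lemma main_G : ∃ C : ℝ, 0 < C ∧ ∀ (G : Type) [AddCommGroup G] [Module (ZMod 2) G] [Fintype G]
    [DecidableEq G] (X Y D : Finset G) (δ ε : ℝ) (r : ℕ), X.Nonempty → Y.Nonempty → D.Nonempty →
    δ = (X.card : ℝ) * Y.card * D.card / (Fintype.card G : ℝ) ^ 3 → 0 < ε → ε < 1 / 2 →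
    C * ε⁻¹ ^ 7 * Real.log (2 / δ) ^ 8 ≤ (r : ℝ) →
    (1 + ε) * δ * (Fintype.card G : ℝ) ^ 2 < ∑ z ∈ D, cc X Y z →
    ∃ V : Submodule (ZMod 2) G, Module.finrank (ZMod 2) G ≤ Module.finrank (ZMod 2) V + r ∧
      (∃ a : G, (1 + ε / 8) * (X.card / Fintype.card G) * Nat.card V <
        (Nat.card {v : V // a + (v : G) ∈ X} : ℝ)) ∧
      (∃ a : G, (1 + ε / 8) * (Y.card / Fintype.card G) * Nat.card V <
        (Nat.card {v : V // a + (v : G) ∈ Y} : ℝ)) := by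
  obtain ⟨C, hC, hpar⟩ := params
  refine ⟨C, hC, ?_⟩
  intro G _ _ _ _ X Y D δ ε r hX hY hD hδ hε0 hε1 hr hbig
  set N : ℝ := (Fintype.card G : ℝ) with hN
  have hN0 : 0 < N := by
    have : Nonempty G := ⟨0⟩
    rw [hN]; exact_mod_cast Fintype.card_pos
  have hXc : (0 : ℝ) < X.card := by exact_mod_cast hX.card_pos
  have hYc : (0 : ℝ) < Y.card := by exact_mod_cast hY.card_pos
  have hDc : (0 : ℝ) < D.card := by exact_mod_cast hD.card_pos
  have hXN : (X.card : ℝ) ≤ N := by rw [hN]; exact_mod_cast Finset.card_le_univ X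
  have hYN : (Y.card : ℝ) ≤ N := by rw [hN]; exact_mod_cast Finset.card_le_univ Y
  have hDN : (D.card : ℝ) ≤ N := by rw [hN]; exact_mod_cast Finset.card_le_univ D
  have hδ0 : 0 < δ := by rw [hδ]; positivity
  have hδ1 : δ ≤ 1 := by
    rw [hδ, div_le_one (by positivity)]
    calc (X.card : ℝ) * Y.card * D.card ≤ N * N * N := by gcongr
      _ = N ^ 3 := by ring
  set ℓ := Real.log (2 / δ) with hℓ
  have hexpℓ : Real.exp ℓ = 2 / δ := Real.exp_log (by positivity)
  have hℓ1 : 1 / 2 ≤ ℓ := by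
    have h1 : Real.log 2 ≤ ℓ := by
      apply Real.log_le_log (by norm_num)
      rw [le_div_iff₀ hδ0]; linarith
    have := Real.log_two_gt_d9
    linarith
  obtain ⟨p, k, m, η, hp, hm, hη0, hη1, e1, e2, e3⟩ := hpar ε ℓ hε0 hε1 hℓ1
  have hpθ : δ⁻¹ * Real.exp (-(p * ε / 3)) ≤ (ε / 16) / 2 := by
    rw [hexpℓ] at e1
    have : 2 / δ * Real.exp (-(p * ε / 3)) = 2 * (δ⁻¹ * Real.exp (-(p * ε / 3))) := by ring
    linarith
  obtain ⟨A, B, hA, hB, hAB, hU⟩ := sift X Y D hX hY hD δ ε (ε / 16) hδ hε0 hε1 (by positivity) p hp hpθ hbig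
  rw [← hN] at hAB
  set L := ((p : ℝ) + 1) * ℓ with hL
  have hAc : (0 : ℝ) < A.card := by exact_mod_cast hA.card_pos
  have hBc : (0 : ℝ) < B.card := by exact_mod_cast hB.card_pos
  have hAN : (A.card : ℝ) ≤ N := by rw [hN]; exact_mod_cast Finset.card_le_univ A
  have hBN : (B.card : ℝ) ≤ N := by rw [hN]; exact_mod_cast Finset.card_le_univ B
  have hLe : N ^ 2 ≤ Real.exp L * (A.card * B.card) := by
    have h1 : Real.exp L = (2 / δ) ^ (p + 1) := by
      rw [← hexpℓ, ← Real.exp_nat_mul, hL]; push_cast; rfl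
    have h2 : (2:ℝ) ≤ 2 ^ (p + 1) := by
      have := pow_le_pow_right₀ (a := (2:ℝ)) (by norm_num) (show 1 ≤ p + 1 by omega)
      simpa using this
    calc N ^ 2 = 2 * (1 / 2 * N ^ 2) := by ring
      _ ≤ 2 ^ (p + 1) * (1 / 2 * N ^ 2) := by gcongr
      _ = (2 / δ) ^ (p + 1) * (1 / 2 * δ ^ (p + 1) * N ^ 2) := by
          rw [div_pow]; field_simp
      _ ≤ (2 / δ) ^ (p + 1) * (A.card * B.card) := by gcongr
      _ = _ := by rw [h1]
  have hexpL := Real.exp_pos L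
  have hNA : N / A.card ≤ Real.exp L := by
    rw [div_le_iff₀ hAc]
    refine le_of_mul_le_mul_right ?_ hN0
    calc N * N = N ^ 2 := by ring
      _ ≤ Real.exp L * (A.card * B.card) := hLe
      _ ≤ Real.exp L * (A.card * N) := by gcongr
      _ = _ := by ring
  have hNB : N / B.card ≤ Real.exp L := by
    rw [div_le_iff₀ hBc]
    refine le_of_mul_le_mul_right ?_ hN0
    calc N * N = N ^ 2 := by ring
      _ ≤ Real.exp L * (A.card * B.card) := hLe
      _ ≤ Real.exp L * (N * B.card) := by gcongr
      _ = _ := by ring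
  obtain ⟨V, w, hV, hw⟩ := almost_periodic A B _ hA hB (ε / 16) hU m k hm η hη0 hη1
  rw [← hN] at hV hw
  have hw' := hw.trans (show _ ≤ ε / 4 * (Nat.card V : ℝ) by
    apply mul_le_mul_of_nonneg_right _ (Nat.cast_nonneg _)
    have t1 : (k:ℝ) * (2 * η + 8 * Real.exp (-(m * η ^ 2 / 4)) * (N / B.card)) ≤
        k * (2 * η + 8 * Real.exp (-(m * η ^ 2 / 4)) * Real.exp L) := by gcongr
    have t2 : (N / A.card + N / B.card) * (1 / 4) ^ k ≤ (Real.exp L + Real.exp L) * (1 / 4) ^ k := by gcongr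
    linarith)
  refine ⟨V, ?_, ?_, ?_⟩
  · have h1 : Real.log (2 * (N / A.card) ^ m) ≤ Real.log 2 + m * L := by
      calc Real.log (2 * (N / A.card) ^ m) ≤ Real.log (2 * (Real.exp L) ^ m) := by
            apply Real.log_le_log (by positivity); gcongr
        _ = Real.log 2 + m * L := by
            rw [Real.log_mul (by norm_num) (by positivity), Real.log_pow, Real.log_exp]
    have h2 : (Module.finrank (ZMod 2) G : ℝ) ≤ (Module.finrank (ZMod 2) V : ℝ) + r := by linarith
    exact_mod_cast h2
  · refine increment Y X hY hX ε hε0 hε1 V w ?_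
    simp only [cc_comm Y X, mul_comm (Y.card : ℝ)]
    exact hw'
  · exact increment X Y hX hY ε hε0 hε1 V w hw'

end CSUB

namespace CSUB
open Finset

lemma card_transfer {n : ℕ} (W : Submodule (ZMod 2) (Fin n → ZMod 2)) (X : Set (Fin n → ZMod 2))
    (hX : X ⊆ (W : Set (Fin n → ZMod 2))) (X' : Finset W)
    (h : ∀ x : W, x ∈ X' ↔ (x : Fin n → ZMod 2) ∈ X) :
    X'.card = Nat.card X := by
  rw [← Nat.card_eq_finsetCard X']
  refine Nat.card_congr ⟨fun x => ⟨x.1.1, (h x.1).1 x.2⟩, fun x => ⟨⟨x.1, hX x.2⟩, (h _).2 x.2⟩, ?_, ?_⟩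
  · intro x; rfl
  · intro x; rfl

lemma spread_contra {n : ℕ} (W : Submodule (ZMod 2) (Fin n → ZMod 2)) [Fintype W]
    (X : Set (Fin n → ZMod 2))
    (hX : X ⊆ (W : Set (Fin n → ZMod 2))) (X' : Finset W)
    (h : ∀ x : W, x ∈ X' ↔ (x : Fin n → ZMod 2) ∈ X) (r : ℕ) (ε : ℝ)
    (hs : AlgebraicallySpread n W X r ε) (V : Submodule (ZMod 2) W)
    (hV : Module.finrank (ZMod 2) W ≤ Module.finrank (ZMod 2) V + r)
    (hinc : ∃ a : W, (1 + ε) * (X'.card / Fintype.card W) * Nat.card V <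
      (Nat.card {v : V // a + (v : W) ∈ X'} : ℝ)) : False := by
  obtain ⟨a, ha⟩ := hinc
  have hfin : Module.finrank (ZMod 2) (V.map W.subtype) = Module.finrank (ZMod 2) V :=
    (Submodule.equivMapOfInjective W.subtype W.injective_subtype V).finrank_eq.symm
  have hcard : Nat.card (V.map W.subtype) = Nat.card V :=
    Nat.card_congr (Submodule.equivMapOfInjective W.subtype W.injective_subtype V).symm.toEquiv
  have h1 := hs (V.map W.subtype) a (by
    rintro _ ⟨_, ⟨v, _, rfl⟩, rfl⟩
    exact W.add_mem a.2 v.2) (by rw [hfin]; exact hV)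
  have hVp : (0 : ℝ) < Nat.card V := by exact_mod_cast Nat.card_pos
  rw [hcard, div_le_iff₀ hVp, ← card_transfer W X hX X' h, Nat.card_eq_fintype_card (α := W)] at h1
  have h2 : Nat.card {v : V // a + (v : W) ∈ X'} =
      Nat.card ↥(X ∩ (((a : Fin n → ZMod 2) + ·) '' ((V.map W.subtype : Submodule _ _) : Set (Fin n → ZMod 2)))) := by
    refine Nat.card_congr (Equiv.ofBijective
      (fun v => ⟨(a : Fin n → ZMod 2) + ((v.1 : W) : Fin n → ZMod 2), (h _).1 v.2, _, ⟨v.1.1, v.1.2, rfl⟩, rfl⟩)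
      ⟨?_, ?_⟩)
    · intro v v' hvv
      have := congrArg Subtype.val hvv
      simp only [add_right_inj] at this
      exact Subtype.ext (Subtype.ext (Subtype.ext this))
    · rintro ⟨_, hx, ⟨_, ⟨v, hv, rfl⟩, rfl⟩⟩
      exact ⟨⟨⟨v, hv⟩, (h _).2 hx⟩, rfl⟩
  rw [← h2] at h1
  linarith

lemma container_card {n : ℕ} (W : Submodule (ZMod 2) (Fin n → ZMod 2)) [Fintype W] [DecidableEq W]
    (X Y D : Set (Fin n → ZMod 2))
    (hX : X ⊆ (W : Set (Fin n → ZMod 2))) (hY : Y ⊆ (W : Set (Fin n → ZMod 2))) (X' Y' D' : Finset W)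
    (h : ∀ x : W, x ∈ X' ↔ (x : Fin n → ZMod 2) ∈ X)
    (h' : ∀ x : W, x ∈ Y' ↔ (x : Fin n → ZMod 2) ∈ Y)
    (h'' : ∀ x : W, x ∈ D' ↔ (x : Fin n → ZMod 2) ∈ D) :
    (Nat.card ↥(Container n X Y D) : ℝ) = ∑ z ∈ D', cc X' Y' z := by
  have e1 : ∑ z ∈ D', cc X' Y' z = (((D' ×ˢ X').filter (fun q => q.1 + q.2 ∈ Y')).card : ℝ) := by
    rw [Finset.card_filter, Finset.sum_product]
    push_cast
    refine Finset.sum_congr rfl fun z _ => ?_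
    rw [cc, Finset.card_filter]
    push_cast; rfl
  rw [e1, Nat.cast_inj, ← Nat.card_eq_finsetCard]
  symm
  refine Nat.card_congr (Equiv.ofBijective
      (fun q => ⟨((q.1.2 : Fin n → ZMod 2), ((q.1.1 + q.1.2 : W) : Fin n → ZMod 2)), ?_⟩) ⟨?_, ?_⟩)
  · obtain ⟨⟨z, x⟩, hq⟩ := q
    simp only [Finset.mem_filter, Finset.mem_product] at hq
    refine ⟨(h _).1 hq.1.2, (h' _).1 hq.2, ?_⟩
    have e : x + (z + x) = z := by rw [add_comm]; exact zadd_cancel z x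
    have := (h'' z).1 hq.1.1
    rw [← e] at this
    exact this
  · rintro ⟨⟨z, x⟩, hq⟩ ⟨⟨z', x'⟩, hq'⟩ he
    have he := congrArg Subtype.val he
    simp only [Prod.mk.injEq] at he
    have h1 : x = x' := Subtype.ext he.1
    have h2 : z + x = z' + x' := Subtype.ext he.2
    subst h1
    have h3 : z = z' := by simpa using h2
    subst h3
    rfl
  · rintro ⟨⟨x, y⟩, hx, hy, hd⟩
    have e : (⟨x, hX hx⟩ + ⟨y, hY hy⟩ : W) + ⟨x, hX hx⟩ = ⟨y, hY hy⟩ := by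
      rw [add_comm (⟨x, hX hx⟩ : W)]; exact zadd_cancel _ _
    refine ⟨⟨((⟨x, hX hx⟩ + ⟨y, hY hy⟩ : W), ⟨x, hX hx⟩), ?_⟩, ?_⟩
    · simp only [Finset.mem_filter, Finset.mem_product]
      refine ⟨⟨(h'' _).2 hd, (h _).2 hx⟩, ?_⟩
      rw [e]; exact (h' _).2 hy
    · apply Subtype.ext
      simp only [e]
end CSUB


/-- Lemma 5.5 of the paper: upper bound on the size of the container `S(X, Y, D)`
when `X` or `Y` is algebraically spread. -/
theorem container_size_upper_bound :
    ∃ C : ℝ, 0 < C ∧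
      ∀ (n : ℕ) (W : Submodule (ZMod 2) (Fin n → ZMod 2))
        (X Y D : Set (Fin n → ZMod 2)) (δ ε : ℝ) (r : ℕ),
        X.Nonempty → Y.Nonempty → D.Nonempty →
        X ⊆ (W : Set (Fin n → ZMod 2)) → Y ⊆ (W : Set (Fin n → ZMod 2)) →
        D ⊆ (W : Set (Fin n → ZMod 2)) →
        δ = (Nat.card ↥X : ℝ) * (Nat.card ↥Y : ℝ) * (Nat.card ↥D : ℝ) /
          (Nat.card ↥W : ℝ) ^ 3 →
        ε ∈ Set.Ioo (0 : ℝ) (1 / 2) →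
        C * ε⁻¹ ^ 7 * Real.log (2 / δ) ^ 8 ≤ (r : ℝ) →
        (AlgebraicallySpread n W X r (ε / 8) ∨ AlgebraicallySpread n W Y r (ε / 8)) →
        (Nat.card ↥(Container n X Y D) : ℝ) ≤ (1 + ε) * δ * (Nat.card ↥W : ℝ) ^ 2 := by
  classical
  obtain ⟨C, hC, hmain⟩ := CSUB.main_G
  refine ⟨C, hC, ?_⟩
  intro n W X Y D δ ε r hXn hYn hDn hX hY hD hδ hε hr hs
  by_contra! hbig
  let X' : Finset W := Finset.univ.filter (fun x => (x : Fin n → ZMod 2) ∈ X)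
  let Y' : Finset W := Finset.univ.filter (fun x => (x : Fin n → ZMod 2) ∈ Y)
  let D' : Finset W := Finset.univ.filter (fun x => (x : Fin n → ZMod 2) ∈ D)
  have hX' : ∀ x : W, x ∈ X' ↔ (x : Fin n → ZMod 2) ∈ X := by intro x; simp [X']
  have hY' : ∀ x : W, x ∈ Y' ↔ (x : Fin n → ZMod 2) ∈ Y := by intro x; simp [Y']
  have hD' : ∀ x : W, x ∈ D' ↔ (x : Fin n → ZMod 2) ∈ D := by intro x; simp [D']
  have cX := CSUB.card_transfer W X hX X' hX'
  have cY := CSUB.card_transfer W Y hY Y' hY'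
  have cD := CSUB.card_transfer W D hD D' hD'
  rw [CSUB.container_card W X Y D hX hY X' Y' D' hX' hY' hD', Nat.card_eq_fintype_card] at hbig
  rw [← cX, ← cY, ← cD, Nat.card_eq_fintype_card] at hδ
  obtain ⟨x, hx⟩ := hXn
  obtain ⟨y, hy⟩ := hYn
  obtain ⟨d, hd⟩ := hDn
  obtain ⟨V, hV, iX, iY⟩ := hmain W X' Y' D' δ ε r ⟨⟨x, hX hx⟩, (hX' _).2 hx⟩ ⟨⟨y, hY hy⟩, (hY' _).2 hy⟩
    ⟨⟨d, hD hd⟩, (hD' _).2 hd⟩ hδ hε.1 hε.2 hr hbig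
  rcases hs with hs | hs
  · exact CSUB.spread_contra W X hX X' hX' r _ hs V hV iX
  · exact CSUB.spread_contra W Y hY Y' hY' r _ hs V hV iY
end

section
/- There exists a constant C > 0 such that the following holds. Let W be a linear subspace of 𝔽₂ⁿ, let X, Y, D ⊆ W be nonempty subsets, and set δ = |X|·|Y|·|D|/|W|³. Let ε ∈ (0, 1/2) and let r be an integer with r ≥ C·ε^{-7}·(log(2/δ))^8. If both X and Y are (r, ε/16)-algebraically spread within W, then (1−ε)·δ·|W|² ≤ |S(X, Y, D)| ≤ (1+ε)·δ·|W|². -/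
namespace KM

set_option linter.unusedSectionVars false

open Finset
open scoped BigOperators

section part1

variable {G : Type*} [AddCommGroup G] [Module (ZMod 2) G] [Fintype G] [DecidableEq G]

/-- indicator function -/
def ind (A : Finset G) (x : G) : ℝ := if x ∈ A then 1 else 0

/-- normalised convolution -/
noncomputable def cv (f g : G → ℝ) (z : G) : ℝ := 𝔼 x, f x * g (x + z)

/-- density -/
noncomputable def den (A : Finset G) : ℝ := (#A : ℝ) / (Fintype.card G : ℝ)

lemma ind_nonneg (A : Finset G) (x : G) : 0 ≤ ind A x := by
  unfold ind; split_ifs <;> norm_num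

lemma ind_le_one (A : Finset G) (x : G) : ind A x ≤ 1 := by
  unfold ind; split_ifs <;> norm_num

lemma card_pos' : (0 : ℝ) < (Fintype.card G : ℝ) := by
  have : Nonempty G := ⟨0⟩
  exact_mod_cast Fintype.card_pos

lemma den_pos {A : Finset G} (hA : A.Nonempty) : 0 < den A := by
  classical
  unfold den
  have := card_pos' (G := G)
  have : 0 < (#A : ℝ) := by exact_mod_cast hA.card_pos
  positivity

lemma den_le_one (A : Finset G) : den A ≤ 1 := by
  classical
  unfold den
  rw [div_le_one card_pos']
  exact_mod_cast Finset.card_le_univ A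

lemma expect_ind_mul (A : Finset G) (f : G → ℝ) :
    𝔼 x, ind A x * f x = den A * 𝔼 x ∈ A, f x := by
  have hN := card_pos' (G := G)
  rcases A.eq_empty_or_nonempty with rfl | hA
  · simp [ind]
  have hc : (#A : ℝ) ≠ 0 := by exact_mod_cast hA.card_pos.ne'
  rw [Fintype.expect_eq_sum_div_card, Finset.expect_eq_sum_div_card]
  unfold ind den
  simp only [ite_mul, one_mul, zero_mul, Finset.sum_ite_mem, Finset.univ_inter]
  field_simp

lemma expect_ind (A : Finset G) (hA : A.Nonempty) : 𝔼 x, ind A x = den A := by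
  have := expect_ind_mul A (fun _ => 1)
  simpa [Finset.expect_const hA] using this

lemma expect_shift (f : G → ℝ) (t : G) : 𝔼 x, f (x + t) = 𝔼 x, f x :=
  Fintype.expect_equiv (Equiv.addRight t) _ _ (fun _ => rfl)

lemma cv_shift (f g : G → ℝ) (z w : G) : 𝔼 t, f (z + t) * g (w + t) = cv f g (z + w) := by
  unfold cv
  refine Fintype.expect_equiv (Equiv.addLeft z) _ _ (fun t => ?_)
  simp only [Equiv.coe_addLeft]
  have : z + t + (z + w) = w + t := by
    have := ZModModule.add_self z
    calc z + t + (z + w) = (z + z) + (w + t) := by abel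
      _ = w + t := by rw [this, zero_add]
  rw [this]

lemma pow_identity (f g φ : G → ℝ) (k : ℕ) :
    𝔼 z, (cv f g z) ^ k * φ z =
      𝔼 t : Fin k → G, 𝔼 z, 𝔼 w, (∏ i, f (z + t i)) * (∏ i, g (w + t i)) * φ (z + w) := by
  classical
  have h1 : ∀ z w : G, 𝔼 t : Fin k → G, (∏ i, f (z + t i)) * (∏ i, g (w + t i)) * φ (z + w)
      = (cv f g (w + z)) ^ k * φ (w + z) := by
    intro z w
    rw [add_comm w z, ← cv_shift, Finset.expect_pow, Fintype.piFinset_univ, ← Finset.expect_mul]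
    simp_rw [Finset.prod_mul_distrib]
  rw [Finset.expect_comm]
  have h2 : ∀ z : G, 𝔼 t : Fin k → G, 𝔼 w, (∏ i, f (z + t i)) * (∏ i, g (w + t i)) * φ (z + w)
      = 𝔼 z, (cv f g z) ^ k * φ z := by
    intro z
    rw [Finset.expect_comm]
    simp_rw [h1]
    exact expect_shift (fun w => (cv f g w) ^ k * φ w) z
  simp_rw [h2]
  have : Nonempty G := ⟨0⟩
  rw [Fintype.expect_const]

lemma pow_identity' (f g : G → ℝ) (k : ℕ) :
    𝔼 z, (cv f g z) ^ k =
      𝔼 t : Fin k → G, (𝔼 z, ∏ i, f (z + t i)) * (𝔼 w, ∏ i, g (w + t i)) := by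
  have := pow_identity f g (fun _ => 1) k
  simp only [mul_one] at this
  rw [this]
  simp_rw [Fintype.expect_mul_expect]

lemma spectral_nonneg (f : G → ℝ) (k : ℕ) : 0 ≤ 𝔼 z, (cv f f z) ^ k := by
  rw [pow_identity']
  exact Finset.expect_nonneg (fun t _ => mul_self_nonneg _)

lemma decouple (f g : G → ℝ) (k : ℕ) :
    (𝔼 z, (cv f g z) ^ k) ^ 2 ≤ (𝔼 z, (cv f f z) ^ k) * (𝔼 z, (cv g g z) ^ k) := by
  rw [pow_identity', pow_identity', pow_identity']
  refine (Finset.expect_mul_sq_le_sq_mul_sq _ _ _).trans_eq ?_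
  simp_rw [sq]

lemma unb_nonneg (h : G → ℝ) (hh : ∀ k, 0 ≤ 𝔼 z, h z ^ k) (b : ℕ) :
    ∀ a, 0 ≤ 𝔼 z, h z ^ a * (1 + h z) ^ b := by
  induction b with
  | zero => simpa using hh
  | succ b ih =>
    intro a
    have : ∀ z, h z ^ a * (1 + h z) ^ (b + 1)
      = h z ^ a * (1 + h z) ^ b + h z ^ (a + 1) * (1 + h z) ^ b := by intro z; ring
    simp_rw [this, Finset.expect_add_distrib]
    exact add_nonneg (ih a) (ih (a + 1))

lemma unb_mono (h : G → ℝ) (hh : ∀ k, 0 ≤ 𝔼 z, h z ^ k) (a : ℕ) :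
    ∀ b, 𝔼 z, h z ^ a * (1 + h z) ^ b ≤ 𝔼 z, (1 + h z) ^ (a + b) := by
  induction a with
  | zero => intro b; simp
  | succ a ih =>
    intro b
    have h1 := ih (b + 1)
    have : ∀ z, h z ^ a * (1 + h z) ^ (b + 1)
      = h z ^ a * (1 + h z) ^ b + h z ^ (a + 1) * (1 + h z) ^ b := by intro z; ring
    simp_rw [this, Finset.expect_add_distrib] at h1
    have h2 := unb_nonneg h hh b a
    have e : a + 1 + b = a + (b + 1) := by ring
    rw [e]
    linarith

lemma unb_abs (h : G → ℝ) (hh : ∀ k, 0 ≤ 𝔼 z, h z ^ k) (b : ℕ) :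
    ∀ a, |𝔼 z, h z ^ a * (1 - h z) ^ b| ≤ 𝔼 z, h z ^ a * (1 + h z) ^ b := by
  induction b with
  | zero => intro a; simp [abs_of_nonneg (hh a)]
  | succ b ih =>
    intro a
    have h1 : ∀ z, h z ^ a * (1 + h z) ^ (b + 1)
      = h z ^ a * (1 + h z) ^ b + h z ^ (a + 1) * (1 + h z) ^ b := by intro z; ring
    have h2 : ∀ z, h z ^ a * (1 - h z) ^ (b + 1)
      = h z ^ a * (1 - h z) ^ b - h z ^ (a + 1) * (1 - h z) ^ b := by intro z; ring
    simp_rw [h1, h2, Finset.expect_add_distrib, Finset.expect_sub_distrib]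
    exact (abs_sub _ _).trans (add_le_add (ih a) (ih (a + 1)))

/-- unbalancing -/
lemma unbalance (h : G → ℝ) [Nonempty G] (hh : ∀ k, 0 ≤ 𝔼 z, h z ^ k) (p q : ℕ) (hp : Even p)
    (hq : Even q) (a b : ℝ) (hb : 0 ≤ b) (ha : a ^ p ≤ 𝔼 z, h z ^ p) :
    (a ^ p - b ^ p) * (1 + b) ^ q / 2 ≤ 𝔼 z, (1 + h z) ^ (p + q) := by
  have h1 := unb_mono h hh p q
  have h2 := (abs_le.1 (unb_abs h hh q p)).2
  have h3 : ∀ z, (h z ^ p - b ^ p) * (1 + b) ^ q ≤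
      h z ^ p * (1 + h z) ^ q + h z ^ p * (1 - h z) ^ q := by
    intro z
    have e1 : h z ^ p * (1 + |h z|) ^ q ≤
        h z ^ p * (1 + h z) ^ q + h z ^ p * (1 - h z) ^ q := by
      have p0 : 0 ≤ h z ^ p := hp.pow_nonneg _
      have p1 : 0 ≤ (1 + h z) ^ q := hq.pow_nonneg _
      have p2 : 0 ≤ (1 - h z) ^ q := hq.pow_nonneg _
      rcases abs_cases (h z) with ⟨e, _⟩ | ⟨e, _⟩
      · rw [e]; nlinarith
      · rw [e, ← sub_eq_add_neg]; nlinarith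
    refine le_trans ?_ e1
    rw [← hp.pow_abs]
    have q0 : 0 ≤ |h z| := abs_nonneg _
    generalize |h z| = y at *
    rcases le_total b y with hby | hby
    · have : (1 + b) ^ q ≤ (1 + y) ^ q := by gcongr
      have : b ^ p ≥ 0 := by positivity
      have : y ^ p - b ^ p ≥ 0 := by
        have : b ^ p ≤ y ^ p := by gcongr
        linarith
      have : (1 + b) ^ q ≥ 0 := by positivity
      calc (y ^ p - b ^ p) * (1 + b) ^ q ≤ y ^ p * (1 + b) ^ q := by gcongr; linarith
        _ ≤ y ^ p * (1 + y) ^ q := by gcongr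
    · have : y ^ p ≤ b ^ p := by gcongr
      have : (1 + b) ^ q ≥ 0 := by positivity
      have : (y ^ p - b ^ p) * (1 + b) ^ q ≤ 0 := mul_nonpos_of_nonpos_of_nonneg (by linarith) this
      have : 0 ≤ y ^ p * (1 + y) ^ q := by positivity
      linarith
  have h4 := Finset.expect_le_expect (s := Finset.univ) (fun z _ => h3 z)
  rw [Finset.expect_add_distrib, ← Finset.expect_mul, Finset.expect_sub_distrib,
    Fintype.expect_const] at h4
  have h5 : (a ^ p - b ^ p) * (1 + b) ^ q ≤ ((𝔼 z, h z ^ p) - b ^ p) * (1 + b) ^ q := by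
    gcongr
  linarith

/-- sifting -/
lemma sift (A : Finset G) (Q : ℕ) (θ κ : ℝ) (S : Finset G)
    (hS : ∀ z, z ∉ S → cv (ind A) (ind A) z ≤ θ) (hκ : 0 < κ) (hθ : 0 ≤ θ)
    (hA : A.Nonempty)
    (h1 : θ ^ Q ≤ κ / 4 * 𝔼 z, cv (ind A) (ind A) z ^ Q)
    (h2 : (den A ^ Q) ^ 2 ≤ 𝔼 z, cv (ind A) (ind A) z ^ Q) :
    ∃ B : Finset G, den A ^ Q / 2 ≤ den B ∧
      1 - κ ≤ 𝔼 x ∈ B, 𝔼 y ∈ B, ind S (x + y) := by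
  have hN : Nonempty G := ⟨0⟩
  have hα := den_pos hA
  set B : (Fin Q → G) → Finset G := fun t => Finset.univ.filter (fun z => ∀ i, z + t i ∈ A) with hB
  have hprod : ∀ t z, ∏ i, ind A (z + t i) = ind (B t) z := by
    intro t z
    unfold ind
    rw [Finset.prod_ite_zero]
    simp [hB]
  set M := 𝔼 z, cv (ind A) (ind A) z ^ Q with hM
  set bad : (Fin Q → G) → ℝ := fun t => 𝔼 z, 𝔼 w, ind (B t) z * ind (B t) w * (1 - ind S (z + w))
    with hbad
  have hden : ∀ t, 𝔼 z, ind (B t) z = den (B t) := by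
    intro t
    have := expect_ind_mul (B t) (fun _ => 1)
    simp only [mul_one] at this
    rw [this]
    rcases (B t).eq_empty_or_nonempty with h | h
    · rw [h]; simp [den]
    · rw [Finset.expect_const h, mul_one]
  have hM1 : M = 𝔼 t, den (B t) ^ 2 := by
    rw [hM, pow_identity']
    simp_rw [hprod, hden, sq]
  have hM2 : 𝔼 t, bad t ≤ θ ^ Q := by
    have := pow_identity (ind A) (ind A) (fun z => 1 - ind S z) Q
    simp_rw [hprod] at this
    rw [hbad, ← this]
    apply Finset.expect_le Finset.univ_nonempty
    intro z _
    have hc0 : 0 ≤ cv (ind A) (ind A) z :=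
      Finset.expect_nonneg (fun x _ => mul_nonneg (ind_nonneg _ _) (ind_nonneg _ _))
    by_cases hz : z ∈ S
    · have : ind S z = 1 := by simp [ind, hz]
      rw [this]
      have : 0 ≤ θ ^ Q := by positivity
      linarith
    · have : ind S z = 0 := by simp [ind, hz]
      rw [this, sub_zero, mul_one]
      exact pow_le_pow_left₀ hc0 (hS z hz) Q
  by_contra hcon
  push Not at hcon
  have key : ∀ t, den (B t) ^ 2 ≤ bad t / κ + (den A ^ Q) ^ 2 / 4 := by
    intro t
    have hbad0 : 0 ≤ bad t := by
      apply Finset.expect_nonneg; intro z _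
      apply Finset.expect_nonneg; intro w _
      have := ind_le_one S (z + w)
      exact mul_nonneg (mul_nonneg (ind_nonneg _ _) (ind_nonneg _ _)) (by linarith)
    by_cases ht : den A ^ Q / 2 ≤ den (B t)
    · have h3 := hcon (B t) ht
      have hne : (B t).Nonempty := by
        rw [Finset.nonempty_iff_ne_empty]
        intro h0
        rw [h0] at ht
        have : den (∅ : Finset G) = 0 := by simp [den]
        rw [this] at ht
        have : 0 < den A ^ Q := by positivity
        linarith
      have e : bad t = den (B t) ^ 2 * (1 - 𝔼 x ∈ B t, 𝔼 y ∈ B t, ind S (x + y)) := by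
        rw [hbad]
        simp only [mul_assoc, ← Finset.mul_expect]
        simp_rw [expect_ind_mul, ← Finset.mul_expect, Finset.expect_sub_distrib,
          Finset.expect_const hne]
        ring
      have h5 : 0 ≤ den (B t) ^ 2 := sq_nonneg _
      have h4 : den (B t) ^ 2 ≤ bad t / κ := by
        rw [le_div_iff₀ hκ, e]
        apply mul_le_mul_of_nonneg_left _ h5
        linarith
      have : 0 ≤ (den A ^ Q) ^ 2 / 4 := by positivity
      linarith
    · push Not at ht
      have h0 : 0 ≤ den (B t) := by unfold den; positivity
      have : den (B t) ^ 2 ≤ (den A ^ Q / 2) ^ 2 := pow_le_pow_left₀ h0 ht.le 2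
      have : 0 ≤ bad t / κ := by positivity
      nlinarith
  have h6 := Finset.expect_le_expect (s := Finset.univ) (fun t _ => key t)
  rw [← hM1, Finset.expect_add_distrib, ← Finset.expect_div, Fintype.expect_const] at h6
  have h7 : (𝔼 t, bad t) / κ ≤ M / 4 := by
    rw [div_le_iff₀ hκ]; nlinarith
  have : 0 < (den A ^ Q) ^ 2 := by positivity
  linarith

end part1
end KM


namespace KM
set_option linter.unusedSectionVars false

open Finset
open scoped BigOperators

section part2

variable {G : Type*} [AddCommGroup G] [Module (ZMod 2) G] [Fintype G] [DecidableEq G]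

/-- averaging operator -/
noncomputable def U (B : Finset G) (u : G → ℝ) (z : G) : ℝ := 𝔼 t ∈ B, u (z + t)

lemma jensen_pow {ι : Type*} (s : Finset ι) (hs : s.Nonempty) (f : ι → ℝ) (m : ℕ) (hm : Even m) :
    (𝔼 i ∈ s, f i) ^ m ≤ 𝔼 i ∈ s, f i ^ m := by
  have hc : (#s : ℝ) ≠ 0 := by exact_mod_cast hs.card_pos.ne'
  have := Real.pow_arith_mean_le_arith_mean_pow_of_even s (fun _ => (1 : ℝ) / #s) f
    (fun _ _ => by positivity) (by simp [hc]) hm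
  rw [Finset.expect_eq_sum_div_card, Finset.expect_eq_sum_div_card, Finset.sum_div, Finset.sum_div]
  simpa [div_eq_inv_mul] using this

lemma U_comm (B C : Finset G) (u : G → ℝ) : U B (U C u) = U C (U B u) := by
  funext z
  unfold U
  rw [Finset.expect_comm]
  simp_rw [add_right_comm]

lemma U_sub (B : Finset G) (u v : G → ℝ) : U B (u - v) = U B u - U B v := by
  funext z
  simp [U, Finset.expect_sub_distrib]

lemma U_contract (T : Finset G) (hT : T.Nonempty) (u : G → ℝ) (m : ℕ) (hm : Even m) :
    𝔼 z, (U T u z) ^ m ≤ 𝔼 z, u z ^ m := by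
  calc 𝔼 z, (U T u z) ^ m ≤ 𝔼 z, 𝔼 t ∈ T, u (z + t) ^ m :=
        Finset.expect_le_expect (fun z _ => jensen_pow T hT _ m hm)
    _ = 𝔼 t ∈ T, 𝔼 z, u (z + t) ^ m := Finset.expect_comm _ _ _
    _ = 𝔼 t ∈ T, 𝔼 z, u z ^ m := by
        apply Finset.expect_congr rfl
        intro t _
        exact expect_shift (fun z => u z ^ m) t
    _ = _ := Finset.expect_const hT _

lemma pairing (A : Finset G) (u : G → ℝ) (m : ℕ) (hm : Even m) (hm0 : m ≠ 0) (ρ : ℝ) (hρ : 0 ≤ ρ)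
    (hA : (1 / 2 : ℝ) ^ m ≤ den A) (hu : 𝔼 z, u z ^ m ≤ ρ ^ m) : |𝔼 y ∈ A, u y| ≤ 2 * ρ := by
  have hpos : 0 < den A := lt_of_lt_of_le (by positivity) hA
  have hne : A.Nonempty := by
    rw [Finset.nonempty_iff_ne_empty]
    rintro rfl
    simp [den] at hpos
  have h1 := jensen_pow A hne u m hm
  have h2 := expect_ind_mul A (fun z => u z ^ m)
  have h3 : 𝔼 x, ind A x * u x ^ m ≤ ρ ^ m := by
    refine le_trans (Finset.expect_le_expect (fun x _ => ?_)) hu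
    have := hm.pow_nonneg (u x)
    have := ind_le_one A x
    nlinarith
  have h0 : 0 ≤ 𝔼 x ∈ A, u x ^ m := Finset.expect_nonneg (fun x _ => hm.pow_nonneg _)
  have h4 : (1 / 2 : ℝ) ^ m * 𝔼 x ∈ A, u x ^ m ≤ ρ ^ m := by
    refine le_trans ?_ (h2 ▸ h3)
    gcongr
  have h5 : |𝔼 y ∈ A, u y| ^ m ≤ (2 * ρ) ^ m := by
    rw [hm.pow_abs, mul_pow]
    have e : (2 : ℝ) ^ m * (1 / 2) ^ m = 1 := by rw [← mul_pow]; norm_num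
    have : (2 : ℝ) ^ m * ((1 / 2 : ℝ) ^ m * 𝔼 x ∈ A, u x ^ m) ≤ 2 ^ m * ρ ^ m := by gcongr
    rw [← mul_assoc, e, one_mul] at this
    linarith
  exact le_of_pow_le_pow_left₀ hm0 (by positivity) h5

lemma mgf_bound (A : Finset G) (hA : A.Nonempty) (Y : G → ℝ) (hY0 : ∀ x, 0 ≤ Y x)
    (hY1 : ∀ x, Y x ≤ 1) (l : ℝ) (hl : |l| ≤ 1) (k : ℕ) :
    𝔼 x ∈ Fintype.piFinset (fun _ : Fin k => A),
      Real.exp (l * ∑ i, (Y (x i) - 𝔼 y ∈ A, Y y)) ≤ Real.exp (l ^ 2 * k) := by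
  set μ := 𝔼 y ∈ A, Y y with hμ
  have hμ0 : 0 ≤ μ := Finset.expect_nonneg (fun x _ => hY0 x)
  have hμ1 : μ ≤ 1 := Finset.expect_le hA (fun x _ => hY1 x)
  have e : ∀ x : Fin k → G, Real.exp (l * ∑ i, (Y (x i) - μ)) =
      ∏ i, Real.exp (l * (Y (x i) - μ)) := by
    intro x
    rw [← Real.exp_sum, Finset.mul_sum]
  simp_rw [e]
  rw [← Finset.expect_pow A (fun x => Real.exp (l * (Y x - μ)))]
  have h1 : 𝔼 x ∈ A, Real.exp (l * (Y x - μ)) ≤ Real.exp (l ^ 2) := by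
    have h2 : ∀ x ∈ A, Real.exp (l * (Y x - μ)) ≤ 1 + l * (Y x - μ) + l ^ 2 := by
      intro x _
      have hd : |Y x - μ| ≤ 1 := by
        rw [abs_le]; constructor <;> linarith [hY0 x, hY1 x]
      have hd1 : |l * (Y x - μ)| ≤ 1 := by
        rw [abs_mul]
        exact mul_le_one₀ hl (abs_nonneg _) hd
      have h3 := (abs_le.1 (Real.abs_exp_sub_one_sub_id_le hd1)).2
      have h4 : (l * (Y x - μ)) ^ 2 ≤ l ^ 2 := by
        rw [mul_pow]
        have : (Y x - μ) ^ 2 ≤ 1 := by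
          rw [← sq_abs]; exact pow_le_one₀ (abs_nonneg _) hd
        nlinarith [sq_nonneg l]
      linarith
    refine (Finset.expect_le_expect h2).trans ?_
    rw [Finset.expect_add_distrib, Finset.expect_add_distrib, ← Finset.mul_expect,
      Finset.expect_sub_distrib, Finset.expect_const hA, Finset.expect_const hA,
      Finset.expect_const hA]
    rw [← hμ]
    have := Real.add_one_le_exp (l ^ 2)
    linarith
  have h0 : 0 ≤ 𝔼 x ∈ A, Real.exp (l * (Y x - μ)) :=
    Finset.expect_nonneg (fun x _ => (Real.exp_pos _).le)
  calc _ ≤ (Real.exp (l ^ 2)) ^ k := pow_le_pow_left₀ h0 h1 k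
    _ = _ := by rw [← Real.exp_nat_mul]; ring_nf

lemma moment_bound (A : Finset G) (hA : A.Nonempty) (Y : G → ℝ) (hY0 : ∀ x, 0 ≤ Y x)
    (hY1 : ∀ x, Y x ≤ 1) (m j : ℕ) (hm : Even m) (hm0 : m ≠ 0) (hj : 1 ≤ j) :
    𝔼 x ∈ Fintype.piFinset (fun _ : Fin (m * j ^ 2) => A),
      ((𝔼 i, Y (x i)) - 𝔼 y ∈ A, Y y) ^ m ≤ 2 * (3 / j : ℝ) ^ m := by
  set μ := 𝔼 y ∈ A, Y y with hμ
  set k := m * j ^ 2 with hk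
  have hj' : (1 : ℝ) ≤ j := by exact_mod_cast hj
  have hj0 : (0 : ℝ) < j := by linarith
  have hm' : (0 : ℝ) < m := by exact_mod_cast Nat.pos_of_ne_zero hm0
  have hkpos : 0 < k := by positivity
  have hkR : (k : ℝ) = m * (j : ℝ) ^ 2 := by rw [hk]; push_cast; ring
  have hl : |(1 / j : ℝ)| ≤ 1 := by
    rw [abs_of_pos (by positivity), div_le_one hj0]; exact hj'
  have hne : (Fintype.piFinset (fun _ : Fin k => A)).Nonempty := by
    rw [Fintype.piFinset_nonempty]; intro _; exact hA
  have hNk : Nonempty (Fin k) := ⟨⟨0, hkpos⟩⟩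
  have pt : ∀ x : Fin k → G, ((𝔼 i, Y (x i)) - μ) ^ m ≤ (1 / m : ℝ) ^ m * (1 / j : ℝ) ^ m *
      (m.factorial * (Real.exp ((1 / j : ℝ) * ∑ i, (Y (x i) - μ)) +
        Real.exp ((-(1 / j) : ℝ) * ∑ i, (Y (x i) - μ)))) := by
    intro x
    set s := ∑ i, (Y (x i) - μ) with hs
    have e1 : (𝔼 i, Y (x i)) - μ = (1 / m : ℝ) * (1 / j) * ((1 / j) * s) := by
      have : (𝔼 i, Y (x i)) - μ = 𝔼 i : Fin k, (Y (x i) - μ) := by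
        rw [Finset.expect_sub_distrib, Fintype.expect_const]
      rw [this, Fintype.expect_eq_sum_div_card, Fintype.card_fin, hkR, ← hs]
      field_simp
    rw [e1, mul_pow, mul_pow (1 / m : ℝ)]
    apply mul_le_mul_of_nonneg_left _ (by positivity)
    set y := (1 / j : ℝ) * s with hy
    have e2 : (-(1 / j) : ℝ) * s = -y := by rw [hy]; ring
    rw [e2, ← hm.pow_abs]
    have h1 := Real.pow_div_factorial_le_exp |y| (abs_nonneg y) m
    rw [div_le_iff₀ (by positivity)] at h1
    have h2 : Real.exp |y| ≤ Real.exp y + Real.exp (-y) := by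
      rcases abs_cases y with ⟨e, _⟩ | ⟨e, _⟩ <;> rw [e] <;>
        linarith [Real.exp_pos y, Real.exp_pos (-y)]
    have h3 : (0 : ℝ) < m.factorial := by positivity
    nlinarith
  have h1 := mgf_bound A hA Y hY0 hY1 (1 / j) hl k
  have h2 := mgf_bound A hA Y hY0 hY1 (-(1 / j)) (by rw [abs_neg]; exact hl) k
  have e3 : (1 / j : ℝ) ^ 2 * k = m := by rw [hkR]; field_simp
  rw [← hμ, e3] at h1
  rw [← hμ, neg_sq, e3] at h2
  refine (Finset.expect_le_expect (fun x _ => pt x)).trans ?_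
  rw [← Finset.mul_expect, ← Finset.mul_expect, Finset.expect_add_distrib]
  have hf : (m.factorial : ℝ) ≤ (m : ℝ) ^ m := by exact_mod_cast Nat.factorial_le_pow m
  have he : Real.exp m ≤ 3 ^ m := by
    have : Real.exp m = (Real.exp 1) ^ m := by rw [← Real.exp_nat_mul]; simp
    rw [this]
    have := Real.exp_one_lt_d9
    apply pow_le_pow_left₀ (Real.exp_pos 1).le
    linarith
  calc _ ≤ (1 / m : ℝ) ^ m * (1 / j : ℝ) ^ m * ((m : ℝ) ^ m * (Real.exp m + Real.exp m)) := by
        gcongr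
    _ ≤ (1 / m : ℝ) ^ m * (1 / j : ℝ) ^ m * ((m : ℝ) ^ m * (3 ^ m + 3 ^ m)) := by gcongr
    _ = 2 * (3 / j : ℝ) ^ m := by
        rw [div_pow, div_pow, div_pow]; field_simp; ring

/-- Croot and Sisask almost periodicity -/
lemma croot_sisask (A : Finset G) (S : G → ℝ) (hS0 : ∀ x, 0 ≤ S x) (hS1 : ∀ x, S x ≤ 1)
    (m j : ℕ) (hm : Even m) (hm0 : m ≠ 0) (hj : 1 ≤ j) (hA : (1 / 2 : ℝ) ^ m ≤ den A) :
    ∃ T : Finset G, (1 / 2 : ℝ) ^ (m * (m * j ^ 2) + 1) ≤ den T ∧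
      ∀ t ∈ T, 𝔼 z, (U A S (z + t) - U A S z) ^ m ≤ (12 / j : ℝ) ^ m := by
  have hN := card_pos' (G := G)
  have hNe : Nonempty G := ⟨0⟩
  have hpos : 0 < den A := lt_of_lt_of_le (by positivity) hA
  have hne : A.Nonempty := by
    rw [Finset.nonempty_iff_ne_empty]
    rintro rfl
    simp [den] at hpos
  have hj' : (1 : ℝ) ≤ j := by exact_mod_cast hj
  set k := m * j ^ 2 with hk
  set c : ℝ := (3 / j : ℝ) ^ m with hc
  have hcpos : 0 < c := by positivity
  set err : (Fin k → G) → ℝ := fun x => 𝔼 z, ((𝔼 i, S (z + x i)) - U A S z) ^ m with herr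
  have herr0 : ∀ x, 0 ≤ err x := fun x => Finset.expect_nonneg (fun z _ => hm.pow_nonneg _)
  have hmean : 𝔼 x ∈ Fintype.piFinset (fun _ : Fin k => A), err x ≤ 2 * c := by
    rw [herr, Finset.expect_comm]
    apply Finset.expect_le Finset.univ_nonempty
    intro z _
    exact moment_bound A hne (fun x => S (z + x)) (fun _ => hS0 _) (fun _ => hS1 _) m j hm hm0 hj
  set P := Fintype.piFinset (fun _ : Fin k => A) with hP
  have hPc : (#P : ℝ) = (#A : ℝ) ^ k := by
    rw [hP, Fintype.card_piFinset]; simp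
  have hApos : (0 : ℝ) < #A := by exact_mod_cast hne.card_pos
  have hPpos : (0 : ℝ) < #P := by rw [hPc]; positivity
  set L := P.filter (fun x => err x ≤ 4 * c) with hL
  have hLc : (#P : ℝ) / 2 ≤ #L := by
    rw [Finset.expect_eq_sum_div_card, div_le_iff₀ hPpos] at hmean
    have h1 : (#(P.filter (fun x => ¬ err x ≤ 4 * c)) : ℝ) * (4 * c) ≤ ∑ x ∈ P, err x := by
      calc (#(P.filter (fun x => ¬ err x ≤ 4 * c)) : ℝ) * (4 * c)
          = ∑ x ∈ P.filter (fun x => ¬ err x ≤ 4 * c), 4 * c := by simp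
        _ ≤ ∑ x ∈ P.filter (fun x => ¬ err x ≤ 4 * c), err x := by
            apply Finset.sum_le_sum
            intro x hx
            simp only [Finset.mem_filter, not_le] at hx
            exact hx.2.le
        _ ≤ ∑ x ∈ P, err x :=
            Finset.sum_le_sum_of_subset_of_nonneg (Finset.filter_subset _ _) (fun x _ _ => herr0 x)
    have h2 : (#L : ℝ) + #(P.filter (fun x => ¬ err x ≤ 4 * c)) = #P := by
      exact_mod_cast Finset.card_filter_add_card_filter_not (s := P) (fun x => err x ≤ 4 * c)
    have h3 : (#(P.filter (fun x => ¬ err x ≤ 4 * c)) : ℝ) * 2 ≤ #P := by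
      by_contra hcon
      rw [not_le] at hcon
      nlinarith
    linarith
  -- pigeonhole
  have hcount : ∃ y : Fin k → G, (1 / 2 : ℝ) ^ (m * k + 1) ≤
      den (Finset.univ.filter (fun t : G => (fun i => y i + t) ∈ L)) := by
    have h1 : 𝔼 y : Fin k → G, den (Finset.univ.filter (fun t : G => (fun i => y i + t) ∈ L)) =
        (#L : ℝ) / (Fintype.card G : ℝ) ^ k := by
      have e1 : ∀ y : Fin k → G, den (Finset.univ.filter (fun t : G => (fun i => y i + t) ∈ L)) =
          𝔼 t : G, (if (fun i => y i + t) ∈ L then (1 : ℝ) else 0) := by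
        intro y
        rw [Fintype.expect_eq_sum_div_card]
        simp [den]
      simp_rw [e1]
      rw [Finset.expect_comm]
      have e2 : ∀ t : G, 𝔼 y : Fin k → G, (if (fun i => y i + t) ∈ L then (1 : ℝ) else 0) =
          (#L : ℝ) / (Fintype.card G : ℝ) ^ k := by
        intro t
        have : 𝔼 y : Fin k → G, (if (fun i => y i + t) ∈ L then (1 : ℝ) else 0) =
            𝔼 y : Fin k → G, (if y ∈ L then (1 : ℝ) else 0) :=
          Fintype.expect_equiv (Equiv.addRight (fun _ => t)) _ _ (fun y => rfl)
        rw [this, Fintype.expect_eq_sum_div_card]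
        simp
      simp_rw [e2]
      rw [Fintype.expect_const]
    have h2 : (1 / 2 : ℝ) ^ (m * k + 1) ≤ (#L : ℝ) / (Fintype.card G : ℝ) ^ k := by
      have : (1 / 2 : ℝ) ^ (m * k + 1) ≤ den A ^ k / 2 := by
        rw [pow_succ, pow_mul]
        have : ((1 / 2 : ℝ) ^ m) ^ k ≤ den A ^ k := by gcongr
        linarith
      refine this.trans ?_
      unfold den
      rw [div_pow, div_right_comm]
      gcongr
      rw [← hPc]; exact hLc
    rw [← h1] at h2
    obtain ⟨y, _, hy⟩ := Finset.exists_le_of_le_expect Finset.univ_nonempty h2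
    exact ⟨y, hy⟩
  obtain ⟨y, hy⟩ := hcount
  set T0 := Finset.univ.filter (fun t : G => (fun i => y i + t) ∈ L) with hT0
  have hT0' : ∀ t ∈ T0, 𝔼 z, ((𝔼 i, S (z + y i)) - U A S (z + t)) ^ m ≤ 4 * c := by
    intro t ht
    simp only [hT0, hL, Finset.mem_filter, Finset.mem_univ, true_and] at ht
    refine le_trans (le_of_eq ?_) ht.2
    rw [herr]
    simp only
    rw [← expect_shift (fun z => ((𝔼 i, S (z + (y i + t))) - U A S z) ^ m) t]
    apply Finset.expect_congr rfl
    intro z _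
    have : ∀ i, z + t + (y i + t) = z + y i := by
      intro i
      calc z + t + (y i + t) = z + y i + (t + t) := by abel
        _ = _ := by rw [ZModModule.add_self, add_zero]
    simp_rw [this]
  have hT0ne : T0.Nonempty := by
    rw [Finset.nonempty_iff_ne_empty]
    intro h0
    rw [h0] at hy
    have : (0 : ℝ) < (1 / 2 : ℝ) ^ (m * k + 1) := by positivity
    have h00 : den (∅ : Finset G) = 0 := by simp [den]
    rw [h00] at hy
    linarith
  obtain ⟨t0, ht0⟩ := hT0ne
  refine ⟨T0.image (fun t => t + t0), ?_, ?_⟩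
  · unfold den at hy ⊢
    rwa [Finset.card_image_of_injective _ (add_left_injective t0)]
  · intro t ht
    obtain ⟨s, hs, rfl⟩ := Finset.mem_image.1 ht
    have e : 𝔼 z, (U A S (z + (s + t0)) - U A S z) ^ m
        = 𝔼 z, (U A S (z + s) - U A S (z + t0)) ^ m := by
      rw [← expect_shift (fun z => (U A S (z + (s + t0)) - U A S z) ^ m) t0]
      apply Finset.expect_congr rfl
      intro z _
      have : z + t0 + (s + t0) = z + s := by
        calc z + t0 + (s + t0) = z + s + (t0 + t0) := by abel
          _ = _ := by rw [ZModModule.add_self, add_zero]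
      rw [this]
    rw [e]
    have pt : ∀ z, (U A S (z + s) - U A S (z + t0)) ^ m ≤ 2 ^ (m - 1) *
        (((𝔼 i, S (z + y i)) - U A S (z + t0)) ^ m + ((𝔼 i, S (z + y i)) - U A S (z + s)) ^ m) := by
      intro z
      generalize (𝔼 i, S (z + y i)) = a
      generalize U A S (z + s) = b
      generalize U A S (z + t0) = d
      have h1 : (b - d) ^ m ≤ (|a - d| + |a - b|) ^ m := by
        rw [← hm.pow_abs]
        apply pow_le_pow_left₀ (abs_nonneg _)
        have : b - d = (a - d) - (a - b) := by ring
        rw [this]; exact abs_sub _ _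
      refine h1.trans ?_
      have := add_pow_le (abs_nonneg (a - d)) (abs_nonneg (a - b)) m
      rwa [hm.pow_abs, hm.pow_abs] at this
    refine (Finset.expect_le_expect (fun z _ => pt z)).trans ?_
    rw [← Finset.mul_expect, Finset.expect_add_distrib]
    have h1 := hT0' s hs
    have h2 := hT0' t0 ht0
    calc _ ≤ (2 : ℝ) ^ (m - 1) * (4 * c + 4 * c) := by gcongr
      _ = 2 ^ m * 4 * c := by
          have : (2 : ℝ) ^ m = 2 ^ (m - 1) * 2 := by
            rw [← pow_succ]; congr 1; omega
          rw [this]; ring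
      _ ≤ 2 ^ m * 2 ^ m * c := by
          have h2m : 2 ≤ m := by
            obtain ⟨r, hr⟩ := hm; omega
          have : (4 : ℝ) ≤ 2 ^ m := by
            calc (4 : ℝ) = 2 ^ 2 := by norm_num
              _ ≤ 2 ^ m := pow_le_pow_right₀ (by norm_num) h2m
          gcongr
      _ = (12 / j : ℝ) ^ m := by
          rw [hc, ← mul_pow, ← mul_pow]; congr 1; ring

/-- iterated almost periodicity, paired against `A` -/
lemma iterate_bound (A T : Finset G) (hT : T.Nonempty) (F : G → ℝ) (m : ℕ) (hm : Even m)
    (hm0 : m ≠ 0) (ρ : ℝ) (hρ : 0 ≤ ρ) (hA : (1 / 2 : ℝ) ^ m ≤ den A)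
    (hF : ∀ t ∈ T, 𝔼 z, (F (z + t) - F z) ^ m ≤ ρ ^ m) (l : ℕ) :
    |U A ((U T)^[l] F) 0 - U A F 0| ≤ l * (2 * ρ) := by
  have h1 : ∀ l, 𝔼 z, ((U T)^[l + 1] F z - (U T)^[l] F z) ^ m ≤ ρ ^ m := by
    intro l
    induction l with
    | zero =>
      simp only [zero_add, Function.iterate_one, Function.iterate_zero, id_eq]
      have e : ∀ z, U T F z - F z = 𝔼 t ∈ T, (F (z + t) - F z) := by
        intro z
        rw [Finset.expect_sub_distrib, Finset.expect_const hT]; rfl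
      simp_rw [e]
      refine (Finset.expect_le_expect (fun z _ => jensen_pow T hT _ m hm)).trans ?_
      rw [Finset.expect_comm]
      exact Finset.expect_le hT hF
    | succ l ih =>
      refine le_trans ?_ ih
      have e : ∀ z, (U T)^[l + 1 + 1] F z - (U T)^[l + 1] F z =
          U T ((U T)^[l + 1] F - (U T)^[l] F) z := by
        intro z
        rw [U_sub]
        rw [Function.iterate_succ_apply' _ (l + 1)]
        rw [Pi.sub_apply]
        congr 2
        rw [Function.iterate_succ_apply']
      simp_rw [e]
      exact U_contract T hT _ m hm
  induction l with
  | zero => simp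
  | succ l ih =>
    have h2 := pairing A (fun z => (U T)^[l + 1] F z - (U T)^[l] F z) m hm hm0 ρ hρ hA (h1 l)
    rw [Finset.expect_sub_distrib] at h2
    have e : ∀ u : G → ℝ, U A u 0 = 𝔼 y ∈ A, u y := by intro u; simp [U]
    rw [e, e] at ih ⊢
    push_cast
    calc _ = |((𝔼 y ∈ A, (U T)^[l + 1] F y) - 𝔼 y ∈ A, (U T)^[l] F y) +
        ((𝔼 y ∈ A, (U T)^[l] F y) - 𝔼 y ∈ A, F y)| := by congr 1; ring
      _ ≤ _ := abs_add_le _ _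
      _ ≤ _ := by linarith

end part2
end KM


namespace KM
set_option linter.unusedSectionVars false

open Finset
open scoped BigOperators

section part3

variable {G : Type*} [AddCommGroup G] [Module (ZMod 2) G] [Fintype G] [DecidableEq G]

/-- sign character of `ZMod 2` -/
noncomputable def sg (a : ZMod 2) : ℝ := if a = 0 then 1 else -1

lemma zmod2_cases (a : ZMod 2) : a = 0 ∨ a = 1 := by
  revert a; decide

lemma sg_zero : sg 0 = 1 := by simp [sg]

lemma sg_one : sg 1 = -1 := by simp [sg]

lemma sg_add (a b : ZMod 2) : sg (a + b) = sg a * sg b := by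
  have h11 : (1 : ZMod 2) + 1 = 0 := by decide
  rcases zmod2_cases a with rfl | rfl <;> rcases zmod2_cases b with rfl | rfl <;>
    simp [sg_zero, sg_one, h11]

lemma sg_cases (a : ZMod 2) : sg a = 1 ∨ sg a = -1 := by
  rcases zmod2_cases a with rfl | rfl
  · left; exact sg_zero
  · right; exact sg_one

lemma abs_sg (a : ZMod 2) : |sg a| = 1 := by
  rcases sg_cases a with h | h <;> simp [h]

lemma sg_sum {ι : Type*} (s : Finset ι) (f : ι → ZMod 2) : sg (∑ i ∈ s, f i) = ∏ i ∈ s, sg (f i) := by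
  classical
  induction s using Finset.induction_on with
  | empty => simp [sg_zero]
  | insert a s ha ih => rw [Finset.sum_insert ha, Finset.prod_insert ha, sg_add, ih]

lemma expect_sg (φ : Module.Dual (ZMod 2) G) (hφ : φ ≠ 0) : 𝔼 x, sg (φ x) = 0 := by
  have : ∃ y, φ y ≠ 0 := by
    by_contra h
    push Not at h
    exact hφ (LinearMap.ext h)
  obtain ⟨y, hy⟩ := this
  have hy1 : φ y = 1 := (zmod2_cases _).resolve_left hy
  have h1 := expect_shift (fun x => sg (φ x)) y
  simp_rw [map_add, sg_add, hy1, sg_one, mul_neg_one, Finset.expect_neg_distrib] at h1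
  linarith

variable [Fintype (Module.Dual (ZMod 2) G)]

lemma card_dual : (Fintype.card (Module.Dual (ZMod 2) G)) = Fintype.card G := by
  rw [Module.card_eq_pow_finrank (K := ZMod 2) (V := Module.Dual (ZMod 2) G),
    Module.card_eq_pow_finrank (K := ZMod 2) (V := G), Subspace.dual_finrank_eq]

lemma sum_sg (x : G) : ∑ φ : Module.Dual (ZMod 2) G, sg (φ x) =
    if x = 0 then (Fintype.card G : ℝ) else 0 := by
  split_ifs with hx
  · subst hx
    simp [sg_zero, card_dual]
  · have : ∃ ψ : Module.Dual (ZMod 2) G, ψ x ≠ 0 := by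
      by_contra h
      push Not at h
      exact hx ((Module.forall_dual_apply_eq_zero_iff (ZMod 2) x).1 h)
    obtain ⟨ψ, hψ⟩ := this
    have hψ1 : ψ x = 1 := (zmod2_cases _).resolve_left hψ
    have h1 : ∑ φ : Module.Dual (ZMod 2) G, sg ((φ + ψ) x) =
        ∑ φ : Module.Dual (ZMod 2) G, sg (φ x) :=
      Fintype.sum_equiv (Equiv.addRight ψ) _ _ (fun _ => rfl)
    simp_rw [LinearMap.add_apply, sg_add, hψ1, sg_one, mul_neg_one, Finset.sum_neg_distrib] at h1
    linarith

/-- Fourier coefficient of the uniform measure on a finset -/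
noncomputable def ft (B : Finset G) (φ : Module.Dual (ZMod 2) G) : ℝ := 𝔼 t ∈ B, sg (φ t)

lemma abs_ft_le (B : Finset G) (φ : Module.Dual (ZMod 2) G) : |ft B φ| ≤ 1 := by
  rcases B.eq_empty_or_nonempty with rfl | hB
  · simp [ft]
  · unfold ft
    refine (Finset.abs_expect_le _ _).trans ?_
    exact Finset.expect_le hB (fun x _ => (abs_sg _).le)

lemma add_eq_zero_iff' (x y : G) : x + y = 0 ↔ x = y := by
  rw [← ZModModule.sub_eq_add, sub_eq_zero]

lemma fourier_inv (u : G → ℝ) (z : G) :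
    u z = ∑ φ : Module.Dual (ZMod 2) G, (𝔼 x, u x * sg (φ x)) * sg (φ z) := by
  simp_rw [Finset.expect_mul]
  rw [← Finset.expect_sum_comm]
  simp_rw [mul_assoc, ← sg_add, ← map_add, ← Finset.mul_sum, sum_sg, add_eq_zero_iff']
  rw [Fintype.expect_eq_sum_div_card]
  have := card_pos' (G := G)
  simp only [mul_ite, mul_zero, Finset.sum_ite_eq', Finset.mem_univ, if_true]
  field_simp

lemma parseval (B : Finset G) (hB : B.Nonempty) :
    ∑ φ : Module.Dual (ZMod 2) G, ft B φ ^ 2 = 1 / den B := by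
  unfold ft
  simp_rw [sq, Finset.expect_mul_expect, ← sg_add, ← map_add]
  rw [← Finset.expect_sum_comm]
  simp_rw [← Finset.expect_sum_comm, sum_sg, add_eq_zero_iff']
  have hc : (#B : ℝ) ≠ 0 := by exact_mod_cast hB.card_pos.ne'
  have : ∀ x ∈ B, 𝔼 y ∈ B, (if x = y then (Fintype.card G : ℝ) else 0) = 1 / den B := by
    intro x hx
    rw [Finset.expect_eq_sum_div_card, Finset.sum_ite_eq, if_pos hx]
    unfold den
    rw [one_div_div]
  rw [Finset.expect_congr rfl this, Finset.expect_const hB]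

lemma U_fourier (B : Finset G) (c : Module.Dual (ZMod 2) G → ℝ) :
    U B (fun z => ∑ φ, c φ * sg (φ z)) = fun z => ∑ φ, (c φ * ft B φ) * sg (φ z) := by
  funext z
  unfold U ft
  rw [Finset.expect_sum_comm]
  apply Finset.sum_congr rfl
  intro φ _
  simp_rw [map_add, sg_add, ← mul_assoc]
  rw [← Finset.mul_expect]
  ring

lemma U_iter_fourier (B : Finset G) (c : Module.Dual (ZMod 2) G → ℝ) (l : ℕ) :
    (U B)^[l] (fun z => ∑ φ, c φ * sg (φ z)) =
      fun z => ∑ φ, (c φ * ft B φ ^ l) * sg (φ z) := by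
  induction l with
  | zero => simp
  | succ l ih =>
    rw [Function.iterate_succ_apply', ih, U_fourier]
    simp_rw [pow_succ, mul_assoc]

lemma riesz (Λ : Finset (Module.Dual (ZMod 2) G)) (hΛ : LinearIndepOn (ZMod 2) id (Λ : Set (Module.Dual (ZMod 2) G)))
    (C : ℝ) (b : Module.Dual (ZMod 2) G → ℝ) :
    𝔼 x, ∏ φ ∈ Λ, (b φ * sg (φ x) + C) = C ^ #Λ := by
  classical
  have hNe : Nonempty G := ⟨0⟩
  simp_rw [Finset.prod_add]
  rw [Finset.expect_sum_comm]
  have h1 : ∀ t ∈ Λ.powerset, t ≠ ∅ →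
      𝔼 x, ((∏ φ ∈ t, (b φ * sg (φ x))) * ∏ φ ∈ Λ \ t, C) = 0 := by
    intro t ht hne
    rw [Finset.mem_powerset] at ht
    have e : ∀ x : G, (∏ φ ∈ t, (b φ * sg (φ x))) * ∏ φ ∈ Λ \ t, C =
        ((∏ φ ∈ t, b φ) * ∏ φ ∈ Λ \ t, C) * sg ((∑ φ ∈ t, φ) x) := by
      intro x
      rw [Finset.prod_mul_distrib, LinearMap.sum_apply, sg_sum]
      ring
    simp_rw [e]
    rw [← Finset.mul_expect, expect_sg, mul_zero]
    intro h0
    rw [linearIndepOn_finset_iff] at hΛ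
    obtain ⟨ψ, hψ⟩ := Finset.nonempty_iff_ne_empty.2 hne
    have := hΛ (fun φ => if φ ∈ t then 1 else 0) (by
      simp only [id_eq, ite_smul, one_smul, zero_smul, Finset.sum_ite_mem]
      rw [Finset.inter_eq_right.2 ht]; exact h0) ψ (ht hψ)
    simp [hψ] at this
  rw [Finset.sum_eq_single ∅ h1 (by simp)]
  simp

lemma chang (Λ : Finset (Module.Dual (ZMod 2) G)) (hΛ : LinearIndepOn (ZMod 2) id (Λ : Set (Module.Dual (ZMod 2) G)))
    (T : Finset G) (M : ℕ) (hT : (1 / 2 : ℝ) ^ M ≤ den T)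
    (hspec : ∀ φ ∈ Λ, 1 / 2 ≤ |ft T φ|) : #Λ ≤ 6 * M := by
  have hpos : 0 < den T := lt_of_lt_of_le (by positivity) hT
  have hne : T.Nonempty := by
    rw [Finset.nonempty_iff_ne_empty]
    rintro rfl
    simp [den] at hpos
  set s : Module.Dual (ZMod 2) G → ℝ := fun φ => if 0 ≤ ft T φ then 1 else -1 with hs
  have hs1 : ∀ φ, s φ = 1 ∨ s φ = -1 := by
    intro φ; simp only [hs]; split_ifs <;> simp
  have hs2 : ∀ φ, s φ * ft T φ = |ft T φ| := by
    intro φ; simp only [hs]; split_ifs with h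
    · rw [abs_of_nonneg h, one_mul]
    · rw [abs_of_neg (not_le.1 h)]; ring
  set g : G → ℝ := fun x => ∑ φ ∈ Λ, (1 / 2 : ℝ) * (s φ * sg (φ x)) with hg
  have hexp : ∀ x, Real.exp (g x) =
      ∏ φ ∈ Λ, ((Real.sinh (1 / 2) * s φ) * sg (φ x) + Real.cosh (1 / 2)) := by
    intro x
    rw [hg, Real.exp_sum]
    apply Finset.prod_congr rfl
    intro φ _
    have hc : s φ * sg (φ x) = 1 ∨ s φ * sg (φ x) = -1 := by
      rcases hs1 φ with h | h <;> rcases sg_cases (φ x) with h' | h' <;> rw [h, h'] <;> norm_num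
    rw [mul_assoc (Real.sinh (1 / 2))]
    rcases hc with h | h <;> rw [h]
    · rw [mul_one, mul_one, Real.sinh_add_cosh]
    · rw [mul_neg_one, mul_neg_one, neg_add_eq_sub, Real.cosh_sub_sinh]
  have h1 : 𝔼 x, Real.exp (g x) = Real.cosh (1 / 2) ^ #Λ := by
    simp_rw [hexp]; exact riesz Λ hΛ _ _
  have h2 : 𝔼 x, Real.exp (g x) ≤ Real.exp (#Λ / 8) := by
    rw [h1]
    have := Real.cosh_le_exp_half_sq (1 / 2)
    calc Real.cosh (1 / 2) ^ #Λ ≤ (Real.exp ((1 / 2) ^ 2 / 2)) ^ #Λ :=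
          pow_le_pow_left₀ (Real.cosh_pos _).le this _
      _ = _ := by rw [← Real.exp_nat_mul]; congr 1; ring
  have h3 : (#Λ : ℝ) / 4 ≤ 𝔼 x ∈ T, g x := by
    rw [hg, Finset.expect_sum_comm]
    simp_rw [← Finset.mul_expect]
    have : ∀ φ ∈ Λ, (1 / 4 : ℝ) ≤ 1 / 2 * (s φ * 𝔼 t ∈ T, sg (φ t)) := by
      intro φ hφ
      have := hspec φ hφ
      rw [← hs2] at this
      unfold ft at this
      linarith
    have h := Finset.sum_le_sum this
    simp only [Finset.sum_const, nsmul_eq_mul] at h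
    linarith
  have h4 : Real.exp (#Λ / 4) ≤ 𝔼 x ∈ T, Real.exp (g x) := by
    have : ∀ x ∈ T, Real.exp (#Λ / 4) * (1 + (g x - #Λ / 4)) ≤ Real.exp (g x) := by
      intro x _
      have h := Real.add_one_le_exp (g x - #Λ / 4)
      have e : Real.exp (g x) = Real.exp (#Λ / 4) * Real.exp (g x - #Λ / 4) := by
        rw [← Real.exp_add]; congr 1; ring
      rw [e]
      gcongr
      linarith
    refine le_trans ?_ (Finset.expect_le_expect this)
    rw [← Finset.mul_expect, Finset.expect_add_distrib, Finset.expect_sub_distrib,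
      Finset.expect_const hne, Finset.expect_const hne]
    have := Real.exp_pos (#Λ / 4 : ℝ)
    nlinarith
  have h5 : den T * 𝔼 x ∈ T, Real.exp (g x) ≤ Real.exp (#Λ / 8) := by
    rw [← expect_ind_mul]
    refine le_trans (Finset.expect_le_expect (fun x _ => ?_)) h2
    have := ind_le_one T x
    have := Real.exp_pos (g x)
    nlinarith
  have h6 : (1 / 2 : ℝ) ^ M * Real.exp (#Λ / 4) ≤ Real.exp (#Λ / 8) := by
    refine le_trans ?_ h5
    gcongr
  have h7 : Real.exp (#Λ / 8) ≤ 2 ^ M := by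
    have e : Real.exp (#Λ / 4 : ℝ) = Real.exp (#Λ / 8) * Real.exp (#Λ / 8) := by
      rw [← Real.exp_add]; congr 1; ring
    have hp := Real.exp_pos (#Λ / 8 : ℝ)
    rw [e, ← mul_assoc] at h6
    have h8 : (1 / 2 : ℝ) ^ M * Real.exp (#Λ / 8) ≤ 1 := by
      by_contra hcon
      rw [not_le] at hcon
      nlinarith
    have e2 : (2 : ℝ) ^ M * (1 / 2) ^ M = 1 := by rw [← mul_pow]; norm_num
    calc Real.exp (#Λ / 8) = 2 ^ M * ((1 / 2 : ℝ) ^ M * Real.exp (#Λ / 8)) := by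
          rw [← mul_assoc, e2, one_mul]
      _ ≤ 2 ^ M * 1 := by gcongr
      _ = _ := mul_one _
  have h8 : (#Λ : ℝ) / 8 ≤ M * Real.log 2 := by
    have := Real.log_le_log (Real.exp_pos _) h7
    rwa [Real.log_exp, Real.log_pow] at this
  have h9 := Real.log_two_lt_d9
  have h10 : (#Λ : ℝ) ≤ 6 * M := by
    have : (0 : ℝ) ≤ M := by positivity
    nlinarith
  exact_mod_cast h10

lemma U_mono_const (B : Finset G) (hB : B.Nonempty) (u : G → ℝ) (c : ℝ) (hu : ∀ z, u z ≤ c) (z : G) :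
    U B u z ≤ c := Finset.expect_le hB (fun _ _ => hu _)

lemma U_iter_comm (B C : Finset G) (u : G → ℝ) (l : ℕ) :
    U B ((U C)^[l] u) = (U C)^[l] (U B u) := by
  induction l with
  | zero => rfl
  | succ l ih =>
    rw [Function.iterate_succ_apply', Function.iterate_succ_apply', U_comm, ih]

/-- almost periodicity: the set `S` is dense on a coset of a large subspace -/
lemma bogo (A S : Finset G) (m j l : ℕ) (hm : Even m) (hm0 : m ≠ 0) (hj : 1 ≤ j)
    (hA : (1 / 2 : ℝ) ^ m ≤ den A) :
    ∃ (V : Submodule (ZMod 2) G) (VF : Finset G) (w : G), (∀ x, x ∈ VF ↔ x ∈ V) ∧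
      Module.finrank (ZMod 2) G ≤ Module.finrank (ZMod 2) V + 6 * (m * (m * j ^ 2) + 1) ∧
      (𝔼 x ∈ A, 𝔼 y ∈ A, ind S (x + y)) - l * (2 * (12 / j)) - 2 * 2 ^ m * (1 / 2) ^ l ≤
        𝔼 v ∈ VF, ind S (w + v) := by
  classical
  have hpos : 0 < den A := lt_of_lt_of_le (by positivity) hA
  have hne : A.Nonempty := by
    rw [Finset.nonempty_iff_ne_empty]
    rintro rfl
    simp [den] at hpos
  obtain ⟨T, hT, hT2⟩ := croot_sisask A (ind S) (ind_nonneg S) (ind_le_one S) m j hm hm0 hj hA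
  have hTpos : 0 < den T := lt_of_lt_of_le (by positivity) hT
  have hTne : T.Nonempty := by
    rw [Finset.nonempty_iff_ne_empty]
    rintro rfl
    simp [den] at hTpos
  set Spec : Set (Module.Dual (ZMod 2) G) := {φ | 1 / 2 ≤ |ft T φ|} with hSpec
  obtain ⟨b, hb1, hb2, hb3⟩ := exists_linearIndependent (ZMod 2) Spec
  set V := (Submodule.span (ZMod 2) Spec).dualCoannihilator with hV
  set VF : Finset G := Finset.univ.filter (fun x => x ∈ V) with hVF
  have hVF' : ∀ x, x ∈ VF ↔ x ∈ V := by intro x; simp [hVF]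
  have hVne : VF.Nonempty := ⟨0, (hVF' 0).2 V.zero_mem⟩
  have hdim : Module.finrank (ZMod 2) G ≤
      Module.finrank (ZMod 2) V + 6 * (m * (m * j ^ 2) + 1) := by
    have h1 := Subspace.finrank_add_finrank_dualCoannihilator_eq (Submodule.span (ZMod 2) Spec)
    have hb4 : LinearIndepOn (ZMod 2) id ((b.toFinset : Finset _) : Set (Module.Dual (ZMod 2) G)) := by
      rw [Set.coe_toFinset]; exact hb3
    have h2 := finrank_span_finset_eq_card hb4
    rw [Set.coe_toFinset, hb2] at h2
    have h3 := chang b.toFinset hb4 T _ hT (by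
      intro φ hφ
      rw [Set.mem_toFinset] at hφ
      exact hb1 hφ)
    rw [← hV] at h1
    omega
  obtain ⟨w, hw⟩ := Finite.exists_max (fun z => U VF (ind S) z)
  refine ⟨V, VF, w, hVF', hdim, ?_⟩
  change _ ≤ U VF (ind S) w
  set H := U A ((U T)^[l] (U A (ind S))) with hH
  -- upper bound
  have up : U VF H 0 ≤ U VF (ind S) w := by
    have e : U VF H = U A ((U T)^[l] (U A (U VF (ind S)))) := by
      rw [hH, U_comm, U_iter_comm, U_comm VF A]
    rw [e]
    apply U_mono_const A hne
    have : ∀ l z, (U T)^[l] (U A (U VF (ind S))) z ≤ U VF (ind S) w := by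
      intro l
      induction l with
      | zero => intro z; exact U_mono_const A hne _ _ hw z
      | succ l ih =>
        intro z
        rw [Function.iterate_succ_apply']
        exact U_mono_const T hTne _ _ ih z
    exact this l
  -- almost periodicity
  have ap : |H 0 - U A (U A (ind S)) 0| ≤ l * (2 * (12 / j)) :=
    iterate_bound A T hTne (U A (ind S)) m hm hm0 (12 / j) (by positivity) hA hT2 l
  have e0 : U A (U A (ind S)) 0 = 𝔼 x ∈ A, 𝔼 y ∈ A, ind S (x + y) := by simp [U]
  -- Fourier
  set c : Module.Dual (ZMod 2) G → ℝ := fun φ => 𝔼 x, ind S x * sg (φ x) with hc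
  have hc1 : ∀ φ, |c φ| ≤ 1 := by
    intro φ
    refine (Finset.abs_expect_le _ _).trans ?_
    apply Finset.expect_le ⟨0, Finset.mem_univ _⟩
    intro x _
    rw [abs_mul, abs_sg, mul_one, abs_of_nonneg (ind_nonneg _ _)]
    exact ind_le_one _ _
  have hHf : H = fun z => ∑ φ, (c φ * ft A φ * ft T φ ^ l * ft A φ) * sg (φ z) := by
    have : ind S = fun z => ∑ φ, c φ * sg (φ z) := by
      funext z; exact fourier_inv (ind S) z
    rw [hH, this, U_fourier, U_iter_fourier, U_fourier]
  have hdiff : ∀ v ∈ VF, H 0 - 2 * 2 ^ m * (1 / 2) ^ l ≤ H v := by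
    intro v hv
    rw [hVF'] at hv
    have hv' : ∀ φ ∈ Spec, φ v = 0 := by
      intro φ hφ
      exact (Submodule.mem_dualCoannihilator v).1 hv φ (Submodule.subset_span hφ)
    have h1 : |H 0 - H v| ≤ 2 * 2 ^ m * (1 / 2) ^ l := by
      rw [hHf]
      simp only
      rw [← Finset.sum_sub_distrib]
      refine (Finset.abs_sum_le_sum_abs _ _).trans ?_
      have pt : ∀ φ ∈ (Finset.univ : Finset (Module.Dual (ZMod 2) G)),
          |c φ * ft A φ * ft T φ ^ l * ft A φ * sg (φ 0) -
            c φ * ft A φ * ft T φ ^ l * ft A φ * sg (φ v)| ≤ ft A φ ^ 2 * (2 * (1 / 2) ^ l) := by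
        intro φ _
        rw [map_zero, sg_zero]
        by_cases hφ : φ ∈ Spec
        · rw [hv' φ hφ, sg_zero, sub_self, abs_zero]
          positivity
        · have h2 : |ft T φ| ≤ 1 / 2 := by
            simp only [hSpec, Set.mem_ofPred_eq, not_le] at hφ
            exact hφ.le
          have h3 : |ft T φ| ^ l ≤ (1 / 2) ^ l := pow_le_pow_left₀ (abs_nonneg _) h2 l
          have h4 : |1 - sg (φ v)| ≤ 2 := by
            rcases sg_cases (φ v) with h | h <;> rw [h] <;> norm_num
          have e : c φ * ft A φ * ft T φ ^ l * ft A φ * 1 -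
            c φ * ft A φ * ft T φ ^ l * ft A φ * sg (φ v) =
              ft A φ ^ 2 * ((c φ * (1 - sg (φ v))) * ft T φ ^ l) := by ring
          rw [e, abs_mul, abs_of_nonneg (sq_nonneg (ft A φ)), abs_mul, abs_mul, abs_pow]
          have h5 : |c φ| * |1 - sg (φ v)| ≤ 1 * 2 :=
            mul_le_mul (hc1 φ) h4 (abs_nonneg _) (by norm_num)
          rw [one_mul] at h5
          gcongr
      refine (Finset.sum_le_sum pt).trans ?_
      rw [← Finset.sum_mul, parseval A hne]
      have h6 : 1 / den A ≤ 2 ^ m := by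
        rw [div_le_iff₀ hpos]
        have e2 : (2 : ℝ) ^ m * (1 / 2) ^ m = 1 := by rw [← mul_pow]; norm_num
        calc (1 : ℝ) = (2 : ℝ) ^ m * (1 / 2) ^ m := e2.symm
          _ ≤ _ := by gcongr
      calc 1 / den A * (2 * (1 / 2) ^ l) ≤ 2 ^ m * (2 * (1 / 2) ^ l) := by gcongr
        _ = _ := by ring
    have := (abs_le.1 h1).2
    linarith
  have lo : H 0 - 2 * 2 ^ m * (1 / 2) ^ l ≤ U VF H 0 := by
    apply Finset.le_expect hVne
    intro v hv
    rw [zero_add]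
    exact hdiff v hv
  rw [← e0]
  have := (abs_le.1 ap).1
  linarith

end part3
end KM


namespace KM
set_option linter.unusedSectionVars false

open Finset
open scoped BigOperators

section part4

variable {G : Type*} [AddCommGroup G] [Module (ZMod 2) G] [Fintype G] [DecidableEq G]

lemma numeric (ε : ℝ) (hε0 : 0 < ε) (hε1 : ε < 1 / 2) (P R E : ℕ) (hP : 1 ≤ P) (hR : 1 ≤ R)
    (hR' : 1 / ε ≤ 2 ^ R) (hE : 1 / ε ≤ E) :
    (1 + ε / 8) ^ (2 * P + 280 * E * R * P) ≤
      (ε / 64) / 4 * (((ε / 2) ^ (2 * P) - (ε / 4) ^ (2 * P)) *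
        (1 + ε / 4) ^ (280 * E * R * P) / 2) := by
  set q := 280 * E * R * P with hq
  have hRε : (1 / 2 : ℝ) ^ R ≤ ε := by
    rw [div_le_iff₀ hε0] at hR'
    have e2 : (1 / 2 : ℝ) ^ R * 2 ^ R = 1 := by rw [← mul_pow]; norm_num
    calc (1 / 2 : ℝ) ^ R = (1 / 2 : ℝ) ^ R * 1 := (mul_one _).symm
      _ ≤ (1 / 2 : ℝ) ^ R * (2 ^ R * ε) := by gcongr
      _ = ε := by rw [← mul_assoc, e2, one_mul]
  have h1 : (1 + ε / 8) ^ q * 2 ^ (28 * R * P) ≤ (1 + ε / 4) ^ q := by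
    have a1 : (2 : ℝ) ≤ (1 + ε / 10) ^ (10 * E) := by
      have := one_add_mul_le_pow (a := ε / 10) (by linarith) (10 * E)
      refine le_trans ?_ this
      rw [div_le_iff₀ hε0] at hE
      push_cast
      linarith
    have a2 : (2 : ℝ) ^ (28 * R * P) ≤ (1 + ε / 10) ^ q := by
      have : q = (10 * E) * (28 * R * P) := by rw [hq]; ring
      rw [this, pow_mul (1 + ε / 10)]
      exact pow_le_pow_left₀ (by norm_num) a1 _
    calc (1 + ε / 8) ^ q * 2 ^ (28 * R * P) ≤ (1 + ε / 8) ^ q * (1 + ε / 10) ^ q := by gcongr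
      _ = ((1 + ε / 8) * (1 + ε / 10)) ^ q := (mul_pow _ _ _).symm
      _ ≤ (1 + ε / 4) ^ q := by
        apply pow_le_pow_left₀ (by positivity)
        nlinarith
  have h2 : (1 / 2 : ℝ) ^ (2 * P * (R + 1) + 1) ≤ (ε / 2) ^ (2 * P) - (ε / 4) ^ (2 * P) := by
    have a1 : (ε / 4) ^ (2 * P) ≤ (ε / 2) ^ (2 * P) * (1 / 2) := by
      have : ε / 4 = (ε / 2) * (1 / 2) := by ring
      rw [this, mul_pow]
      gcongr
      calc (1 / 2 : ℝ) ^ (2 * P) ≤ (1 / 2 : ℝ) ^ 1 :=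
            pow_le_pow_of_le_one (by norm_num) (by norm_num) (by omega)
        _ = 1 / 2 := pow_one _
    have a2 : (1 / 2 : ℝ) ^ (2 * P * (R + 1)) ≤ (ε / 2) ^ (2 * P) := by
      rw [mul_comm, pow_mul]
      apply pow_le_pow_left₀ (by positivity)
      rw [pow_succ]
      linarith
    rw [pow_succ]
    linarith
  have h3 : (1 / 2 : ℝ) ^ (R + 8) ≤ (ε / 64) / 4 := by
    rw [pow_add]
    have : (1 / 2 : ℝ) ^ 8 = 1 / 256 := by norm_num
    rw [this]; linarith
  have h4 : (1 + ε / 8) ^ (2 * P) ≤ 2 ^ (2 * P) := pow_le_pow_left₀ (by positivity) (by linarith) _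
  have h5 : (2 : ℝ) ^ (2 * P) ≤
      (1 / 2 : ℝ) ^ (R + 8) * ((1 / 2 : ℝ) ^ (2 * P * (R + 1) + 1) * 2 ^ (28 * R * P) * (1 / 2)) := by
    have e : (1 / 2 : ℝ) ^ (R + 8) * ((1 / 2 : ℝ) ^ (2 * P * (R + 1) + 1) * 2 ^ (28 * R * P) * (1 / 2))
      = (1 / 2 : ℝ) ^ (R + 8 + (2 * P * (R + 1) + 1) + 1) * 2 ^ (28 * R * P) := by
      rw [pow_succ _ (R + 8 + (2 * P * (R + 1) + 1)), pow_add _ (R + 8)]; ring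
    rw [e, one_div, inv_pow, ← div_eq_inv_mul, le_div_iff₀ (by positivity), ← pow_add]
    apply pow_le_pow_right₀ (by norm_num)
    nlinarith [mul_le_mul hP hR (by norm_num) (by omega)]
  have hd : 0 ≤ (ε / 2) ^ (2 * P) - (ε / 4) ^ (2 * P) := le_trans (by positivity) h2
  calc (1 + ε / 8) ^ (2 * P + q) = (1 + ε / 8) ^ (2 * P) * (1 + ε / 8) ^ q := pow_add _ _ _
    _ ≤ ((1 / 2 : ℝ) ^ (R + 8) *
        ((1 / 2 : ℝ) ^ (2 * P * (R + 1) + 1) * 2 ^ (28 * R * P) * (1 / 2))) * (1 + ε / 8) ^ q := by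
        gcongr
        exact h4.trans h5
    _ = (1 / 2 : ℝ) ^ (R + 8) *
        ((1 / 2 : ℝ) ^ (2 * P * (R + 1) + 1) * ((1 + ε / 8) ^ q * 2 ^ (28 * R * P)) / 2) := by ring
    _ ≤ _ := by gcongr

/-- balanced function -/
noncomputable def bal (A : Finset G) (x : G) : ℝ := ind A x / den A - 1

lemma cv_bal (A B : Finset G) (hA : A.Nonempty) (hB : B.Nonempty) (z : G) :
    1 + cv (bal A) (bal B) z = cv (ind A) (ind B) z / (den A * den B) := by
  have hNe : Nonempty G := ⟨0⟩
  have hα := den_pos hA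
  have hβ := den_pos hB
  unfold cv bal
  have e : ∀ x, (ind A x / den A - 1) * (ind B (x + z) / den B - 1) =
      (ind A x * ind B (x + z)) / (den A * den B) - ind A x / den A - ind B (x + z) / den B + 1 := by
    intro x
    field_simp
    ring
  simp_rw [e]
  rw [Finset.expect_add_distrib, Finset.expect_sub_distrib, Finset.expect_sub_distrib,
    ← Finset.expect_div, ← Finset.expect_div, ← Finset.expect_div, expect_ind A hA,
    expect_shift (ind B) z, expect_ind B hB, Fintype.expect_const, div_self hα.ne', div_self hβ.ne']
  ring

/-- abstract spreadness -/
def Spread (A : Finset G) (r : ℕ) (ε : ℝ) : Prop :=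
  ∀ (V : Submodule (ZMod 2) G) (VF : Finset G) (w : G), (∀ x, x ∈ VF ↔ x ∈ V) →
    Module.finrank (ZMod 2) G ≤ Module.finrank (ZMod 2) V + r →
    𝔼 v ∈ VF, ind A (w + v) ≤ (1 + ε) * den A

lemma core (A : Finset G) (hA : A.Nonempty) (ε : ℝ) (hε0 : 0 < ε) (hε1 : ε < 1 / 2)
    (P R E r : ℕ) (hP : 1 ≤ P) (hR : 1 ≤ R) (hE1 : 1 ≤ E)
    (hR' : 1 / ε ≤ 2 ^ R) (hE : 1 / ε ≤ E) (hPA : (1 / 2 : ℝ) ^ P ≤ den A)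
    (hr : 7 * 566 ^ 2 * (3072 * 575) ^ 2 * (P ^ 8 * R ^ 4 * E ^ 6) ≤ r)
    (hsp : Spread A r (ε / 16)) :
    𝔼 z, (cv (bal A) (bal A) z) ^ (2 * P) ≤ (ε / 2) ^ (2 * P) := by
  have hNe : Nonempty G := ⟨0⟩
  haveI : Finite (Module.Dual (ZMod 2) G) := Module.finite_of_finite (ZMod 2)
  letI : Fintype (Module.Dual (ZMod 2) G) := Fintype.ofFinite _
  by_contra hcon
  rw [not_le] at hcon
  have hα := den_pos hA
  set q := 280 * E * R * P with hq
  set Q := 2 * P + q with hQ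
  have hun := unbalance (cv (bal A) (bal A)) (spectral_nonneg (bal A)) (2 * P) q (even_two_mul P)
    (by rw [hq]; exact ⟨140 * E * R * P, by ring⟩) (ε / 2) (ε / 4) (by linarith) hcon.le
  have hnum := numeric ε hε0 hε1 P R E hP hR hR' hE
  rw [← hq, ← hQ] at hnum
  rw [← hQ] at hun
  set c := cv (ind A) (ind A) with hc
  have hEc : 𝔼 z, c z ^ Q = (den A ^ Q) ^ 2 * 𝔼 z, (1 + cv (bal A) (bal A) z) ^ Q := by
    rw [Finset.mul_expect]
    apply Finset.expect_congr rfl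
    intro z _
    rw [cv_bal A A hA hA, ← hc, div_pow, mul_pow]
    field_simp
  set I := 𝔼 z, (1 + cv (bal A) (bal A) z) ^ Q with hI
  have hnum2 : (1 + ε / 8) ^ Q ≤ (ε / 64) / 4 * I := by
    refine hnum.trans ?_
    gcongr
  have hI1 : 1 ≤ I := by
    have : (1 : ℝ) ≤ (1 + ε / 8) ^ Q := one_le_pow₀ (by linarith)
    by_contra hlt
    rw [not_le] at hlt
    nlinarith
  set θ := (1 + ε / 8) * den A ^ 2 with hθ
  set S : Finset G := Finset.univ.filter (fun z => θ ≤ c z) with hS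
  obtain ⟨B, hB1, hB2⟩ := sift A Q θ (ε / 64) S
    (by
      intro z hz
      simp only [hS, Finset.mem_filter, Finset.mem_univ, true_and, not_le] at hz
      exact hz.le) (by positivity) (by positivity) hA
    (by
      rw [← hc, hEc, hθ, mul_pow, ← pow_mul, ← pow_mul, mul_comm 2 Q]
      calc (1 + ε / 8) ^ Q * den A ^ (Q * 2) ≤ ((ε / 64) / 4 * I) * den A ^ (Q * 2) := by gcongr
        _ = _ := by ring)
    (by
      rw [← hc, hEc]
      exact le_mul_of_one_le_right (by positivity) hI1)
  set m := 2 * (P * Q + 1) with hm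
  set l := m + 8 + R with hl
  set j := 3072 * l * E with hj
  have hBm : (1 / 2 : ℝ) ^ m ≤ den B := by
    refine le_trans ?_ hB1
    calc (1 / 2 : ℝ) ^ m ≤ (1 / 2 : ℝ) ^ (P * Q + 1) :=
          pow_le_pow_of_le_one (by norm_num) (by norm_num) (by omega)
      _ = ((1 / 2 : ℝ) ^ P) ^ Q / 2 := by rw [pow_succ, pow_mul]; ring
      _ ≤ _ := by gcongr
  have hl1 : 1 ≤ l := by omega
  have hj1 : 1 ≤ j := by
    rw [hj]; exact Nat.one_le_iff_ne_zero.2 (by positivity)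
  obtain ⟨V, VF, w, hVF, hdim, hbog⟩ := bogo B S m j l (even_two_mul _) (by omega) hj1 hBm
  -- dimension
  have hdim2 : 6 * (m * (m * j ^ 2) + 1) ≤ r := by
    refine le_trans ?_ hr
    set X := E * R * P ^ 2 with hX
    have hX1 : 1 ≤ X := Nat.one_le_iff_ne_zero.2 (by positivity)
    have hPP : 1 ≤ E * R := Nat.one_le_iff_ne_zero.2 (by positivity)
    have hPX : P * P ≤ X := by
      rw [hX, sq]; exact Nat.le_mul_of_pos_left _ hPP
    have hRX : R ≤ X := by
      have : 1 ≤ E * P ^ 2 := Nat.one_le_iff_ne_zero.2 (by positivity)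
      calc R ≤ R * (E * P ^ 2) := Nat.le_mul_of_pos_right _ this
        _ = X := by rw [hX]; ring
    have hmX : m ≤ 566 * X := by
      have : P * Q = 2 * (P * P) + 280 * X := by rw [hQ, hq, hX]; ring
      rw [hm, this]; omega
    have hlX : l ≤ 575 * X := by omega
    have hjX : j ≤ 3072 * 575 * X * E := by
      rw [hj]
      calc 3072 * l * E ≤ 3072 * (575 * X) * E := by gcongr
        _ = _ := by ring
    have hm1 : 1 ≤ m := by omega
    calc 6 * (m * (m * j ^ 2) + 1) ≤ 7 * (m ^ 2 * j ^ 2) := by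
          have : 6 ≤ m ^ 2 * j ^ 2 := by
            have h1 : 3072 ≤ j := by
              rw [hj, mul_assoc]
              exact Nat.le_mul_of_pos_right _ (by positivity)
            have : 1 ≤ m ^ 2 := Nat.one_le_pow _ _ hm1
            nlinarith
          have e : m * (m * j ^ 2) = m ^ 2 * j ^ 2 := by ring
          rw [e]; omega
      _ ≤ 7 * ((566 * X) ^ 2 * (3072 * 575 * X * E) ^ 2) := by gcongr
      _ = _ := by rw [hX]; ring
  have hspV := hsp V VF
  have hub : 𝔼 v ∈ VF, c (w + v) ≤ (1 + ε / 16) * den A ^ 2 := by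
    rw [hc]
    unfold cv
    rw [Finset.expect_comm]
    have : ∀ x ∈ (Finset.univ : Finset G), 𝔼 v ∈ VF, ind A x * ind A (x + (w + v)) ≤
        ind A x * ((1 + ε / 16) * den A) := by
      intro x _
      rw [← Finset.mul_expect]
      apply mul_le_mul_of_nonneg_left _ (ind_nonneg _ _)
      have := hspV (x + w) hVF (by omega)
      simp_rw [← add_assoc]
      exact this
    refine (Finset.expect_le_expect this).trans_eq ?_
    rw [← Finset.expect_mul, expect_ind A hA]
    ring
  have hlb : θ * 𝔼 v ∈ VF, ind S (w + v) ≤ 𝔼 v ∈ VF, c (w + v) := by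
    rw [Finset.mul_expect]
    apply Finset.expect_le_expect
    intro v _
    by_cases hv : w + v ∈ S
    · have h1 : ind S (w + v) = 1 := by simp [ind, hv]
      rw [h1, mul_one]
      simpa [hS] using hv
    · have h1 : ind S (w + v) = 0 := by simp [ind, hv]
      rw [h1, mul_zero]
      exact Finset.expect_nonneg (fun x _ => mul_nonneg (ind_nonneg _ _) (ind_nonneg _ _))
  have herr1 : (l : ℝ) * (2 * (12 / j)) ≤ ε / 128 := by
    have hl0 : (0 : ℝ) < l := by exact_mod_cast hl1
    have hE0 : (0 : ℝ) < E := by exact_mod_cast hE1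
    rw [hj]
    push_cast
    have : (l : ℝ) * (2 * (12 / (3072 * l * E))) = (1 / E) / 128 := by
      field_simp; norm_num
    rw [this]
    have : 1 / (E : ℝ) ≤ ε := by
      rw [div_le_iff₀ hε0] at hE
      rw [div_le_iff₀ hE0]; linarith
    linarith
  have herr2 : (2 : ℝ) * 2 ^ m * (1 / 2) ^ l ≤ ε / 128 := by
    have e2 : (2 : ℝ) ^ m * (1 / 2) ^ m = 1 := by rw [← mul_pow]; norm_num
    rw [hl, pow_add, pow_add]
    have : (2 : ℝ) * 2 ^ m * ((1 / 2) ^ m * (1 / 2) ^ 8 * (1 / 2) ^ R) =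
        ((2 : ℝ) ^ m * (1 / 2) ^ m) * (1 / 2) ^ R / 128 := by ring
    rw [this, e2, one_mul]
    have hRε : (1 / 2 : ℝ) ^ R ≤ ε := by
      rw [one_div, inv_pow]
      rw [one_div] at hR'
      exact inv_le_of_inv_le₀ hε0 hR'
    linarith
  have hfin : 1 - ε / 32 ≤ 𝔼 v ∈ VF, ind S (w + v) := by linarith
  have hθ0 : 0 ≤ θ := by positivity
  have h9 : θ * (1 - ε / 32) ≤ (1 + ε / 16) * den A ^ 2 :=
    (mul_le_mul_of_nonneg_left hfin hθ0).trans (hlb.trans hub)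
  rw [hθ] at h9
  have hα2 : 0 < den A ^ 2 := by positivity
  have h10 : (1 + ε / 8) * (1 - ε / 32) ≤ 1 + ε / 16 := by
    have : ((1 + ε / 8) * (1 - ε / 32)) * den A ^ 2 ≤ (1 + ε / 16) * den A ^ 2 := by linarith
    exact le_of_mul_le_mul_right this hα2
  nlinarith

lemma main_abstract (X Y D : Finset G) (hX : X.Nonempty) (hY : Y.Nonempty) (hD : D.Nonempty)
    (ε : ℝ) (hε0 : 0 < ε) (hε1 : ε < 1 / 2)
    (P R E r : ℕ) (hP : 1 ≤ P) (hR : 1 ≤ R) (hE1 : 1 ≤ E)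
    (hR' : 1 / ε ≤ 2 ^ R) (hE : 1 / ε ≤ E) (hPA : (1 / 2 : ℝ) ^ P ≤ den X * den Y * den D)
    (hr : 7 * 566 ^ 2 * (3072 * 575) ^ 2 * (P ^ 8 * R ^ 4 * E ^ 6) ≤ r)
    (hspX : Spread X r (ε / 16)) (hspY : Spread Y r (ε / 16)) :
    |𝔼 x ∈ D, cv (bal X) (bal Y) x| ≤ ε := by
  have x0 := den_pos hX
  have y0 := den_pos hY
  have d0 := den_pos hD
  have x1 := den_le_one X
  have y1 := den_le_one Y
  have d1 := den_le_one D
  have hxy : den X * den Y ≤ 1 := mul_le_one₀ x1 y0.le y1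
  have hPX : (1 / 2 : ℝ) ^ P ≤ den X := by
    refine hPA.trans ?_
    rw [mul_assoc]
    exact mul_le_of_le_one_right x0.le (mul_le_one₀ y1 d0.le d1)
  have hPY : (1 / 2 : ℝ) ^ P ≤ den Y := by
    refine hPA.trans ?_
    rw [mul_comm (den X), mul_assoc]
    exact mul_le_of_le_one_right y0.le (mul_le_one₀ x1 d0.le d1)
  have hPD : (1 / 2 : ℝ) ^ P ≤ den D := hPA.trans (mul_le_of_le_one_left d0.le hxy)
  have hPD2 : (1 / 2 : ℝ) ^ (2 * P) ≤ den D :=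
    le_trans (pow_le_pow_of_le_one (by norm_num) (by norm_num) (by omega)) hPD
  have cX := core X hX ε hε0 hε1 P R E r hP hR hE1 hR' hE hPX hr hspX
  have cY := core Y hY ε hε0 hε1 P R E r hP hR hE1 hR' hE hPY hr hspY
  have hdec := decouple (bal X) (bal Y) (2 * P)
  have h1 : (𝔼 z, cv (bal X) (bal Y) z ^ (2 * P)) ^ 2 ≤ ((ε / 2) ^ (2 * P)) ^ 2 := by
    refine hdec.trans ?_
    rw [sq ((ε / 2) ^ (2 * P))]
    exact mul_le_mul cX cY (spectral_nonneg _ _) (by positivity)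
  have h2 := abs_le_of_sq_le_sq' h1 (by positivity)
  have h3 := pairing D (cv (bal X) (bal Y)) (2 * P) (even_two_mul P) (by omega) (ε / 2)
    (by positivity) hPD2 h2.2
  linarith

lemma count_eq (X Y D : Finset G) (hX : X.Nonempty) (hY : Y.Nonempty) (hD : D.Nonempty) :
    (#(Finset.univ.filter (fun p : G × G => p.1 ∈ X ∧ p.2 ∈ Y ∧ p.1 + p.2 ∈ D)) : ℝ) =
      (den X * den Y * den D) * (Fintype.card G : ℝ) ^ 2 *
        (1 + 𝔼 x ∈ D, cv (bal X) (bal Y) x) := by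
  have hN := card_pos' (G := G)
  have x0 := den_pos hX
  have y0 := den_pos hY
  have e1 : den D * (1 + 𝔼 x ∈ D, cv (bal X) (bal Y) x) =
      𝔼 z, ind D z * (cv (ind X) (ind Y) z / (den X * den Y)) := by
    rw [expect_ind_mul]
    congr 1
    simp_rw [← cv_bal X Y hX hY]
    rw [Finset.expect_add_distrib, Finset.expect_const hD]
  have e2 : 𝔼 z, ind D z * (cv (ind X) (ind Y) z / (den X * den Y)) =
      (𝔼 z, ind D z * cv (ind X) (ind Y) z) / (den X * den Y) := by
    rw [Finset.expect_div]
    simp_rw [mul_div_assoc]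
  have e3 : 𝔼 z, ind D z * cv (ind X) (ind Y) z =
      𝔼 x, 𝔼 y, ind X x * ind Y y * ind D (x + y) := by
    unfold cv
    simp_rw [Finset.mul_expect]
    rw [Finset.expect_comm]
    apply Finset.expect_congr rfl
    intro x _
    refine Fintype.expect_equiv (Equiv.addLeft x) _ _ (fun z => ?_)
    simp only [Equiv.coe_addLeft]
    rw [← add_assoc, ZModModule.add_self, zero_add]
    ring
  have e4 : (𝔼 x, 𝔼 y, ind X x * ind Y y * ind D (x + y)) * (Fintype.card G : ℝ) ^ 2 =
      (#(Finset.univ.filter (fun p : G × G => p.1 ∈ X ∧ p.2 ∈ Y ∧ p.1 + p.2 ∈ D)) : ℝ) := by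
    simp_rw [Fintype.expect_eq_sum_div_card]
    rw [← Finset.sum_div]
    have : ∀ x y : G, ind X x * ind Y y * ind D (x + y) =
        if x ∈ X ∧ y ∈ Y ∧ x + y ∈ D then 1 else 0 := by
      intro x y
      unfold ind
      by_cases h1 : x ∈ X <;> by_cases h2 : y ∈ Y <;> by_cases h3 : x + y ∈ D <;> simp [h1, h2, h3]
    simp_rw [this]
    rw [Finset.card_filter, Fintype.sum_prod_type]
    push_cast
    field_simp
  rw [← e4, ← e3]
  have e5 : 𝔼 z, ind D z * cv (ind X) (ind Y) z =
      den D * (1 + 𝔼 x ∈ D, cv (bal X) (bal Y) x) * (den X * den Y) := by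
    rw [e1, e2]; field_simp
  rw [e5]; ring

lemma choose_params (ε δ : ℝ) (hε0 : 0 < ε) (hε1 : ε < 1 / 2) (hδ0 : 0 < δ) (hδ1 : δ ≤ 1) :
    ∃ P R E : ℕ, 1 ≤ P ∧ 1 ≤ R ∧ 1 ≤ E ∧ 1 / ε ≤ 2 ^ R ∧ 1 / ε ≤ E ∧ (1 / 2 : ℝ) ^ P ≤ δ ∧
      (P ^ 8 * R ^ 4 * E ^ 6 : ℝ) ≤ 4 ^ 8 * 9 ^ 4 * 2 ^ 6 * (ε⁻¹ ^ 7 * Real.log (2 / δ) ^ 8) := by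
  have hlog2 := Real.log_two_gt_d9
  set L := Real.log (2 / δ) with hL
  have hLeq : L = Real.log 2 + Real.log (1 / δ) := by
    rw [hL, ← Real.log_mul (by norm_num) (by positivity)]; congr 1; ring
  have hld : 0 ≤ Real.log (1 / δ) := Real.log_nonneg (by rw [le_div_iff₀ hδ0]; linarith)
  have hLhalf : 1 / 2 ≤ L := by linarith
  have hi1 : 1 ≤ ε⁻¹ := (one_le_inv₀ hε0).2 (by linarith)
  set w := Real.sqrt (Real.sqrt ε⁻¹) with hw
  have hw1 : 1 ≤ w := by
    rw [hw, Real.one_le_sqrt, Real.one_le_sqrt]; exact hi1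
  have hw4 : w ^ 4 = ε⁻¹ := by
    have : w ^ 4 = (w ^ 2) ^ 2 := by ring
    rw [this, hw, Real.sq_sqrt (Real.sqrt_nonneg _), Real.sq_sqrt (by positivity)]
  have hlogw : Real.log ε⁻¹ ≤ 4 * w := by
    rw [← hw4, Real.log_pow]
    have := Real.log_le_self (by linarith : 0 ≤ w)
    push_cast
    linarith
  have hP1 : 2 * L ≤ (⌈2 * L⌉₊ : ℝ) := Nat.le_ceil _
  have hP2 : (⌈2 * L⌉₊ : ℝ) < 2 * L + 1 := Nat.ceil_lt_add_one (by linarith)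
  have hR1 : 8 * w ≤ (⌈8 * w⌉₊ : ℝ) := Nat.le_ceil _
  have hR2 : (⌈8 * w⌉₊ : ℝ) < 8 * w + 1 := Nat.ceil_lt_add_one (by linarith)
  have hE1 : ε⁻¹ ≤ (⌈ε⁻¹⌉₊ : ℝ) := Nat.le_ceil _
  have hE2 : (⌈ε⁻¹⌉₊ : ℝ) < ε⁻¹ + 1 := Nat.ceil_lt_add_one (by linarith)
  refine ⟨⌈2 * L⌉₊, ⌈8 * w⌉₊, ⌈ε⁻¹⌉₊, ?_, ?_, ?_, ?_, ?_, ?_, ?_⟩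
  · exact Nat.one_le_iff_ne_zero.2 (Nat.ceil_pos.2 (by linarith)).ne'
  · exact Nat.one_le_iff_ne_zero.2 (Nat.ceil_pos.2 (by linarith)).ne'
  · exact Nat.one_le_iff_ne_zero.2 (Nat.ceil_pos.2 (by linarith)).ne'
  · rw [one_div, ← Real.log_le_log_iff (by positivity) (by positivity), Real.log_pow]
    nlinarith
  · rw [one_div]; exact hE1
  · rw [← Real.log_le_log_iff (by positivity) hδ0, Real.log_pow]
    have h1 : Real.log (1 / 2) = - Real.log 2 := by rw [one_div, Real.log_inv]
    have h2 : Real.log (1 / δ) = - Real.log δ := by rw [one_div, Real.log_inv]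
    rw [h1]
    nlinarith
  · calc ((⌈2 * L⌉₊ : ℝ) ^ 8 * (⌈8 * w⌉₊ : ℝ) ^ 4 * (⌈ε⁻¹⌉₊ : ℝ) ^ 6)
        ≤ (4 * L) ^ 8 * (9 * w) ^ 4 * (2 * ε⁻¹) ^ 6 := by
          gcongr <;> linarith
      _ = 4 ^ 8 * 9 ^ 4 * 2 ^ 6 * (w ^ 4 * ε⁻¹ ^ 6 * L ^ 8) := by ring
      _ = _ := by rw [hw4]; ring

end part4
end KM

namespace KM
open Finset
open scoped BigOperators
section part5

lemma card_transfer {α β : Type*} [DecidableEq α] (S : Set β) (F : Finset α) (f : α → β)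
    (hf : Function.Injective f) (h1 : ∀ b, b ∈ S ↔ ∃ a ∈ F, f a = b) :
    Nat.card ↥S = #F := by
  have : S = f '' (F : Set α) := by
    ext b
    simp [h1]
  rw [this, Nat.card_image_of_injective hf]
  simp

variable {n : ℕ} {W : Submodule (ZMod 2) (Fin n → ZMod 2)} [Fintype W] [DecidableEq W]

lemma card_restrict {X : Set (Fin n → ZMod 2)} (hXW : X ⊆ (W : Set (Fin n → ZMod 2)))
    (XF : Finset W) (hXF : ∀ w : W, w ∈ XF ↔ (w : Fin n → ZMod 2) ∈ X) :
    Nat.card ↥X = #XF := by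
  apply card_transfer X XF (fun w => (w : Fin n → ZMod 2)) Subtype.val_injective
  intro b
  constructor
  · intro hb
    exact ⟨⟨b, hXW hb⟩, (hXF _).2 hb, rfl⟩
  · rintro ⟨a, ha, rfl⟩
    exact (hXF a).1 ha

lemma spread_transfer {X : Set (Fin n → ZMod 2)} (hXW : X ⊆ (W : Set (Fin n → ZMod 2)))
    (XF : Finset W) (hXF : ∀ w : W, w ∈ XF ↔ (w : Fin n → ZMod 2) ∈ X) (r : ℕ) (ε : ℝ)
    (h : AlgebraicallySpread n W X r ε) : Spread XF r ε := by
  intro V VF w hVF hfin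
  have hinj : Function.Injective W.subtype := W.injective_subtype
  have e := Submodule.equivMapOfInjective W.subtype hinj V
  have key := h (V.map W.subtype) (w : Fin n → ZMod 2) ?_ ?_
  · have c1 : Nat.card ↥(V.map W.subtype) = #VF := by
      rw [← Nat.card_congr e.toEquiv]
      apply card_transfer (V : Set W) VF id Function.injective_id
      intro b
      simp [hVF]
    have c2 : Nat.card ↥(X ∩ (((w : Fin n → ZMod 2) + ·) ''
        ((V.map W.subtype : Submodule (ZMod 2) (Fin n → ZMod 2)) : Set (Fin n → ZMod 2))))
        = #(VF.filter (fun v => w + v ∈ XF)) := by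
      apply card_transfer _ _ (fun v : W => (w : Fin n → ZMod 2) + (v : Fin n → ZMod 2))
      · intro a b hab
        exact Subtype.ext (add_left_cancel hab)
      · intro b
        constructor
        · rintro ⟨hb, x, ⟨v, hv, rfl⟩, rfl⟩
          exact ⟨v, by
            rw [mem_filter, hVF, hXF]
            exact ⟨hv, hb⟩, rfl⟩
        · rintro ⟨v, hv, rfl⟩
          rw [mem_filter, hVF, hXF] at hv
          exact ⟨hv.2, _, ⟨v, hv.1, rfl⟩, rfl⟩
    rw [c1, c2, card_restrict hXW XF hXF, Nat.card_eq_fintype_card] at key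
    have : 𝔼 v ∈ VF, ind XF (w + v) = (#(VF.filter (fun v => w + v ∈ XF)) : ℝ) / (#VF : ℝ) := by
      rw [Finset.expect_eq_sum_div_card]
      congr 1
      simp [ind, Finset.sum_ite]
    rw [this]
    exact key
  · rintro _ ⟨x, ⟨v, hv, rfl⟩, rfl⟩
    exact (w + v).2
  · rw [← e.finrank_eq]
    exact hfin

lemma container_card {X Y D : Set (Fin n → ZMod 2)} (hXW : X ⊆ (W : Set (Fin n → ZMod 2)))
    (hYW : Y ⊆ (W : Set (Fin n → ZMod 2)))
    (XF YF DF : Finset W) (hXF : ∀ w : W, w ∈ XF ↔ (w : Fin n → ZMod 2) ∈ X)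
    (hYF : ∀ w : W, w ∈ YF ↔ (w : Fin n → ZMod 2) ∈ Y)
    (hDF : ∀ w : W, w ∈ DF ↔ (w : Fin n → ZMod 2) ∈ D) :
    Nat.card ↥(Container n X Y D) =
      #(univ.filter (fun p : W × W => p.1 ∈ XF ∧ p.2 ∈ YF ∧ p.1 + p.2 ∈ DF)) := by
  apply card_transfer _ _ (fun p : W × W => ((p.1 : Fin n → ZMod 2), (p.2 : Fin n → ZMod 2)))
  · rintro ⟨a, b⟩ ⟨c, d⟩ h
    simp only [Prod.mk.injEq] at h
    exact Prod.ext (Subtype.ext h.1) (Subtype.ext h.2)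
  · rintro ⟨a, b⟩
    constructor
    · rintro ⟨ha, hb, hab⟩
      refine ⟨(⟨a, hXW ha⟩, ⟨b, hYW hb⟩), ?_, rfl⟩
      simp only [mem_filter, mem_univ, true_and, hXF, hYF, hDF]
      exact ⟨ha, hb, hab⟩
    · rintro ⟨p, hp, hpe⟩
      simp only [mem_filter, mem_univ, true_and, hXF, hYF, hDF] at hp
      rw [← hpe]
      exact hp

end part5
end KM

/-- Lemma 5.6 of the paper: two-sided bound on the size of the container
`S(X, Y, D)` when both `X` and `Y` are algebraically spread. -/
theorem container_size_two_sided_bound :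
    ∃ C : ℝ, 0 < C ∧
      ∀ (n : ℕ) (W : Submodule (ZMod 2) (Fin n → ZMod 2))
        (X Y D : Set (Fin n → ZMod 2)) (δ ε : ℝ) (r : ℕ),
        X.Nonempty → Y.Nonempty → D.Nonempty →
        X ⊆ (W : Set (Fin n → ZMod 2)) → Y ⊆ (W : Set (Fin n → ZMod 2)) →
        D ⊆ (W : Set (Fin n → ZMod 2)) →
        δ = (Nat.card ↥X : ℝ) * (Nat.card ↥Y : ℝ) * (Nat.card ↥D : ℝ) /
          (Nat.card ↥W : ℝ) ^ 3 →
        ε ∈ Set.Ioo (0 : ℝ) (1 / 2) →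
        C * ε⁻¹ ^ 7 * Real.log (2 / δ) ^ 8 ≤ (r : ℝ) →
        AlgebraicallySpread n W X r (ε / 16) →
        AlgebraicallySpread n W Y r (ε / 16) →
        (1 - ε) * δ * (Nat.card ↥W : ℝ) ^ 2 ≤ (Nat.card ↥(Container n X Y D) : ℝ) ∧
          (Nat.card ↥(Container n X Y D) : ℝ) ≤ (1 + ε) * δ * (Nat.card ↥W : ℝ) ^ 2 := by
  classical
  refine ⟨7 * 566 ^ 2 * (3072 * 575) ^ 2 * (4 ^ 8 * 9 ^ 4 * 2 ^ 6), by positivity, ?_⟩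
  intro n W X Y D δ ε r hX hY hD hXW hYW hDW hδ hε hr hsX hsY
  haveI : Fintype W := Fintype.ofFinite W
  obtain ⟨XF, hXF⟩ : ∃ F : Finset W, ∀ w : W, w ∈ F ↔ (w : Fin n → ZMod 2) ∈ X :=
    ⟨Finset.univ.filter (fun w : W => (w : Fin n → ZMod 2) ∈ X), by simp⟩
  obtain ⟨YF, hYF⟩ : ∃ F : Finset W, ∀ w : W, w ∈ F ↔ (w : Fin n → ZMod 2) ∈ Y :=
    ⟨Finset.univ.filter (fun w : W => (w : Fin n → ZMod 2) ∈ Y), by simp⟩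
  obtain ⟨DF, hDF⟩ : ∃ F : Finset W, ∀ w : W, w ∈ F ↔ (w : Fin n → ZMod 2) ∈ D :=
    ⟨Finset.univ.filter (fun w : W => (w : Fin n → ZMod 2) ∈ D), by simp⟩
  have nX : XF.Nonempty := by
    obtain ⟨x, hx⟩ := hX
    exact ⟨⟨x, hXW hx⟩, (hXF _).2 hx⟩
  have nY : YF.Nonempty := by
    obtain ⟨x, hx⟩ := hY
    exact ⟨⟨x, hYW hx⟩, (hYF _).2 hx⟩
  have nD : DF.Nonempty := by
    obtain ⟨x, hx⟩ := hD
    exact ⟨⟨x, hDW hx⟩, (hDF _).2 hx⟩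
  have hδ' : δ = KM.den XF * KM.den YF * KM.den DF := by
    rw [hδ, KM.card_restrict hXW XF hXF, KM.card_restrict hYW YF hYF,
      KM.card_restrict hDW DF hDF, Nat.card_eq_fintype_card]
    unfold KM.den
    ring
  have pX := KM.den_pos nX
  have pY := KM.den_pos nY
  have pD := KM.den_pos nD
  have hδ0 : 0 < δ := by rw [hδ']; positivity
  have hδ1 : δ ≤ 1 := by
    rw [hδ']
    have := mul_le_one₀ (mul_le_one₀ (KM.den_le_one XF) pY.le (KM.den_le_one YF)) pD.le
      (KM.den_le_one DF)
    exact this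
  obtain ⟨P, R, E, hP, hR, hE, hR', hE', hPδ, hPRE⟩ :=
    KM.choose_params ε δ hε.1 hε.2 hδ0 hδ1
  have hrN : 7 * 566 ^ 2 * (3072 * 575) ^ 2 * (P ^ 8 * R ^ 4 * E ^ 6) ≤ r := by
    have : (7 * 566 ^ 2 * (3072 * 575) ^ 2 * (P ^ 8 * R ^ 4 * E ^ 6) : ℝ) ≤ r := by
      refine le_trans (mul_le_mul_of_nonneg_left hPRE (by positivity)) (le_trans (le_of_eq ?_) hr)
      ring
    exact_mod_cast this
  rw [hδ'] at hPδ
  have main := KM.main_abstract XF YF DF nX nY nD ε hε.1 hε.2 P R E r hP hR hE hR' hE' hPδ hrN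
    (KM.spread_transfer hXW XF hXF r _ hsX) (KM.spread_transfer hYW YF hYF r _ hsY)
  rw [KM.container_card hXW hYW XF YF DF hXF hYF hDF, KM.count_eq XF YF DF nX nY nD, ← hδ',
    Nat.card_eq_fintype_card]
  obtain ⟨m1, m2⟩ := abs_le.1 main
  have hK : 0 ≤ δ * (Fintype.card W : ℝ) ^ 2 := by positivity
  constructor
  · nlinarith [mul_le_mul_of_nonneg_left m1 hK]
  · nlinarith [mul_le_mul_of_nonneg_left m2 hK]
end
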